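/- arXiv:1006.0129 — 3 statements merged into one kernel-verified Lean document; each statement's English description precedes it below -/
import Mathlib

section
/- Let G be a finite group, k a field of characteristic p > 0, M a finitely generated kG-module, and f a proper complexity function. Then c_{kG}(M) ≤ f if and only if c_{kE}(M) ≤ f for every elementary abelian p-subgroup E of G. (Alperin–Evens theorem, in the growth-rate formulation.) -/
open CategoryTheory

noncomputable section

/-- `f : ℕ → ℝ≥0` is a proper complexity function. -/
def IsProperComplexityFunction (f : ℕ → NNReal) : Prop :=
  ∀ n : ℤ, ∃ c : NNReal, ∀ m : ℕ, 0 ≤ (m : ℤ) + n → f ((m : ℤ) + n).toNat < c * f m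

/-- The module `P` can be generated by at most `b` elements over `R`. -/
def RankLE (R : Type) [Ring R] (P : Type) [AddCommGroup P] [Module R P] (b : NNReal) : Prop :=
  ∃ s : Finset P, Submodule.span R (s : Set P) = ⊤ ∧ (s.card : NNReal) ≤ b

/-- `c_R(M) ≤ f` : `M` has a projective resolution whose `n`-th term has rank at most
`d * f n` for some constant `d`. -/
def ComplexityLE (R : Type) [Ring R] (M : ModuleCat.{0} R) (f : ℕ → NNReal) : Prop :=
  ∃ (P : ProjectiveResolution M) (d : NNReal),
    ∀ n : ℕ, RankLE R (P.complex.X n) (d * f n)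

/-- `cds_R(M) ≤ f` : complexity at most `f` up to a direct summand. -/
def CdsLE (R : Type) [Ring R] (M : ModuleCat.{0} R) (f : ℕ → NNReal) : Prop :=
  ∃ N : ModuleCat.{0} R, ComplexityLE R (ModuleCat.of R (M × N)) f

/-- The ring homomorphism `k[H] →+* k[G]` induced by the inclusion of a subgroup `H ≤ G`. -/
def subgroupRingHom (k : Type) [Ring k] {G : Type} [Group G] (H : Subgroup G) :
    MonoidAlgebra k H →+* MonoidAlgebra k G :=
  MonoidAlgebra.mapDomainRingHom k H.subtype

/-- Restriction of a `k[G]`-module to a `k[H]`-module, `H ≤ G`. -/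
def resMod (k : Type) [Ring k] {G : Type} [Group G] (H : Subgroup G)
    (M : ModuleCat.{0} (MonoidAlgebra k G)) : ModuleCat.{0} (MonoidAlgebra k H) :=
  (ModuleCat.restrictScalars (subgroupRingHom k H)).obj M

/-- A group is elementary abelian if it is isomorphic to `(ℤ/p)^r` for a prime `p`. -/
def IsElementaryAbelian (Q : Type) [Group Q] : Prop :=
  ∃ (p r : ℕ), p.Prime ∧ Nonempty (Q ≃* Multiplicative (Fin r → ZMod p))

/-- A group is `p`-elementary abelian if it is isomorphic to `(ℤ/p)^r`. -/
def IsPElementaryAbelian (p : ℕ) (Q : Type) [Group Q] : Prop :=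
  ∃ r : ℕ,
  Nonempty (Q ≃* Multiplicative (Fin r → ZMod p))

section Homology

variable {k : Type} [Field k] {G H K : Type} [Group G] [Group H] [Group K]
  {U V W X : Type} [AddCommGroup U] [Module k U] [AddCommGroup V] [Module k V]
  [AddCommGroup W] [Module k W] [AddCommGroup X] [Module k X]

/-- Group homology with coefficients in an unbundled representation. -/
abbrev Hlgy (ρ : Representation k G V) (n : ℕ) : Type := groupHomology (Rep.of ρ) n

/-- The dimension of the `n`-th homology. -/
def betti (ρ : Representation k G V) (n : ℕ) : ℕ := Module.finrank k (Hlgy ρ n)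

/-- The map on homology induced by compatible maps of groups and of coefficients. -/
def hlgyMap {ρ : Representation k G V} {σ : Representation k H W} (φ : G →* H) (l : V →ₗ[k] W)
    (h : ∀ g v, l (ρ g v) = σ (φ g) (l v)) (n : ℕ) : Hlgy ρ n →ₗ[k] Hlgy σ n :=
  (groupHomology.map (A := Rep.of ρ) (B := Rep.of σ) φ
    (Rep.ofHom (ρ := ρ) (σ := σ.comp φ) ⟨l, fun g => LinearMap.ext (h g)⟩) n).hom

theorem hlgyMap_id (ρ : Representation k G V) (n : ℕ) :
    hlgyMap (ρ := ρ) (σ := ρ) (MonoidHom.id G) LinearMap.id (fun _ _ => rfl) n =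
      LinearMap.id := by
  have := groupHomology.map_id (A := Rep.of ρ) (n := n)
  exact congrArg ModuleCat.Hom.hom this

theorem hlgyMap_comp {ρ : Representation k G V} {σ : Representation k H W}
    {τ : Representation k K X} (φ : G →* H) (ψ : H →* K) (l : V →ₗ[k] W) (m : W →ₗ[k] X)
    (hl : ∀ g v, l (ρ g v) = σ (φ g) (l v)) (hm : ∀ g v, m (σ g v) = τ (ψ g) (m v))
    (n : ℕ) :
    hlgyMap (ψ.comp φ) (m ∘ₗ l) (fun g v => by simp [hl, hm]) n =
      hlgyMap ψ m hm n ∘ₗ hlgyMap φ l hl n := by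
  have := groupHomology.map_comp (A := Rep.of ρ) (B := Rep.of σ) (C := Rep.of τ) φ ψ
    (Rep.ofHom (ρ := ρ) (σ := σ.comp φ) ⟨l, fun g => LinearMap.ext (hl g)⟩)
    (Rep.ofHom (ρ := σ) (σ := τ.comp ψ) ⟨m, fun g => LinearMap.ext (hm g)⟩) n
  exact congrArg ModuleCat.Hom.hom this

instance hlgy_finite [Finite G] (ρ : Representation k G V) [FiniteDimensional k V] (n : ℕ) :
    FiniteDimensional k (Hlgy ρ n) := by
  have : FiniteDimensional k ((groupHomology.inhomogeneousChains (Rep.of ρ)).X n) :=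
    inferInstanceAs (FiniteDimensional k ((Fin n → G) →₀ V))
  have h1 : FiniteDimensional k ((groupHomology.inhomogeneousChains (Rep.of ρ)).cycles n) :=
    FiniteDimensional.of_injective
      ((groupHomology.inhomogeneousChains (Rep.of ρ)).iCycles n).hom
      ((ModuleCat.mono_iff_injective _).1 inferInstance)
  exact FiniteDimensional.of_surjective
      ((groupHomology.inhomogeneousChains (Rep.of ρ)).homologyπ n).hom
      ((ModuleCat.epi_iff_surjective _).1 inferInstance)

theorem hlgyMap_les {ρ : Representation k G V} {σ : Representation k G W}
    {τ : Representation k G X} (l : V →ₗ[k] W) (m : W →ₗ[k] X)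
    (hl : ∀ g v, l (ρ g v) = σ g (l v)) (hm : ∀ g v, m (σ g v) = τ g (m v))
    (il : Function.Injective l) (sm : Function.Surjective m) (ex : Function.Exact l m) :
    (∀ n, Function.Exact (hlgyMap (MonoidHom.id G) l hl n) (hlgyMap (MonoidHom.id G) m hm n)) ∧
    ∃ δ : ∀ n, Hlgy τ (n + 1) →ₗ[k] Hlgy ρ n,
      (∀ n, Function.Exact (hlgyMap (MonoidHom.id G) m hm (n + 1)) (δ n)) ∧
      (∀ n, Function.Exact (δ n) (hlgyMap (MonoidHom.id G) l hl n)) := by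
  let f : Rep.of ρ ⟶ Rep.of σ := Rep.ofHom ⟨l, fun g => LinearMap.ext (hl g)⟩
  let g : Rep.of σ ⟶ Rep.of τ := Rep.ofHom ⟨m, fun g => LinearMap.ext (hm g)⟩
  have hz : f ≫ g = 0 := by
    ext v
    exact ex.apply_apply_eq_zero v
  let S : ShortComplex (Rep k G) := ⟨f, g, hz⟩
  have hS : S.ShortExact := by
    have hmono : Mono f := (Rep.mono_iff_injective f).2 il
    have hepi : Epi g := (Rep.epi_iff_surjective g).2 sm
    refine ⟨(S.exact_map_iff_of_faithful (forget₂ (Rep k G) (ModuleCat k))).1 ?_⟩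
    rw [ShortComplex.ShortExact.moduleCat_exact_iff_function_exact]
    exact ex
  refine ⟨fun n => ?_, fun n => (groupHomology.δ hS (n + 1) n rfl).hom, fun n => ?_, fun n => ?_⟩
  · have := groupHomology.mapShortComplex₂_exact hS n
    rw [ShortComplex.ShortExact.moduleCat_exact_iff_function_exact] at this
    exact this
  · have := groupHomology.mapShortComplex₃_exact hS (i := n+1) (j := n) rfl
    rw [ShortComplex.ShortExact.moduleCat_exact_iff_function_exact] at this
    exact this
  · have := groupHomology.mapShortComplex₁_exact hS (i := n+1) (j := n) rfl
    rw [ShortComplex.ShortExact.moduleCat_exact_iff_function_exact] at this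
    exact this

theorem hlgyMap_zero_surjective {ρ : Representation k G V} {σ : Representation k G W}
    (l : V →ₗ[k] W) (hl : ∀ g v, l (ρ g v) = σ g (l v)) (sl : Function.Surjective l) :
    Function.Surjective (hlgyMap (MonoidHom.id G) l hl 0) := by
  let f : Rep.of ρ ⟶ Rep.of σ := Rep.ofHom ⟨l, fun g => LinearMap.ext (hl g)⟩
  have hepi : Epi f := (Rep.epi_iff_surjective f).2 sl
  exact (ModuleCat.epi_iff_surjective _).1 (groupHomology.epi_map_0_of_epi f)

end Homology

section Betti

variable {k : Type} [Field k] {G H K : Type} [Group G] [Group H] [Group K]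
  {U V W X : Type} [AddCommGroup U] [Module k U] [AddCommGroup V] [Module k V]
  [AddCommGroup W] [Module k W] [AddCommGroup X] [Module k X]

theorem hlgyMap_injective_of_leftInverse {ρ : Representation k G V} {σ : Representation k H W}
    (φ : G →* H) (l : V →ₗ[k] W) (hl : ∀ g v, l (ρ g v) = σ (φ g) (l v))
    (ψ : H →* G) (m : W →ₗ[k] V) (hm : ∀ g v, m (σ g v) = ρ (ψ g) (m v))
    (hφ : ψ.comp φ = MonoidHom.id G) (hml : m ∘ₗ l = LinearMap.id) (n : ℕ) :
    Function.Injective (hlgyMap φ l hl n) := by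
  have h := hlgyMap_comp φ ψ l m hl hm n
  have h' : hlgyMap (ψ.comp φ) (m ∘ₗ l) (fun g v => by simp [hl, hm]) n =
      (LinearMap.id : Hlgy ρ n →ₗ[k] Hlgy ρ n) := by
    rw [← hlgyMap_id ρ n]
    congr!
  rw [h] at h'
  exact Function.LeftInverse.injective (g := hlgyMap ψ m hm n) (LinearMap.congr_fun h')

theorem betti_le_of_retract [Finite H] [FiniteDimensional k W]
    {ρ : Representation k G V} {σ : Representation k H W}
    (φ : G →* H) (l : V →ₗ[k] W) (hl : ∀ g v, l (ρ g v) = σ (φ g) (l v))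
    (ψ : H →* G) (m : W →ₗ[k] V) (hm : ∀ g v, m (σ g v) = ρ (ψ g) (m v))
    (hφ : ψ.comp φ = MonoidHom.id G) (hml : m ∘ₗ l = LinearMap.id) (n : ℕ) :
    betti ρ n ≤ betti σ n :=
  LinearMap.finrank_le_finrank_of_injective
    (hlgyMap_injective_of_leftInverse φ l hl ψ m hm hφ hml n)

theorem betti_congr [Finite G] [Finite H] [FiniteDimensional k V] [FiniteDimensional k W]
    {ρ : Representation k G V} {σ : Representation k H W}
    (φ : G ≃* H) (l : V ≃ₗ[k] W) (hl : ∀ g v, l (ρ g v) = σ (φ g) (l v)) (n : ℕ) :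
    betti ρ n = betti σ n := by
  have hm : ∀ h w, l.symm (σ h w) = ρ (φ.symm h) (l.symm w) := fun h w => by
    rw [LinearEquiv.symm_apply_eq, hl]; simp
  apply le_antisymm
  · exact betti_le_of_retract φ.toMonoidHom l.toLinearMap hl φ.symm.toMonoidHom
      l.symm.toLinearMap hm (by ext; simp) (by ext; simp) n
  · exact betti_le_of_retract φ.symm.toMonoidHom l.symm.toLinearMap hm φ.toMonoidHom
      l.toLinearMap hl (by ext; simp) (by ext; simp) n

theorem finrank_le_of_exact [FiniteDimensional k U] [FiniteDimensional k V]
    [FiniteDimensional k W] (a : U →ₗ[k] V) (b : V →ₗ[k] W) (h : Function.Exact a b) :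
    Module.finrank k V ≤ Module.finrank k U + Module.finrank k W := by
  have h1 := LinearMap.finrank_range_add_finrank_ker b
  have h2 := LinearMap.finrank_range_le a
  rw [← LinearMap.exact_iff.1 h] at h2
  have h3 := Submodule.finrank_le (LinearMap.range b)
  omega

section SES

variable [Finite G] [FiniteDimensional k V] [FiniteDimensional k W] [FiniteDimensional k X]
  {ρ : Representation k G V} {σ : Representation k G W}
  {τ : Representation k G X} (l : V →ₗ[k] W) (m : W →ₗ[k] X)
  (hl : ∀ g v, l (ρ g v) = σ g (l v)) (hm : ∀ g v, m (σ g v) = τ g (m v))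
  (il : Function.Injective l) (sm : Function.Surjective m) (ex : Function.Exact l m)

include hl hm il sm ex

theorem betti_middle_le (n : ℕ) : betti σ n ≤ betti ρ n + betti τ n :=
  finrank_le_of_exact _ _ ((hlgyMap_les l m hl hm il sm ex).1 n)

theorem betti_succ_right_le (n : ℕ) : betti τ (n + 1) ≤ betti σ (n + 1) + betti ρ n := by
  obtain ⟨-, δ, h, -⟩ := hlgyMap_les l m hl hm il sm ex
  exact finrank_le_of_exact _ _ (h n)

theorem betti_left_le (n : ℕ) : betti ρ n ≤ betti τ (n + 1) + betti σ n := by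
  obtain ⟨-, δ, -, h⟩ := hlgyMap_les l m hl hm il sm ex
  exact finrank_le_of_exact _ _ (h n)

omit [FiniteDimensional k V] [FiniteDimensional k W] in
theorem betti_left_le_of_eq_zero (n : ℕ) (h0 : hlgyMap (MonoidHom.id G) l hl n = 0) :
    betti ρ n ≤ betti τ (n + 1) := by
  obtain ⟨-, δ, -, h⟩ := hlgyMap_les l m hl hm il sm ex
  refine LinearMap.finrank_le_finrank_of_surjective (f := δ n) fun x => ?_
  exact (h n x).1 (by rw [h0]; rfl)

omit [FiniteDimensional k V] [FiniteDimensional k W] in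
theorem betti_succ_right_eq_of_injective (n : ℕ)
    (hj : ∀ n, Function.Injective (hlgyMap (MonoidHom.id G) m hm n)) :
    betti τ (n + 1) = betti σ (n + 1) + betti ρ n := by
  obtain ⟨h1, δ, h2, h3⟩ := hlgyMap_les l m hl hm il sm ex
  have sδ : Function.Surjective (δ n) := fun x => by
    refine (h3 n x).1 (hj n ?_)
    rw [map_zero]
    exact (h1 n).apply_apply_eq_zero x
  have e1 := LinearMap.finrank_range_add_finrank_ker (δ n)
  rw [LinearMap.range_eq_top.2 sδ, finrank_top, LinearMap.exact_iff.1 (h2 n),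
    LinearMap.finrank_range_of_inj (hj (n+1))] at e1
  unfold betti
  omega

omit [Finite G] [FiniteDimensional k V] [FiniteDimensional k W] [FiniteDimensional k X] in
theorem hlgyMap_zero_eq_zero (hj : Function.Injective (hlgyMap (MonoidHom.id G) m hm 0)) :
    hlgyMap (MonoidHom.id G) l hl 0 = 0 := by
  have h1 := (hlgyMap_les l m hl hm il sm ex).1 0
  ext x
  refine hj ?_
  rw [LinearMap.zero_apply, map_zero]
  exact h1.apply_apply_eq_zero x

end SES

theorem betti_zero_le_of_surjective [Finite G] [FiniteDimensional k V] [FiniteDimensional k W]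
    {ρ : Representation k G V} {σ : Representation k G W}
    (l : V →ₗ[k] W) (hl : ∀ g v, l (ρ g v) = σ g (l v)) (sl : Function.Surjective l) :
    betti σ 0 ≤ betti ρ 0 :=
  LinearMap.finrank_le_finrank_of_surjective (hlgyMap_zero_surjective l hl sl)

theorem betti_zero (ρ : Representation k G V) :
    betti ρ 0 = Module.finrank k (V ⧸ Representation.Coinvariants.ker ρ) :=
  (groupHomology.H0Iso (Rep.of ρ)).toLinearEquiv.finrank_eq

theorem betti_succ_of_subsingleton [Subsingleton G] (ρ : Representation k G V) (n : ℕ) :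
    betti ρ (n + 1) = 0 := by
  have := isZero_groupHomology_succ_of_subsingleton (Rep.of ρ) n
  have : Subsingleton (Hlgy ρ (n + 1)) := ModuleCat.subsingleton_of_isZero this
  exact Module.finrank_zero_of_subsingleton

theorem betti_coind [Finite G] (S : Subgroup G) (ρ : Representation k S V) (n : ℕ) :
    betti (Representation.coind S.subtype ρ) n = betti ρ n := by
  classical
  let e := groupHomology.indIso S (Rep.of ρ) n
  let e' := (groupHomology.functor k G n).mapIso (Rep.indCoindIso (S := S) (Rep.of ρ))
  exact (e'.symm ≪≫ e).toLinearEquiv.finrank_eq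

/-- Recognition of coinduced representations: Shapiro's lemma. -/
theorem betti_eq_of_coinduced [Finite G] [FiniteDimensional k V] [FiniteDimensional k W]
    (ρ : Representation k G V) (S : Subgroup G) (σ : Representation k S W)
    (l : V →ₗ[k] W) (hl : ∀ (s : S) v, l (ρ s v) = σ s (l v))
    (hinj : ∀ v, (∀ g, l (ρ g v) = 0) → v = 0)
    (hsurj : ∀ w, ∃ v, l v = w ∧ ∀ g, g ∉ S → l (ρ g v) = 0) (n : ℕ) :
    betti ρ n = betti σ n := by
  classical
  rw [← betti_coind S σ n]
  let Φ : V →ₗ[k] Representation.coindV S.subtype σ :=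
    { toFun := fun v => ⟨fun g => l (ρ g v), fun s g => by simp [hl]⟩
      map_add' := fun v w => by ext; simp
      map_smul' := fun c v => by ext; simp }
  have hΦ : Function.Bijective Φ := by
    constructor
    · rw [injective_iff_map_eq_zero]
      intro v hv
      exact hinj v fun g => congrFun (congrArg Subtype.val hv) g
    · rintro ⟨h, hh⟩
      choose F hF hF' using hsurj
      let := Fintype.ofFinite (Quotient (QuotientGroup.rightRel S))
      refine ⟨∑ q : Quotient (QuotientGroup.rightRel S), ρ (q.out)⁻¹ (F (h q.out)), ?_⟩
      ext g
      change l (ρ g (∑ q : Quotient (QuotientGroup.rightRel S), ρ (q.out)⁻¹ (F (h q.out)))) = h g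
      rw [map_sum, map_sum, Finset.sum_eq_single (Quotient.mk (QuotientGroup.rightRel S) g)]
      · set q := (Quotient.mk (QuotientGroup.rightRel S) g).out with hq
        have hmem : g * q⁻¹ ∈ S := by
          have : QuotientGroup.rightRel S q g := Quotient.mk_out g
          rwa [QuotientGroup.rightRel_apply] at this
        have h1 := hl ⟨_, hmem⟩ (F (h q))
        have h2 := hh ⟨_, hmem⟩ q
        simp only [map_mul, Module.End.mul_apply] at h1
        rw [h1, hF, ← h2]
        simp
      · intro q _ hne
        have := hF' (h q.out) (g * (q.out)⁻¹) (fun hmem => hne ?_)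
        · simpa using this
        · rw [← Quotient.out_eq q, Quotient.eq, QuotientGroup.rightRel_apply]
          exact hmem
      · simp
  exact betti_congr (MulEquiv.refl G) (LinearEquiv.ofBijective Φ hΦ) (fun g v => by
    ext x
    change l (ρ x (ρ g v)) = l (ρ (x * g) v)
    simp) n

end Betti

section LowerBound

variable {k : Type} [Field k] {p : ℕ} [Fact p.Prime] {G : Type} [Group G]
  {V : Type} [AddCommGroup V] [Module k V]

variable (p) in
/-- Functions on the cyclic group of order `p` with values in a representation of `G`, as a
representation of the product with the cyclic group. -/
def funRep (ρ : Representation k G V) :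
    Representation k (G × Multiplicative (ZMod p)) (ZMod p → V) where
  toFun γ := LinearMap.pi fun x => ρ γ.1 ∘ₗ LinearMap.proj (x - γ.2.toAdd)
  map_one' := by ext; simp
  map_mul' a b := by
    refine LinearMap.ext fun f => funext fun x => ?_
    simp [sub_sub]

@[simp]
theorem funRep_apply (ρ : Representation k G V) (γ : G × Multiplicative (ZMod p))
    (f : ZMod p → V) (x : ZMod p) : funRep p ρ γ f x = ρ γ.1 (f (x - γ.2.toAdd)) := rfl

variable (k p V) in
/-- Summation of a function on the cyclic group. -/
def sumMap : (ZMod p → V) →ₗ[k] V := ∑ x : ZMod p, LinearMap.proj x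

@[simp]
theorem sumMap_apply (f : ZMod p → V) : sumMap k p V f = ∑ x, f x := by simp [sumMap]

theorem sumMap_funRep (ρ : Representation k G V) (γ : G × Multiplicative (ZMod p))
    (f : ZMod p → V) : sumMap k p V (funRep p ρ γ f) =
      (ρ.comp (MonoidHom.fst G (Multiplicative (ZMod p)))) γ (sumMap k p V f) := by
  simp only [sumMap_apply, funRep_apply, ← map_sum]
  congr 1
  exact Fintype.sum_equiv (Equiv.subRight _) _ _ fun _ => rfl

variable (k p V) in
/-- The difference operator on functions on the cyclic group. -/
def diffMap : (ZMod p → V) →ₗ[k] (ZMod p → V) :=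
  LinearMap.pi fun x => LinearMap.proj (R := k) (φ := fun _ : ZMod p => V) (x - 1) -
    LinearMap.proj x

@[simp]
theorem diffMap_apply (f : ZMod p → V) (x : ZMod p) :
    diffMap k p V f x = f (x - 1) - f x := rfl

theorem diffMap_funRep (ρ : Representation k G V) (γ : G × Multiplicative (ZMod p))
    (f : ZMod p → V) : diffMap k p V (funRep p ρ γ f) = funRep p ρ γ (diffMap k p V f) := by
  ext x
  simp [sub_right_comm]

theorem sumMap_diffMap (f : ZMod p → V) : sumMap k p V (diffMap k p V f) = 0 := by
  simp only [sumMap_apply, diffMap_apply, Finset.sum_sub_distrib, sub_eq_zero]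
  exact Fintype.sum_equiv (Equiv.subRight 1) _ _ fun _ => rfl

variable (k p V) in
/-- Constant functions on the cyclic group. -/
def constMap : V →ₗ[k] (ZMod p → V) := LinearMap.pi fun _ => LinearMap.id

omit [Fact p.Prime] in
@[simp]
theorem constMap_apply (v : V) (x : ZMod p) : constMap k p V v x = v := rfl

theorem exact_constMap_diffMap : Function.Exact (constMap k p V) (diffMap k p V) := by
  intro f
  constructor
  · intro h
    have hs : ∀ x, f (x - 1) = f x := fun x => sub_eq_zero.1 (congrFun h x)
    have hn : ∀ n : ℕ, f n = f 0 := fun n => by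
      induction n with
      | zero => simp
      | succ n ih => rw [← ih, ← hs]; simp
    refine ⟨f 0, funext fun x => ?_⟩
    rw [constMap_apply, ← hn x.val, ZMod.natCast_zmod_val]
  · rintro ⟨v, rfl⟩
    ext x
    simp

variable (k p V) in
/-- The difference operator with values in the functions of sum zero. -/
def diffMap' : (ZMod p → V) →ₗ[k] LinearMap.ker (sumMap k p V) :=
  (diffMap k p V).codRestrict _ fun f => LinearMap.mem_ker.2 (sumMap_diffMap f)

theorem sumMap_surjective : Function.Surjective (sumMap k p V) := fun v => by
  classical
  exact ⟨Pi.single 0 v, by simp⟩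

theorem diffMap'_surjective [FiniteDimensional k V] :
    Function.Surjective (diffMap' k p V) := by
  rw [← LinearMap.range_eq_top]
  apply Submodule.eq_top_of_finrank_eq
  have h1 := LinearMap.finrank_range_add_finrank_ker (diffMap' k p V)
  have h2 := LinearMap.finrank_range_add_finrank_ker (sumMap k p V)
  have h3 : LinearMap.ker (diffMap' k p V) = LinearMap.range (constMap k p V) := by
    rw [diffMap', LinearMap.ker_codRestrict]
    exact LinearMap.exact_iff.1 exact_constMap_diffMap
  have h4 : Function.Injective (constMap k p V) := fun a b h => congrFun h 0
  rw [h3, LinearMap.finrank_range_of_inj h4] at h1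
  rw [LinearMap.range_eq_top.2 sumMap_surjective, finrank_top] at h2
  omega

variable (p) in
/-- The representation on functions of sum zero. -/
def funRepKer (ρ : Representation k G V) :
    Representation k (G × Multiplicative (ZMod p)) (LinearMap.ker (sumMap k p V)) where
  toFun γ := (funRep p ρ γ).restrict fun f hf => by
    rw [LinearMap.mem_ker, sumMap_funRep, LinearMap.mem_ker.1 hf, map_zero]
  map_one' := by ext; simp
  map_mul' a b := by ext; simp [sub_sub]

theorem betti_funRep [Finite G] [FiniteDimensional k V] (ρ : Representation k G V) (n : ℕ) :
    betti (funRep p ρ) n = betti ρ n := by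
  classical
  let S : Subgroup (G × Multiplicative (ZMod p)) := (MonoidHom.inl G _).range
  let e : G ≃* S := MonoidHom.ofInjective (f := MonoidHom.inl G (Multiplicative (ZMod p)))
    (fun a b h => (Prod.ext_iff.1 h).1)
  let σ : Representation k S V := ρ.comp e.symm.toMonoidHom
  rw [betti_eq_of_coinduced (funRep p ρ) S σ (LinearMap.proj 0) ?_ ?_ ?_ n]
  · refine (betti_congr e (LinearEquiv.refl k V) ?_ n).symm
    intro g v
    simp [σ]
  · intro s v
    obtain ⟨g, rfl⟩ := e.surjective s
    have : ((e g : S) : G × Multiplicative (ZMod p)) = (g, 1) := rfl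
    simp [σ, this]
  · intro f hf
    ext x
    simpa using hf (1, Multiplicative.ofAdd (-x))
  · intro w
    refine ⟨Pi.single 0 w, by simp, fun g hg => ?_⟩
    have : g.2.toAdd ≠ 0 := fun h => hg ⟨g.1, Prod.ext rfl (by
      change 1 = g.2
      rw [← ofAdd_toAdd g.2, h]; rfl)⟩
    simp [this]

theorem hlgyMap_sumMap_injective [Finite G] [FiniteDimensional k V]
    (ρ : Representation k G V) (n : ℕ) :
    Function.Injective (hlgyMap (MonoidHom.id _) (sumMap k p V) (sumMap_funRep ρ) n) := by
  classical
  have hδ : ∀ (g : G) v, LinearMap.single k (fun _ : ZMod p => V) 0 (ρ g v) =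
      funRep p ρ (MonoidHom.inl G (Multiplicative (ZMod p)) g)
        (LinearMap.single k (fun _ : ZMod p => V) 0 v) := fun g v => by
    ext x
    by_cases hx : x = 0
    · subst hx; simp
    · simp [hx]
  have h1 := hlgyMap_comp (MonoidHom.inl G (Multiplicative (ZMod p))) (MonoidHom.id _)
    (LinearMap.single k (fun _ : ZMod p => V) 0) (sumMap k p V) hδ (sumMap_funRep ρ) n
  have h2 := hlgyMap_injective_of_leftInverse (ρ := ρ)
    (σ := ρ.comp (MonoidHom.fst G (Multiplicative (ZMod p))))
    ((MonoidHom.id _).comp (MonoidHom.inl G (Multiplicative (ZMod p))))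
    (sumMap k p V ∘ₗ LinearMap.single k (fun _ : ZMod p => V) 0) (by intros; simp)
    (MonoidHom.fst _ _) LinearMap.id (by intros; simp) (by ext; simp) (by ext; simp) n
  rw [h1, LinearMap.coe_comp] at h2
  have h3 := h2.of_comp
  have h4 := (LinearMap.injective_iff_surjective_of_finrank_eq_finrank
    (betti_funRep (p := p) ρ n).symm).1 h3
  exact (Function.Injective.of_comp_iff' _ ⟨h3, h4⟩).1 h2

theorem hlgyMap_diffMap_injective [CharP k p] [Finite G] [FiniteDimensional k V]
    (ρ : Representation k G V) (n : ℕ) :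
    Function.Injective (hlgyMap (σ := funRepKer p ρ) (MonoidHom.id _) (diffMap' k p V)
      (fun γ f => Subtype.ext (diffMap_funRep ρ γ f)) n) := by
  let e : LinearMap.ker (sumMap k p V) →ₗ[k] V :=
    (∑ x : ZMod p, (ZMod.castHom dvd_rfl k x) • LinearMap.proj x) ∘ₗ Submodule.subtype _
  have he_apply : ∀ f, e f = ∑ x : ZMod p, (ZMod.castHom dvd_rfl k x) • f.1 x := fun f => by
    simp [e]
  have he : ∀ γ f, e (funRepKer p ρ γ f) =
      (ρ.comp (MonoidHom.fst G (Multiplicative (ZMod p)))) γ (e f) := by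
    rintro ⟨g, c⟩ ⟨f, hf⟩
    have hf' : ∑ x, f x = 0 := by simpa using hf
    rw [he_apply, he_apply]
    change ∑ x : ZMod p, (ZMod.castHom dvd_rfl k x) • ρ g (f (x - c.toAdd)) =
      ρ g (∑ x : ZMod p, (ZMod.castHom dvd_rfl k x) • f x)
    simp only [← map_smul, ← map_sum]
    congr 1
    calc ∑ x : ZMod p, (ZMod.castHom dvd_rfl k x) • (f (x - c.toAdd))
        = ∑ x : ZMod p, (ZMod.castHom dvd_rfl k (x + c.toAdd)) • f x :=
          Fintype.sum_equiv (Equiv.subRight c.toAdd) _ _ fun x => by simp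
      _ = _ := by
          simp only [map_add, add_smul, Finset.sum_add_distrib, ← Finset.smul_sum, hf', smul_zero,
            add_zero]
  have hcomp := hlgyMap_comp (ρ := funRep p ρ) (σ := funRepKer p ρ) (MonoidHom.id _)
    (MonoidHom.id _) (diffMap' k p V) e
    (fun γ f => Subtype.ext (diffMap_funRep ρ γ f)) he n
  have hed : e ∘ₗ diffMap' k p V = sumMap k p V := by
    refine LinearMap.ext fun f => ?_
    rw [LinearMap.comp_apply, he_apply, sumMap_apply]
    change ∑ x : ZMod p, (ZMod.castHom dvd_rfl k x) • (f (x - 1) - f x) = _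
    simp only [smul_sub, Finset.sum_sub_distrib]
    rw [sub_eq_iff_eq_add, ← Finset.sum_add_distrib]
    exact Fintype.sum_equiv (Equiv.subRight 1) _ _ fun x => by
      simp [sub_smul]
  have hinj : Function.Injective (hlgyMap (ρ := funRep p ρ)
      (σ := ρ.comp (MonoidHom.fst G (Multiplicative (ZMod p))))
      ((MonoidHom.id _).comp (MonoidHom.id _)) (e ∘ₗ diffMap' k p V)
      (fun γ f => by
        rw [hed]; exact sumMap_funRep ρ γ f) n) := by
    have := hlgyMap_sumMap_injective (p := p) ρ n
    convert this
    rfl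
  rw [hcomp, LinearMap.coe_comp] at hinj
  exact hinj.of_comp

theorem betti_add_two_ge [CharP k p] [Finite G] [FiniteDimensional k V]
    (ρ : Representation k G V) (n : ℕ) :
    betti ρ (n + 2) + betti (ρ.comp (MonoidHom.fst G (Multiplicative (ZMod p)))) n ≤
      betti (ρ.comp (MonoidHom.fst G (Multiplicative (ZMod p)))) (n + 2) := by
  have h1 := betti_succ_right_eq_of_injective (ρ := funRepKer p ρ)
    (Submodule.subtype (LinearMap.ker (sumMap k p V))) (sumMap k p V) (fun _ _ => rfl)
    (sumMap_funRep ρ) Subtype.val_injective sumMap_surjective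
    (LinearMap.exact_subtype_ker_map _) (n + 1) (hlgyMap_sumMap_injective ρ)
  have h2 := betti_succ_right_eq_of_injective
    (ρ := ρ.comp (MonoidHom.fst G (Multiplicative (ZMod p)))) (τ := funRepKer p ρ)
    (constMap k p V) (diffMap' k p V) (fun _ _ => rfl)
    (fun γ f => Subtype.ext (diffMap_funRep ρ γ f)) (fun a b h => congrFun h 0)
    diffMap'_surjective (fun f => by
      rw [← exact_constMap_diffMap (k := k) f, Subtype.ext_iff]; rfl)
    n (hlgyMap_diffMap_injective ρ)
  rw [betti_funRep] at h1
  change betti (ρ.comp _) (n + 2) = betti ρ (n + 2) + _ at h1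
  omega

theorem betti_add_two_mul_ge [CharP k p] [Finite G] [FiniteDimensional k V]
    (ρ : Representation k G V) (n q : ℕ) :
    betti ρ (n + 2 * (q + 1)) + betti (ρ.comp (MonoidHom.fst G (Multiplicative (ZMod p)))) n ≤
      betti (ρ.comp (MonoidHom.fst G (Multiplicative (ZMod p)))) (n + 2 * (q + 1)) := by
  induction q with
  | zero => exact betti_add_two_ge ρ n
  | succ q ih =>
    have := betti_add_two_ge (p := p) ρ (n + 2 * (q + 1))
    rw [show n + 2 * (q + 1 + 1) = n + 2 * (q + 1) + 2 by ring]
    omega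

end LowerBound

section SubRep

variable {k : Type} [Field k] {G : Type} [Group G]
  {V : Type} [AddCommGroup V] [Module k V]

theorem betti_of_subsingleton [Subsingleton V] (ρ : Representation k G V) (n : ℕ) :
    betti ρ n = 0 := by
  have h := (hlgyMap_les (ρ := ρ) (σ := ρ) (τ := ρ) LinearMap.id LinearMap.id (fun _ _ => rfl)
    (fun _ _ => rfl) Function.injective_id Function.surjective_id
    (fun v => ⟨fun _ => ⟨v, rfl⟩, fun _ => Subsingleton.elim _ _⟩)).1 n
  rw [hlgyMap_id] at h
  have : Subsingleton (Hlgy ρ n) :=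
    subsingleton_of_forall_eq 0 fun x => (h x).2 ⟨x, rfl⟩
  exact Module.finrank_zero_of_subsingleton

/-- The restriction of a representation to an invariant subspace. -/
def subRep (ρ : Representation k G V) (U : Submodule k V) (hU : ∀ g, ∀ v ∈ U, ρ g v ∈ U) :
    Representation k G U where
  toFun g := (ρ g).restrict (hU g)
  map_one' := by ext; simp
  map_mul' a b := by ext; simp

@[simp]
theorem subRep_coe (ρ : Representation k G V) (U : Submodule k V)
    (hU : ∀ g, ∀ v ∈ U, ρ g v ∈ U) (g : G) (u : U) : (subRep ρ U hU g u : V) = ρ g u := rfl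

end SubRep

section Monomial

variable {k : Type} [Field k] {G : Type} [Group G] {P : Type} [MulAction G P]
  {M : Type} [AddCommGroup M] [Module k M]

/-- The representation on functions `P → M`, twisted by a multiplicative cocycle. -/
def monRep (ρ : Representation k G M) (s : G → P → k) (hs1 : ∀ τ, s 1 τ = 1)
    (hs : ∀ g h τ, s (g * h) τ = s g (h • τ) * s h τ) : Representation k G (P → M) where
  toFun g := LinearMap.pi fun τ => s g (g⁻¹ • τ) • (ρ g ∘ₗ LinearMap.proj (g⁻¹ • τ))
  map_one' := by
    refine LinearMap.ext fun F => funext fun τ => ?_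
    simp [hs1]
  map_mul' a b := by
    refine LinearMap.ext fun F => funext fun τ => ?_
    simp [hs, mul_smul]

variable {ρ : Representation k G M} {s : G → P → k} {hs1 : ∀ τ, s 1 τ = 1}
    {hs : ∀ g h τ, s (g * h) τ = s g (h • τ) * s h τ}

theorem monRep_apply (g : G) (F : P → M) (τ : P) :
    monRep ρ s hs1 hs g F τ = s g (g⁻¹ • τ) • ρ g (F (g⁻¹ • τ)) := rfl

theorem monRep_apply_smul (g : G) (F : P → M) (τ : P) :
    monRep ρ s hs1 hs g F (g • τ) = s g τ • ρ g (F τ) := by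
  simp [monRep_apply]

variable (k M) in
/-- Functions supported on a given subset. -/
def supportedOn (T : Set P) : Submodule k (P → M) where
  carrier := {F | ∀ τ ∉ T, F τ = 0}
  add_mem' := fun ha hb τ hτ => by simp [ha τ hτ, hb τ hτ]
  zero_mem' := fun _ _ => rfl
  smul_mem' := fun c F hF τ hτ => by simp [hF τ hτ]

theorem monRep_mem_supportedOn {T : Set P} (hT : ∀ (g : G), ∀ τ ∈ T, g • τ ∈ T) (g : G)
    (F : P → M) (hF : F ∈ supportedOn k M T) :
    monRep ρ s hs1 hs g F ∈ supportedOn k M T := by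
  intro τ hτ
  rw [monRep_apply, hF, map_zero, smul_zero]
  intro h
  exact hτ (by simpa using hT g _ h)

variable [Finite G] [Finite P] [FiniteDimensional k M]

theorem betti_supportedOn_orbit (τ₀ : P)
    (hstab : ∀ g : G, g • τ₀ = τ₀ → s g τ₀ = 1)
    (h : ∀ (g : G), ∀ τ ∈ MulAction.orbit G τ₀, g • τ ∈ MulAction.orbit G τ₀) (n : ℕ) :
    betti (subRep (monRep ρ s hs1 hs) (supportedOn k M (MulAction.orbit G τ₀))
      (monRep_mem_supportedOn h)) n =
    betti (ρ.comp (MulAction.stabilizer G τ₀).subtype) n := by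
  classical
  have hne : ∀ g τ, s g τ ≠ 0 := fun g τ h0 => by
    have := hs g⁻¹ g τ
    simp [h0, hs1] at this
  refine betti_eq_of_coinduced _ (MulAction.stabilizer G τ₀) _
    (LinearMap.proj τ₀ ∘ₗ Submodule.subtype _) ?_ ?_ ?_ n
  · rintro ⟨g, hg⟩ ⟨F, hF⟩
    have hg' : g • τ₀ = τ₀ := hg
    have := monRep_apply_smul (ρ := ρ) (s := s) (hs1 := hs1) (hs := hs) g F τ₀
    rw [hg', hstab g hg', one_smul] at this
    exact this
  · rintro ⟨F, hF⟩ h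
    ext τ
    by_cases hτ : τ ∈ MulAction.orbit G τ₀
    · obtain ⟨g, rfl⟩ := hτ
      have h1 : monRep ρ s hs1 hs g⁻¹ F τ₀ = 0 := h g⁻¹
      rw [monRep_apply, inv_inv, smul_eq_zero_iff_right (hne _ _)] at h1
      have := congrArg (ρ g) h1
      simpa using this
    · exact hF τ hτ
  · intro w
    refine ⟨⟨Pi.single τ₀ w, fun τ hτ => ?_⟩, ?_, ?_⟩
    · rw [Pi.single_eq_of_ne]
      rintro rfl
      exact hτ (MulAction.mem_orbit_self τ)
    · simp
    · intro g hg
      change monRep ρ s hs1 hs g (Pi.single τ₀ w) τ₀ = 0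
      rw [monRep_apply, Pi.single_eq_of_ne, map_zero, smul_zero]
      intro h
      exact hg (by rw [MulAction.mem_stabilizer_iff]; nth_rw 1 [← h]; simp)

theorem betti_supportedOn_le (T : Set P) (hT : ∀ (g : G), ∀ τ ∈ T, g • τ ∈ T)
    (hstab : ∀ τ ∈ T, ∀ g : G, g • τ = τ → s g τ = 1) (n B : ℕ)
    (hB : ∀ τ ∈ T, betti (ρ.comp (MulAction.stabilizer G τ).subtype) n ≤ B) :
    betti (subRep (monRep ρ s hs1 hs) (supportedOn k M T) (monRep_mem_supportedOn hT)) n ≤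
      T.ncard * B := by
  classical
  induction hc : T.ncard using Nat.strong_induction_on generalizing T with
  | _ c ih =>
  subst hc
  rcases T.eq_empty_or_nonempty with rfl | ⟨τ₀, hτ₀⟩
  · have : Subsingleton (supportedOn k M (∅ : Set P)) := ⟨fun a b => by
      ext τ
      rw [a.2 τ (by simp), b.2 τ (by simp)]⟩
    rw [betti_of_subsingleton]
    exact Nat.zero_le _
  · set O := MulAction.orbit G τ₀ with hO
    have hOT : O ⊆ T := by
      rintro _ ⟨g, rfl⟩
      exact hT g _ hτ₀
    have hinvO : ∀ (g : G), ∀ τ ∈ O, g • τ ∈ O := by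
      rintro g _ ⟨h, rfl⟩
      exact ⟨g * h, mul_smul _ _ _⟩
    have hinvD : ∀ (g : G), ∀ τ ∈ T \ O, g • τ ∈ T \ O := by
      rintro g τ ⟨h1, h2⟩
      exact ⟨hT g _ h1, fun h => h2 (by simpa using hinvO g⁻¹ _ h)⟩
    have hcard : (T \ O).ncard + O.ncard = T.ncard :=
      Set.ncard_sdiff_add_ncard_of_subset hOT
    have hOpos : 0 < O.ncard := (Set.ncard_pos O.toFinite).2 ⟨τ₀, MulAction.mem_orbit_self τ₀⟩
    have h1 := ih (T \ O).ncard (by omega) (T \ O) hinvD (fun τ hτ => hstab τ hτ.1)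
      (fun τ hτ => hB τ hτ.1) rfl
    have h2 : betti (subRep (monRep ρ s hs1 hs) (supportedOn k M O)
        (monRep_mem_supportedOn hinvO)) n ≤ B :=
      (betti_supportedOn_orbit τ₀ (hstab τ₀ hτ₀) hinvO n).trans_le (hB τ₀ hτ₀)
    let r : supportedOn k M T →ₗ[k] supportedOn k M O :=
      { toFun := fun F => ⟨fun τ => if τ ∈ O then F.1 τ else 0, fun τ hτ => if_neg hτ⟩
        map_add' := fun a b => by
          ext τ
          by_cases h : τ ∈ O <;> simp [h]
        map_smul' := fun c a => by
          ext τ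
          by_cases h : τ ∈ O <;> simp [h] }
    have h4 := betti_middle_le
      (ρ := subRep (monRep ρ s hs1 hs) (supportedOn k M (T \ O)) (monRep_mem_supportedOn hinvD))
      (σ := subRep (monRep ρ s hs1 hs) (supportedOn k M T) (monRep_mem_supportedOn hT))
      (τ := subRep (monRep ρ s hs1 hs) (supportedOn k M O) (monRep_mem_supportedOn hinvO))
      (Submodule.inclusion fun F hF τ hτ => hF τ fun h => hτ h.1) r (fun _ _ => rfl)
      (fun g F => by
        ext τ
        by_cases h : τ ∈ O
        · have h' : g⁻¹ • τ ∈ O := hinvO _ _ h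
          simp [r, h, h', monRep_apply]
        · have h' : g⁻¹ • τ ∉ O := fun h'' => h (by simpa using hinvO g _ h'')
          simp [r, h, h', monRep_apply])
      (Submodule.inclusion_injective _)
      (fun F => ⟨⟨F.1, fun τ hτ => F.2 τ fun h => hτ (hOT h)⟩, by
        ext τ
        by_cases h : τ ∈ O
        · simp [r, h]
        · simp [r, h, F.2 τ h]⟩)
      (fun F => by
        constructor
        · intro h
          refine ⟨⟨F.1, fun τ hτ => ?_⟩, rfl⟩
          by_cases hτO : τ ∈ O
          · have : (r F).1 τ = 0 := by rw [h]; rfl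
            simpa [r, hτO] using this
          · exact F.2 τ fun h => hτ ⟨h, hτO⟩
        · rintro ⟨F', rfl⟩
          ext τ
          by_cases h : τ ∈ O
          · simp [r, h]
            exact F'.2 τ (fun h' => h'.2 h)
          · simp [r, h]) n
    calc _ ≤ (T \ O).ncard * B + B := by omega
      _ ≤ (T \ O).ncard * B + O.ncard * B := by gcongr; exact Nat.le_mul_of_pos_left _ hOpos
      _ = T.ncard * B := by rw [← hcard]; ring

end Monomial

section Complex

variable {k : Type} [Field k] {G : Type} [Group G] [Finite G]
  {V : Type} [AddCommGroup V] [Module k V] [FiniteDimensional k V]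
  {M : Type} [AddCommGroup M] [Module k M] [FiniteDimensional k M]

/-- Dimension shifting along an exact complex whose terms are subspaces `U i` of a fixed space. -/
theorem betti_le_sum_of_exact (ρ : Representation k G V) (τ : Representation k G M)
    (U : ℕ → Submodule k V) (hU : ∀ i g, ∀ v ∈ U i, ρ g v ∈ U i)
    (d : V →ₗ[k] V) (hd : ∀ g v, d (ρ g v) = ρ g (d v))
    (hdU : ∀ i, ∀ v ∈ U i, d v ∈ U (i + 1)) (hdd : ∀ v, d (d v) = 0) (N : ℕ)
    (ε : V →ₗ[k] M) (hε : ∀ g v, ε (ρ g v) = τ g (ε v))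
    (h0 : ∀ v ∈ U 0, d v = 0 → v = 0)
    (hex : ∀ i < N, ∀ v ∈ U (i + 1), d v = 0 → ∃ u ∈ U i, d u = v)
    (hεd : ∀ v ∈ U N, ε (d v) = 0)
    (hεex : ∀ v ∈ U (N + 1), ε v = 0 → ∃ u ∈ U N, d u = v)
    (hεs : ∀ m, ∃ v ∈ U (N + 1), ε v = m) (m : ℕ) :
    betti τ (m + N + 1) ≤
      ∑ t ∈ Finset.range (N + 1), betti (subRep ρ (U (t + 1)) (hU (t + 1))) (m + t + 1) +
      betti (subRep ρ (U 0) (hU 0)) m := by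
  have hI : ∀ i g, ∀ v ∈ (U i).map d, ρ g v ∈ (U i).map d := by
    rintro i g _ ⟨u, hu, rfl⟩
    exact ⟨ρ g u, hU i g u hu, hd g u⟩
  have hle : ∀ i, (U i).map d ≤ U (i + 1) := by
    rintro i _ ⟨u, hu, rfl⟩
    exact hdU i u hu
  let r : ∀ i, U i →ₗ[k] (U i).map d := fun i =>
    (d.domRestrict (U i)).codRestrict _ fun u => ⟨u.1, u.2, rfl⟩
  have hr : ∀ i, Function.Surjective (r i) := by
    rintro i ⟨_, u, hu, rfl⟩
    exact ⟨⟨u, hu⟩, rfl⟩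
  have key : ∀ i ≤ N, betti (subRep ρ ((U i).map d) (hI i)) (m + i) ≤
      ∑ t ∈ Finset.range i, betti (subRep ρ (U (t + 1)) (hU (t + 1))) (m + t + 1) +
      betti (subRep ρ (U 0) (hU 0)) m := by
    intro i hi
    induction i with
    | zero =>
      have hinj : Function.Injective (r 0) := by
        rw [injective_iff_map_eq_zero]
        intro u hu
        exact Subtype.ext (h0 u.1 u.2 (congrArg Subtype.val hu))
      have := betti_congr (MulEquiv.refl G) (ρ := subRep ρ (U 0) (hU 0))
        (σ := subRep ρ ((U 0).map d) (hI 0)) (LinearEquiv.ofBijective (r 0) ⟨hinj, hr 0⟩)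
        (fun g u => Subtype.ext (hd g u)) m
      simp [this]
    | succ i ih =>
      have h1 := betti_succ_right_le (ρ := subRep ρ ((U i).map d) (hI i))
        (σ := subRep ρ (U (i + 1)) (hU (i + 1)))
        (τ := subRep ρ ((U (i + 1)).map d) (hI (i + 1)))
        (Submodule.inclusion (hle i)) (r (i + 1)) (fun _ _ => rfl)
        (fun g u => Subtype.ext (hd g u)) (Submodule.inclusion_injective _) (hr _)
        (by
          intro v
          constructor
          · intro hv
            obtain ⟨u, hu, huv⟩ := hex i hi v.1 v.2 (congrArg Subtype.val hv)
            exact ⟨⟨v.1, u, hu, huv⟩, rfl⟩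
          · rintro ⟨⟨_, u, hu, rfl⟩, rfl⟩
            exact Subtype.ext (hdd u)) (m + i)
      have h2 := ih (by omega)
      rw [Finset.sum_range_succ]
      change betti _ (m + i + 1) ≤ _
      omega
  have h1 := betti_succ_right_le (ρ := subRep ρ ((U N).map d) (hI N))
    (σ := subRep ρ (U (N + 1)) (hU (N + 1))) (τ := τ)
    (Submodule.inclusion (hle N)) (ε.domRestrict (U (N + 1))) (fun _ _ => rfl)
    (fun g u => hε g u) (Submodule.inclusion_injective _)
    (fun x => by obtain ⟨v, hv, rfl⟩ := hεs x; exact ⟨⟨v, hv⟩, rfl⟩)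
    (by
      intro v
      constructor
      · intro hv
        obtain ⟨u, hu, huv⟩ := hεex v.1 v.2 hv
        exact ⟨⟨v.1, u, hu, huv⟩, rfl⟩
      · rintro ⟨⟨_, u, hu, rfl⟩, rfl⟩
        exact hεd u hu) (m + N)
  have h2 := key N le_rfl
  rw [Finset.sum_range_succ]
  omega

end Complex

section LocalOperators

variable {k : Type} [Field k] {ι : Type} [Fintype ι] [LinearOrder ι] {S : Type} [Fintype S]
  [DecidableEq S] {M : Type} [AddCommGroup M] [Module k M]

variable (M) in
/-- The operator on functions of cells `ι → S` given by a matrix acting on the coordinate `w`. -/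
def locOp (w : ι) (t : Matrix S S k) : Module.End k ((ι → S) → M) :=
  LinearMap.pi fun τ => ∑ s, t (τ w) s • LinearMap.proj (Function.update τ w s)

omit [Fintype ι] [DecidableEq S] in
theorem locOp_apply (w : ι) (t : Matrix S S k) (F : (ι → S) → M) (τ : ι → S) :
    locOp M w t F τ = ∑ s, t (τ w) s • F (Function.update τ w s) := by
  simp [locOp]

omit [Fintype ι] [DecidableEq S] in
theorem locOp_mul (w : ι) (t t' : Matrix S S k) :
    locOp M w (t * t') = locOp M w t * locOp M w t' := by
  refine LinearMap.ext fun F => funext fun τ => ?_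
  simp only [locOp_apply, Module.End.mul_apply, Function.update_self, Function.update_idem,
    Finset.smul_sum, Matrix.mul_apply, Finset.sum_smul, mul_smul]
  exact Finset.sum_comm

omit [Fintype ι] in
theorem locOp_one (w : ι) : locOp M w (1 : Matrix S S k) = 1 := by
  refine LinearMap.ext fun F => funext fun τ => ?_
  simp [locOp_apply, Matrix.one_apply]

omit [Fintype ι] [DecidableEq S] in
theorem locOp_add (w : ι) (t t' : Matrix S S k) :
    locOp M w (t + t') = locOp M w t + locOp M w t' := by
  refine LinearMap.ext fun F => funext fun τ => ?_
  simp [locOp_apply, add_smul, Finset.sum_add_distrib]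

omit [Fintype ι] [DecidableEq S] in
theorem locOp_sub (w : ι) (t t' : Matrix S S k) :
    locOp M w (t - t') = locOp M w t - locOp M w t' := by
  refine LinearMap.ext fun F => funext fun τ => ?_
  simp [locOp_apply, sub_smul, Finset.sum_sub_distrib]

omit [Fintype ι] [DecidableEq S] in
theorem locOp_zero (w : ι) : locOp M w (0 : Matrix S S k) = 0 := by
  refine LinearMap.ext fun F => funext fun τ => ?_
  simp [locOp_apply]

omit [Fintype ι] [DecidableEq S] in
theorem locOp_comm {u w : ι} (h : u ≠ w) (t t' : Matrix S S k) :
    locOp M u t * locOp M w t' = locOp M w t' * locOp M u t := by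
  refine LinearMap.ext fun F => funext fun τ => ?_
  simp only [locOp_apply, Module.End.mul_apply, Function.update_of_ne h,
    Function.update_of_ne h.symm, Finset.smul_sum]
  rw [Finset.sum_comm]
  refine Finset.sum_congr rfl fun a _ => Finset.sum_congr rfl fun b _ => ?_
  rw [smul_comm, Function.update_comm h]

variable (M) in
/-- Multiplication of functions of cells by the sign of the coordinates before `w`. -/
def epsOp (sg : S → k) (w : ι) : Module.End k ((ι → S) → M) :=
  LinearMap.pi fun τ => (∏ u with u < w, sg (τ u)) • LinearMap.proj τ

omit [Fintype S] [DecidableEq S] in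
theorem epsOp_apply (sg : S → k) (w : ι) (F : (ι → S) → M) (τ : ι → S) :
    epsOp M sg w F τ = (∏ u with u < w, sg (τ u)) • F τ := rfl

omit [Fintype S] [DecidableEq S] in
theorem epsOp_mul_self {sg : S → k} (hsg : ∀ s, sg s * sg s = 1) (w : ι) :
    epsOp M sg w * epsOp M sg w = 1 := by
  refine LinearMap.ext fun F => funext fun τ => ?_
  simp [epsOp_apply, smul_smul, ← Finset.prod_mul_distrib, hsg]

omit [Fintype S] [DecidableEq S] in
theorem epsOp_comm (sg : S → k) (u w : ι) :
    epsOp M sg u * epsOp M sg w = epsOp M sg w * epsOp M sg u := by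
  refine LinearMap.ext fun F => funext fun τ => ?_
  simp [epsOp_apply, smul_smul, mul_comm]

/-- A matrix is odd if it changes the sign of states. -/
def OddMatrix (sg : S → k) (t : Matrix S S k) : Prop := ∀ a b, t a b ≠ 0 → sg b = - sg a

omit [Fintype S] [DecidableEq S] in
theorem prod_update_of_lt (sg : S → k) {u w : ι} (h : u < w) (τ : ι → S) (b : S)
    (hb : sg b = - sg (τ u)) :
    ∏ v with v < w, sg (Function.update τ u b v) = - ∏ v with v < w, sg (τ v) := by
  have hu : u ∈ Finset.univ.filter (· < w) := by simpa using h
  rw [← Finset.mul_prod_erase _ _ hu, ← Finset.mul_prod_erase _ _ hu, Function.update_self, hb,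
    neg_mul]
  congr 2
  refine Finset.prod_congr rfl fun v hv => ?_
  rw [Function.update_of_ne (Finset.ne_of_mem_erase hv)]

omit [Fintype S] [DecidableEq S] in
theorem prod_update_of_not_lt (sg : S → k) {u w : ι} (h : ¬ u < w) (τ : ι → S) (b : S) :
    ∏ v with v < w, sg (Function.update τ u b v) = ∏ v with v < w, sg (τ v) := by
  refine Finset.prod_congr rfl fun v hv => ?_
  rw [Function.update_of_ne]
  rintro rfl
  exact h (by simpa using hv)

omit [DecidableEq S] in
theorem epsOp_mul_locOp_of_lt {sg : S → k} {u w : ι} (h : u < w) {t : Matrix S S k}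
    (ht : OddMatrix sg t) :
    epsOp M sg w * locOp M u t = - (locOp M u t * epsOp M sg w) := by
  refine LinearMap.ext fun F => funext fun τ => ?_
  simp only [epsOp_apply, locOp_apply, Module.End.mul_apply, LinearMap.neg_apply, Pi.neg_apply,
    Finset.smul_sum, ← Finset.sum_neg_distrib]
  refine Finset.sum_congr rfl fun b _ => ?_
  by_cases h0 : t (τ u) b = 0
  · simp [h0]
  · rw [prod_update_of_lt sg h τ b (ht _ _ h0), smul_comm, neg_smul, smul_neg, neg_neg]

omit [DecidableEq S] in
theorem epsOp_mul_locOp_of_not_lt (sg : S → k) {u w : ι} (h : ¬ u < w) (t : Matrix S S k) :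
    epsOp M sg w * locOp M u t = locOp M u t * epsOp M sg w := by
  refine LinearMap.ext fun F => funext fun τ => ?_
  simp only [epsOp_apply, locOp_apply, Module.End.mul_apply, Finset.smul_sum]
  refine Finset.sum_congr rfl fun b _ => ?_
  rw [prod_update_of_not_lt sg h τ b, smul_comm]

variable (M) in
/-- The local operator at `w` with the Koszul sign. -/
def sgOp (sg : S → k) (w : ι) (t : Matrix S S k) : Module.End k ((ι → S) → M) :=
  epsOp M sg w * locOp M w t

omit [DecidableEq S] in
theorem sgOp_mul_self {sg : S → k} (hsg : ∀ s, sg s * sg s = 1) (w : ι) (t t' : Matrix S S k) :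
    sgOp M sg w t * sgOp M sg w t' = locOp M w (t * t') := by
  rw [sgOp, sgOp, epsOp_mul_locOp_of_not_lt sg (lt_irrefl w), mul_assoc,
    ← mul_assoc (epsOp M sg w), epsOp_mul_self hsg, one_mul, locOp_mul]

omit [DecidableEq S] in
theorem sgOp_anticomm {sg : S → k} {u w : ι} (h : u ≠ w)
    {t t' : Matrix S S k} (ht : OddMatrix sg t) (ht' : OddMatrix sg t') :
    sgOp M sg u t * sgOp M sg w t' = - (sgOp M sg w t' * sgOp M sg u t) := by
  wlog huw : u < w generalizing u w t t'
  · rw [this h.symm ht' ht (lt_of_le_of_ne (not_lt.1 huw) h.symm), neg_neg]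
  have h1 := epsOp_mul_locOp_of_lt (M := M) huw ht
  have h2 := epsOp_mul_locOp_of_not_lt (M := M) sg (not_lt.2 huw.le) t'
  calc sgOp M sg u t * sgOp M sg w t'
      = epsOp M sg u * (locOp M u t * epsOp M sg w) * locOp M w t' := by
        simp only [sgOp, mul_assoc]
    _ = - (epsOp M sg u * epsOp M sg w * (locOp M u t * locOp M w t')) := by
        rw [← neg_eq_iff_eq_neg] at h1
        rw [← h1]
        simp only [mul_assoc, mul_neg, neg_mul]
    _ = - (epsOp M sg w * (epsOp M sg u * locOp M w t') * locOp M u t) := by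
        rw [locOp_comm h, epsOp_comm]
        simp only [mul_assoc]
    _ = _ := by
        rw [h2]
        simp only [sgOp, mul_assoc]

variable (M) in
/-- The total differential. -/
def totalOp (sg : S → k) (t : Matrix S S k) : Module.End k ((ι → S) → M) :=
  ∑ w, sgOp M sg w t

omit [DecidableEq S] in
theorem totalOp_mul_self {sg : S → k} (hsg : ∀ s, sg s * sg s = 1) {t : Matrix S S k}
    (ht : OddMatrix sg t) (htt : t * t = 0) :
    totalOp (ι := ι) M sg t * totalOp M sg t = 0 := by
  rw [totalOp, Finset.sum_mul_sum, ← Finset.sum_product']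
  refine Finset.sum_involution (fun x _ => x.swap) ?_ ?_ ?_ ?_
  · rintro ⟨u, w⟩ _
    by_cases h : u = w
    · subst h
      simp [sgOp_mul_self hsg, htt, locOp_zero]
    · change sgOp M sg u t * sgOp M sg w t + sgOp M sg w t * sgOp M sg u t = 0
      rw [sgOp_anticomm h ht ht, neg_add_cancel]
  · rintro ⟨u, w⟩ _ hne heq
    obtain rfl : w = u := congrArg Prod.fst heq
    exact hne (by rw [sgOp_mul_self hsg, htt, locOp_zero])
  · simp
  · simp

theorem totalOp_homotopy {sg : S → k} (hsg : ∀ s, sg s * sg s = 1) {t h π : Matrix S S k}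
    (ht : OddMatrix sg t) (hh : OddMatrix sg h) (hth : t * h + h * t = 1 - π) (w : ι) :
    totalOp M sg t * sgOp M sg w h + sgOp M sg w h * totalOp M sg t = 1 - locOp M w π := by
  rw [totalOp, Finset.sum_mul, Finset.mul_sum, ← Finset.sum_add_distrib,
    Finset.sum_eq_single w]
  · rw [sgOp_mul_self hsg, sgOp_mul_self hsg, ← locOp_add, hth, locOp_sub, locOp_one]
  · intro u _ hu
    rw [sgOp_anticomm hu ht hh, neg_add_cancel]
  · simp

end LocalOperators

section States

/-- The states of a coordinate: empty, a vertex (`false`) or an edge (`true`) of a `p`-gon. -/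
abbrev PState (p : ℕ) : Type := Option (Bool × ZMod p)

variable {k : Type} [Field k] {p : ℕ} [Fact p.Prime]

/-- The dimension of a state. -/
def PState.deg : PState p → ℕ
  | none => 0
  | some (false, _) => 1
  | some (true, _) => 2

variable (k) in
/-- The sign of a state. -/
def PState.sgn : PState p → k
  | none => 1
  | some (false, _) => -1
  | some (true, _) => 1

variable (k p) in
/-- The differential of the augmented cochain complex of the `p`-gon. -/
def bdMat : Matrix (PState p) (PState p) k
  | some (false, _), none => 1
  | some (true, a), some (false, b) => (if b = a then 1 else 0) - (if b = a + 1 then 1 else 0)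
  | _, _ => 0

variable (k p) in
/-- A contraction of the augmented cochain complex of the `p`-gon. -/
def htMat : Matrix (PState p) (PState p) k
  | none, some (false, b) => if b = 0 then 1 else 0
  | some (false, a), some (true, b) => if b.val < a.val then -1 else 0
  | _, _ => 0

variable (k p) in
/-- The projection to the cohomology of the `p`-gon. -/
def prMat : Matrix (PState p) (PState p) k
  | some (true, a), some (true, _) => if a = -1 then 1 else 0
  | _, _ => 0

omit [Fact p.Prime] in
theorem sgn_mul_self (s : PState p) : s.sgn k * s.sgn k = 1 := by
  rcases s with _ | ⟨_ | _, a⟩ <;> simp [PState.sgn]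

theorem oddMatrix_bdMat : OddMatrix (PState.sgn k) (bdMat k p) := by
  rintro (_ | ⟨_ | _, a⟩) (_ | ⟨_ | _, b⟩) h <;> simp_all [PState.sgn, bdMat]

theorem oddMatrix_htMat : OddMatrix (PState.sgn k) (htMat k p) := by
  rintro (_ | ⟨_ | _, a⟩) (_ | ⟨_ | _, b⟩) h <;> simp_all [PState.sgn, htMat]

theorem deg_of_bdMat_ne_zero {a b : PState p} (h : bdMat k p a b ≠ 0) : a.deg = b.deg + 1 := by
  rcases a with _ | ⟨_ | _, a⟩ <;> rcases b with _ | ⟨_ | _, b⟩ <;>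
    simp_all [PState.deg, bdMat]

theorem deg_of_htMat_ne_zero {a b : PState p} (h : htMat k p a b ≠ 0) : a.deg + 1 = b.deg := by
  rcases a with _ | ⟨_ | _, a⟩ <;> rcases b with _ | ⟨_ | _, b⟩ <;>
    simp_all [PState.deg, htMat]

theorem prMat_ne_zero {a b : PState p} (h : prMat k p a b ≠ 0) :
    a = some (true, -1) ∧ b.deg = 2 := by
  rcases a with _ | ⟨_ | _, a⟩ <;> rcases b with _ | ⟨_ | _, b⟩ <;>
    simp_all [PState.deg, prMat]

theorem bdMat_mul_self : bdMat k p * bdMat k p = 0 := by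
  ext a b
  rw [Matrix.mul_apply, Fintype.sum_option, Fintype.sum_prod_type, Fintype.sum_bool]
  rcases a with _ | ⟨_ | _, a⟩ <;> rcases b with _ | ⟨_ | _, b⟩ <;> simp [bdMat]

theorem val_add_one (a : ZMod p) : (a + 1).val = if a = -1 then 0 else a.val + 1 := by
  split_ifs with h
  · simp [h]
  · have h1 : a.val + 1 ≠ p := by
      intro h1
      apply h
      rw [eq_neg_iff_add_eq_zero]
      have := congrArg (Nat.cast : ℕ → ZMod p) h1
      simpa using this
    have h2 := a.val_lt
    have h3 : (1 : ZMod p).val = 1 := ZMod.val_one p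
    rw [ZMod.val_add, h3, Nat.mod_eq_of_lt (by omega)]

theorem bdMat_htMat : bdMat k p * htMat k p + htMat k p * bdMat k p = 1 - prMat k p := by
  ext a b
  rw [Matrix.add_apply, Matrix.mul_apply, Matrix.mul_apply, ← Finset.sum_add_distrib,
    Fintype.sum_option, Fintype.sum_prod_type, Fintype.sum_bool, Matrix.sub_apply]
  rcases a with _ | ⟨_ | _, a⟩ <;> rcases b with _ | ⟨_ | _, b⟩ <;>
    simp only [bdMat, htMat, prMat, Matrix.one_apply, zero_mul, mul_zero, add_zero, zero_add,
      Finset.sum_const_zero, ite_mul, one_mul, mul_sub, mul_ite, mul_one, sub_mul,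
      Finset.sum_sub_distrib, Finset.sum_ite_eq', Finset.sum_ite_eq, Finset.mem_univ, if_true,
      reduceCtorEq, if_false, sub_zero, Option.some.injEq, Prod.mk.injEq, true_and, false_and]
  case some.false.some.false =>
    have : ∀ x : ZMod p, (b = x + 1) ↔ (x = b - 1) := fun x => by
      constructor <;> rintro rfl <;> simp
    simp only [this, Finset.sum_ite_eq', Finset.mem_univ, if_true]
    have hb := val_add_one (b - 1)
    rw [sub_add_cancel] at hb
    have hb' : b - 1 = -1 ↔ b = 0 := by
      constructor <;> intro h
      · simpa using h
      · simp [h]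
    simp only [hb'] at hb
    have h0 : b = 0 ↔ b.val = 0 := (ZMod.val_eq_zero b).symm
    have hab : a = b ↔ a.val = b.val := (ZMod.val_injective p).eq_iff.symm
    have ha := a.val_lt
    have hb2 := (b - 1).val_lt
    have hp1 : b = 0 → (b - 1).val = p - 1 := by
      rintro rfl
      rw [zero_sub, ZMod.neg_val, ZMod.val_one]
      simp
    by_cases hz : b = 0
    · have := hp1 hz
      rw [if_pos hz] at hb
      by_cases ha0 : a.val = 0
      · rw [if_pos hz, if_neg (by omega), if_neg (by omega), if_pos (by rw [hab]; omega)]; simp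
      · rw [if_pos hz, if_pos (by omega), if_neg (by omega), if_neg (by rw [hab]; omega)]; simp
    · rw [if_neg hz] at hb
      rw [if_neg hz]
      rcases lt_trichotomy a.val b.val with h | h | h
      · rw [if_neg (by omega), if_neg (by omega), if_neg (by rw [hab]; omega)]; simp
      · rw [if_neg (by omega), if_pos (by omega), if_pos (by rw [hab]; omega)]; simp
      · rw [if_pos (by omega), if_pos (by omega), if_neg (by rw [hab]; omega)]; simp
  case some.true.some.true =>
    have hsum : (∑ x : ZMod p, if b.val < x.val then
        ((if x = a then (-1 : k) else 0) - if x = a + 1 then -1 else 0) else 0) =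
        (if b.val < a.val then -1 else 0) - if b.val < (a + 1).val then -1 else 0 := by
      rw [Finset.sum_congr rfl (g := fun x : ZMod p =>
        (if x = a then (if b.val < a.val then (-1 : k) else 0) else 0) -
          if x = a + 1 then (if b.val < (a + 1).val then (-1 : k) else 0) else 0)]
      · rw [Finset.sum_sub_distrib, Finset.sum_ite_eq', Finset.sum_ite_eq']
        simp
      · intro x _
        by_cases h1 : x = a <;> by_cases h2 : x = a + 1 <;> by_cases h3 : b.val < x.val <;>
          simp_all [not_lt.2]
    rw [hsum]
    have ha := val_add_one a
    have hab : a = b ↔ a.val = b.val := (ZMod.val_injective p).eq_iff.symm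
    have hb2 := b.val_lt
    by_cases hz : a = -1
    · have := ZMod.val_neg_one (p - 1)
      have hp : p - 1 + 1 = p := Nat.sub_add_cancel (Fact.out : p.Prime).one_le
      have hv : a.val = p - 1 := by
        rw [hz, ZMod.neg_val, ZMod.val_one]; simp
      rw [if_pos hz] at ha
      by_cases h : b.val < a.val
      · rw [if_pos h, if_neg (by omega), if_neg (by rw [hab]; omega), if_pos hz]; simp
      · rw [if_neg h, if_neg (by omega), if_pos (by rw [hab]; omega), if_pos hz]; simp
    · rw [if_neg hz] at ha
      rw [if_neg hz]
      rcases lt_trichotomy a.val b.val with h | h | h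
      · rw [if_neg (by omega), if_neg (by omega), if_neg (by rw [hab]; omega)]
      · rw [if_neg (by omega), if_pos (by omega), if_pos (by rw [hab]; omega)]; simp
      · rw [if_pos (by omega), if_pos (by omega), if_neg (by rw [hab]; omega)]; simp
  all_goals simp

end States

section CellComplex

variable {k : Type} [Field k] {ι : Type} [Fintype ι] [LinearOrder ι] {p : ℕ} [Fact p.Prime]
  {M : Type} [AddCommGroup M] [Module k M]

/-- The dimension of a cell of the join of `p`-gons indexed by `ι`. -/
def cellDeg (τ : ι → PState p) : ℕ := ∑ w, (τ w).deg

omit [Fact p.Prime] in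
theorem cellDeg_update (τ : ι → PState p) (w : ι) (s : PState p) :
    cellDeg (Function.update τ w s) + (τ w).deg = cellDeg τ + s.deg := by
  rw [cellDeg, cellDeg, ← Finset.add_sum_erase _ _ (Finset.mem_univ w),
    ← Finset.add_sum_erase _ (fun w => (τ w).deg) (Finset.mem_univ w), Function.update_self,
    Finset.sum_congr rfl (g := fun w => (τ w).deg)]
  · ring
  · intro u hu
    rw [Function.update_of_ne (Finset.ne_of_mem_erase hu)]

variable (k M p) in
/-- The differential on cochains of the join of `p`-gons. -/
def cellDiff : Module.End k ((ι → PState p) → M) := totalOp M (PState.sgn k) (bdMat k p)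

variable (k M p ι) in
/-- Cochains of a given degree. -/
def cellChains (i : ℕ) : Submodule k ((ι → PState p) → M) :=
  supportedOn k M {τ | cellDeg τ = i}

omit [LinearOrder ι] [Fact p.Prime] in
theorem cellDeg_eq_of_ne_zero {i : ℕ} {F : (ι → PState p) → M} (hF : F ∈ cellChains k ι p M i)
    {τ : ι → PState p} (h : F τ ≠ 0) : cellDeg τ = i := by
  by_contra h'
  exact h (hF τ h')

omit [Fintype ι] [Fact p.Prime] in
theorem exists_of_locOp_ne_zero {S : Type} [Fintype S] {w : ι} {t : Matrix S S k}
    {F : (ι → S) → M} {τ : ι → S}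
    (h : locOp M w t F τ ≠ 0) : ∃ s, t (τ w) s ≠ 0 ∧ F (Function.update τ w s) ≠ 0 := by
  rw [locOp_apply] at h
  obtain ⟨s, -, hs⟩ := Finset.exists_ne_zero_of_sum_ne_zero h
  exact ⟨s, left_ne_zero_of_smul hs, right_ne_zero_of_smul hs⟩

theorem exists_of_sgOp_ne_zero {S : Type} [Fintype S] {sg : S → k} {w : ι} {t : Matrix S S k}
    {F : (ι → S) → M} {τ : ι → S} (h : sgOp M sg w t F τ ≠ 0) :
    ∃ s, t (τ w) s ≠ 0 ∧ F (Function.update τ w s) ≠ 0 := by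
  rw [sgOp, Module.End.mul_apply, epsOp_apply] at h
  exact exists_of_locOp_ne_zero (right_ne_zero_of_smul h)

theorem cellDiff_mem {i : ℕ} {F : (ι → PState p) → M} (hF : F ∈ cellChains k ι p M i) :
    cellDiff k p M F ∈ cellChains k ι p M (i + 1) := by
  rw [cellDiff, totalOp, LinearMap.sum_apply]
  refine Submodule.sum_mem _ fun w _ τ hτ => ?_
  by_contra h
  obtain ⟨s, h1, h2⟩ := exists_of_sgOp_ne_zero h
  have h3 := cellDeg_eq_of_ne_zero hF h2
  have h4 := deg_of_bdMat_ne_zero h1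
  have h5 := cellDeg_update τ w s
  exact hτ (by simp only [Set.mem_ofPred_eq]; omega)

theorem sgOp_htMat_mem {i : ℕ} {F : (ι → PState p) → M} (hF : F ∈ cellChains k ι p M (i + 1))
    (w : ι) : sgOp M (PState.sgn k) w (htMat k p) F ∈ cellChains k ι p M i := by
  intro τ hτ
  by_contra h
  obtain ⟨s, h1, h2⟩ := exists_of_sgOp_ne_zero h
  have h3 := cellDeg_eq_of_ne_zero hF h2
  have h4 := deg_of_htMat_ne_zero h1
  have h5 := cellDeg_update τ w s
  exact hτ (by simp only [Set.mem_ofPred_eq]; omega)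

theorem sgOp_htMat_eq_zero {F : (ι → PState p) → M} (hF : F ∈ cellChains k ι p M 0)
    (w : ι) : sgOp M (PState.sgn k) w (htMat k p) F = 0 := by
  funext τ
  by_contra h
  obtain ⟨s, h1, h2⟩ := exists_of_sgOp_ne_zero h
  have h3 := cellDeg_eq_of_ne_zero hF h2
  have h4 := deg_of_htMat_ne_zero h1
  have h5 := cellDeg_update τ w s
  omega

theorem cellDiff_cellDiff (F : (ι → PState p) → M) :
    cellDiff k p M (cellDiff k p M F) = 0 := by
  have := totalOp_mul_self (ι := ι) (M := M) (sgn_mul_self (k := k) (p := p)) oddMatrix_bdMat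
    bdMat_mul_self
  exact LinearMap.congr_fun this F

theorem exists_concentrated {i : ℕ} {F : (ι → PState p) → M} (hF : F ∈ cellChains k ι p M i)
    (hd : cellDiff k p M F = 0) (s : Finset ι) :
    ∃ F' ∈ cellChains k ι p M i, ∃ H, cellDiff k p M F' = 0 ∧ F = F' + cellDiff k p M H ∧
      (∀ j, i = j + 1 → H ∈ cellChains k ι p M j) ∧ (i = 0 → H = 0) ∧
      ∀ τ, F' τ ≠ 0 → ∀ w ∈ s, τ w = some (true, -1) := by
  induction s using Finset.induction_on with
  | empty => exact ⟨F, hF, 0, hd, by simp, by simp, by simp, by simp⟩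
  | insert w s hw ih =>
    obtain ⟨F', hF', H, hd', heq, hH, hH0, hc⟩ := ih
    have key := LinearMap.congr_fun (totalOp_homotopy (M := M) (sgn_mul_self (k := k) (p := p))
      oddMatrix_bdMat oddMatrix_htMat bdMat_htMat w) F'
    change cellDiff k p M (sgOp M (PState.sgn k) w (htMat k p) F') +
      sgOp M (PState.sgn k) w (htMat k p) (cellDiff k p M F') =
      F' - locOp M w (prMat k p) F' at key
    rw [hd', map_zero, add_zero] at key
    have key' : F' = locOp M w (prMat k p) F' +
      cellDiff k p M (sgOp M (PState.sgn k) w (htMat k p) F') := by rw [key]; abel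
    refine ⟨locOp M w (prMat k p) F', ?_, H + sgOp M (PState.sgn k) w (htMat k p) F', ?_, ?_,
      ?_, ?_, ?_⟩
    · intro τ hτ
      by_contra h
      obtain ⟨s, h1, h2⟩ := exists_of_locOp_ne_zero h
      have h3 := cellDeg_eq_of_ne_zero hF' h2
      obtain ⟨h4, h6⟩ := prMat_ne_zero h1
      have h5 := cellDeg_update τ w s
      rw [h4, h6] at h5
      exact hτ (by simp only [Set.mem_ofPred_eq, PState.deg] at h5 ⊢; omega)
    · have := congrArg (cellDiff k p M) key'
      rw [map_add, cellDiff_cellDiff, add_zero, hd'] at this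
      exact this.symm
    · rw [map_add]
      nth_rewrite 1 [heq, key']
      abel
    · rintro j rfl
      exact add_mem (hH j rfl) (sgOp_htMat_mem hF' w)
    · rintro rfl
      rw [hH0 rfl, sgOp_htMat_eq_zero hF' w, add_zero]
    · intro τ hτ u hu
      obtain ⟨s', h1, h2⟩ := exists_of_locOp_ne_zero hτ
      rcases Finset.mem_insert.1 hu with rfl | hu'
      · exact (prMat_ne_zero h1).1
      · have := hc _ h2 u hu'
        rwa [Function.update_of_ne] at this
        rintro rfl
        exact hw hu'

variable (k M p ι) in
/-- The augmentation: the sum of the values on the top cells. -/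
def cellAug : ((ι → PState p) → M) →ₗ[k] M :=
  ∑ x : ι → ZMod p, LinearMap.proj fun w => some (true, x w)

theorem cellAug_apply (F : (ι → PState p) → M) :
    cellAug k ι p M F = ∑ x : ι → ZMod p, F fun w => some (true, x w) := by
  simp [cellAug]

theorem sgOp_bdMat_top (F : (ι → PState p) → M) (w : ι) (x : ι → ZMod p) :
    sgOp M (PState.sgn k) w (bdMat k p) F (fun w => some (true, x w)) =
      F (Function.update (fun w => some (true, x w)) w (some (false, x w))) -
      F (Function.update (fun w => some (true, x w)) w (some (false, x w + 1))) := by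
  rw [sgOp, Module.End.mul_apply, epsOp_apply, locOp_apply, Fintype.sum_option,
    Fintype.sum_prod_type, Fintype.sum_bool]
  simp [PState.sgn, bdMat, sub_smul, Finset.sum_sub_distrib, ite_smul]

theorem cellAug_cellDiff (F : (ι → PState p) → M) : cellAug k ι p M (cellDiff k p M F) = 0 := by
  simp only [cellAug_apply, cellDiff, totalOp, LinearMap.sum_apply, Finset.sum_apply,
    sgOp_bdMat_top]
  rw [Finset.sum_comm]
  refine Finset.sum_eq_zero fun w _ => ?_
  rw [Finset.sum_sub_distrib, sub_eq_zero]
  refine (Fintype.sum_equiv (Equiv.addRight (Pi.single w (1 : ZMod p))) _ _ fun x => ?_).symm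
  congr 1
  funext u
  by_cases h : u = w
  · subst h; simp
  · simp [h]

omit [LinearOrder ι] [Fact p.Prime] in
theorem cellDeg_top (a : ι → ZMod p) :
    cellDeg (fun w : ι => (some (true, a w) : PState p)) = 2 * Fintype.card ι := by
  simp [cellDeg, PState.deg, mul_comm]

theorem exists_concentrated_top {i : ℕ} {F : (ι → PState p) → M}
    (hF : F ∈ cellChains k ι p M i) (hd : cellDiff k p M F = 0) :
    ∃ F' ∈ cellChains k ι p M i, ∃ H, F = F' + cellDiff k p M H ∧
      (∀ j, i = j + 1 → H ∈ cellChains k ι p M j) ∧ (i = 0 → H = 0) ∧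
      ∀ τ, F' τ ≠ 0 → τ = fun _ => some (true, -1) := by
  obtain ⟨F', hF', H, -, heq, hH, hH0, hc⟩ := exists_concentrated hF hd Finset.univ
  exact ⟨F', hF', H, heq, hH, hH0, fun τ hτ => funext fun w => hc τ hτ w (Finset.mem_univ w)⟩

omit [LinearOrder ι] in
theorem cellChains_eq_zero_of_lt {i : ℕ} (hi : i < 2 * Fintype.card ι) {F' : (ι → PState p) → M}
    (hF' : F' ∈ cellChains k ι p M i) (hc : ∀ τ, F' τ ≠ 0 → τ = fun _ => some (true, -1)) :
    F' = 0 := by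
  funext τ
  by_contra h
  have h1 := cellDeg_eq_of_ne_zero hF' h
  rw [hc τ h, cellDeg_top fun _ => -1] at h1
  omega

theorem cellDiff_injective [Nonempty ι] {F : (ι → PState p) → M} (hF : F ∈ cellChains k ι p M 0)
    (hd : cellDiff k p M F = 0) : F = 0 := by
  obtain ⟨F', hF', H, heq, -, hH0, hc⟩ := exists_concentrated_top hF hd
  have := Fintype.card_pos (α := ι)
  rw [heq, hH0 rfl, cellChains_eq_zero_of_lt (by omega) hF' hc, map_zero, add_zero]

theorem cellDiff_exact {i : ℕ} (hi : i + 1 < 2 * Fintype.card ι) {F : (ι → PState p) → M}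
    (hF : F ∈ cellChains k ι p M (i + 1)) (hd : cellDiff k p M F = 0) :
    ∃ H ∈ cellChains k ι p M i, cellDiff k p M H = F := by
  obtain ⟨F', hF', H, heq, hH, -, hc⟩ := exists_concentrated_top hF hd
  refine ⟨H, hH i rfl, ?_⟩
  rw [heq, cellChains_eq_zero_of_lt hi hF' hc, zero_add]

theorem cellDiff_eq_zero_of_top {i : ℕ} (hi : 2 * Fintype.card ι = i) {F : (ι → PState p) → M}
    (hF : F ∈ cellChains k ι p M i) : cellDiff k p M F = 0 := by
  funext τ
  by_contra h
  have h1 := cellDeg_eq_of_ne_zero (cellDiff_mem hF) h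
  have h2 : cellDeg τ ≤ ∑ _w : ι, 2 := Finset.sum_le_sum fun w _ => by
    rcases τ w with _ | ⟨_ | _, a⟩ <;> simp [PState.deg]
  simp at h2
  omega

theorem cellDiff_exact_top {i : ℕ} (hi : 2 * Fintype.card ι = i + 1) {F : (ι → PState p) → M}
    (hF : F ∈ cellChains k ι p M (i + 1)) (hd : cellAug k ι p M F = 0) :
    ∃ H ∈ cellChains k ι p M i, cellDiff k p M H = F := by
  obtain ⟨F', hF', H, heq, hH, -, hc⟩ :=
    exists_concentrated_top hF (cellDiff_eq_zero_of_top hi hF)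
  refine ⟨H, hH i rfl, ?_⟩
  rw [heq, map_add, cellAug_cellDiff, add_zero, cellAug_apply,
    Finset.sum_eq_single (fun _ => -1)] at hd
  · have : F' = 0 := by
      funext τ
      by_contra h
      rw [hc τ h] at h
      exact h hd
    rw [heq, this, zero_add]
  · intro x _ hx
    by_contra h
    have := hc _ h
    exact hx (funext fun w => by simpa using congrFun this w)
  · simp

theorem cellAug_surjective (m : M) :
    ∃ F ∈ cellChains k ι p M (2 * Fintype.card ι), cellAug k ι p M F = m := by
  refine ⟨Pi.single (fun _ => some (true, -1)) m, ?_, ?_⟩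
  · intro τ hτ
    rw [Pi.single_apply, if_neg]
    rintro rfl
    exact hτ (cellDeg_top fun _ => -1)
  · rw [cellAug_apply, Finset.sum_eq_single (fun _ => -1)]
    · simp
    · intro x _ hx
      rw [Pi.single_apply, if_neg]
      intro h
      exact hx (funext fun w => by simpa using congrFun h w)
    · simp

end CellComplex

set_option linter.unusedSectionVars false

section CellAction

variable {k : Type} [Field k] {ι : Type} [Fintype ι] [LinearOrder ι] {p : ℕ} [Fact p.Prime]
  {M : Type} [AddCommGroup M] [Module k M] {Γ : Type} [Group Γ] [MulAction Γ ι]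

/-- Rotation of a state. -/
def PState.shift (c : ZMod p) : PState p → PState p := Option.map (Prod.map id (· + c))

theorem PState.shift_shift (c d : ZMod p) (s : PState p) :
    (s.shift d).shift c = s.shift (c + d) := by
  rcases s with _ | ⟨b, a⟩ <;> simp [PState.shift, add_comm c d, add_assoc]

theorem PState.shift_zero (s : PState p) : s.shift 0 = s := by
  rcases s with _ | ⟨b, a⟩ <;> simp [PState.shift]

theorem PState.deg_shift (c : ZMod p) (s : PState p) : (s.shift c).deg = s.deg := by
  rcases s with _ | ⟨_ | _, a⟩ <;> rfl

theorem PState.sgn_shift (c : ZMod p) (s : PState p) : (s.shift c).sgn k = s.sgn k := by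
  rcases s with _ | ⟨_ | _, a⟩ <;> rfl

theorem PState.shift_bijective (c : ZMod p) : Function.Bijective (PState.shift c) := by
  refine Function.bijective_iff_has_inverse.2 ⟨PState.shift (-c), fun s => ?_, fun s => ?_⟩ <;>
    rw [PState.shift_shift] <;> simp [PState.shift_zero]

theorem PState.shift_eq_self {c : ZMod p} {s : PState p} (h : s.shift c = s) (hs : s ≠ none) :
    c = 0 := by
  rcases s with _ | ⟨_ | _, a⟩
  · exact (hs rfl).elim
  all_goals simpa [PState.shift] using h

theorem bdMat_shift (c : ZMod p) (a b : PState p) :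
    bdMat k p (a.shift c) (b.shift c) = bdMat k p a b := by
  rcases a with _ | ⟨_ | _, a⟩ <;> rcases b with _ | ⟨_ | _, b⟩ <;>
    simp [PState.shift, bdMat, add_right_comm _ c 1]

theorem PState.sgn_eq (s : PState p) : s.sgn k = if s.deg = 1 then -1 else 1 := by
  rcases s with _ | ⟨_ | _, a⟩ <;> simp [PState.deg, PState.sgn]

/-- The permutation of cells given by moving the coordinates and rotating each of them. -/
def cellMap (κ : Γ → ι → ZMod p) (γ : Γ) (τ : ι → PState p) : ι → PState p :=
  fun w => (τ (γ⁻¹ • w)).shift (κ γ (γ⁻¹ • w))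

theorem cellMap_smul (κ : Γ → ι → ZMod p) (γ : Γ) (τ : ι → PState p) (w : ι) :
    cellMap κ γ τ (γ • w) = (τ w).shift (κ γ w) := by
  simp [cellMap]

theorem cellMap_ext (γ : Γ) {τ τ' : ι → PState p} (h : ∀ w, τ (γ • w) = τ' (γ • w)) :
    τ = τ' := by
  funext w
  simpa using h (γ⁻¹ • w)

variable {κ : Γ → ι → ZMod p} (hκ : ∀ a b w, κ (a * b) w = κ a (b • w) + κ b w)

include hκ in
theorem cocycle_one (w : ι) : κ 1 w = 0 := by
  have := hκ 1 1 w
  simpa using this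

/-- The action on cells given by permutations of the coordinates and rotations. -/
abbrev cellAction : MulAction Γ (ι → PState p) where
  smul := cellMap κ
  one_smul τ := by
    change cellMap κ 1 τ = τ
    funext w
    simp [cellMap, cocycle_one hκ, PState.shift_zero]
  mul_smul a b τ := by
    change cellMap κ (a * b) τ = cellMap κ a (cellMap κ b τ)
    refine cellMap_ext (a * b) fun w => ?_
    rw [cellMap_smul, mul_smul, cellMap_smul, cellMap_smul, PState.shift_shift, hκ]

theorem cellDeg_cellMap (γ : Γ) (τ : ι → PState p) : cellDeg (cellMap κ γ τ) = cellDeg τ := by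
  refine (Fintype.sum_bijective _ (MulAction.bijective γ) _ _ fun w => ?_).symm
  rw [cellMap_smul, PState.deg_shift]

theorem cellMap_update (γ : Γ) (τ : ι → PState p) (w : ι) (s : PState p) :
    cellMap κ γ (Function.update τ w s) =
      Function.update (cellMap κ γ τ) (γ • w) (s.shift (κ γ w)) := by
  refine cellMap_ext γ fun u => ?_
  rw [cellMap_smul]
  by_cases h : u = w
  · subst h; simp
  · rw [Function.update_of_ne h, Function.update_of_ne (by simpa using h), cellMap_smul]

/-- The group element reverses the order of the two coordinates. -/
def IsInversion (γ : Γ) (u v : ι) : Prop := ¬ (u < v ↔ γ • u < γ • v)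

theorem isInversion_comm (γ : Γ) (u v : ι) : IsInversion γ u v ↔ IsInversion γ v u := by
  by_cases h : u = v
  · rw [h]
  have h' : γ • u ≠ γ • v := by simpa using h
  unfold IsInversion
  rcases lt_or_gt_of_ne h with h1 | h1 <;> rcases lt_or_gt_of_ne h' with h2 | h2 <;>
    simp [h1, h2, h1.not_gt, h2.not_gt]

theorem not_isInversion_self (γ : Γ) (u : ι) : ¬ IsInversion γ u u := by
  simp [IsInversion]

theorem isInversion_mul (a b : Γ) (u v : ι) :
    IsInversion (a * b) u v ↔ ¬ (IsInversion a (b • u) (b • v) ↔ IsInversion b u v) := by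
  simp only [IsInversion, mul_smul]
  tauto

open Classical in
variable (k) in
/-- The contribution of a pair of coordinates to the sign of the action on a cell. -/
def pairSign (γ : Γ) (τ : ι → PState p) : Sym2 ι → k :=
  Sym2.lift ⟨fun u v => if (τ u).deg = 1 ∧ (τ v).deg = 1 ∧ IsInversion γ u v then -1 else 1,
    fun u v => by
      simp only [isInversion_comm γ u v]
      congr 1
      rw [← and_assoc, ← and_assoc, and_comm (a := (τ u).deg = 1)]⟩

open Classical in
theorem pairSign_mk (γ : Γ) (τ : ι → PState p) (u v : ι) :
    pairSign k γ τ s(u, v) =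
      if (τ u).deg = 1 ∧ (τ v).deg = 1 ∧ IsInversion γ u v then -1 else 1 := rfl

variable (k) in
/-- The sign of the action on a cell. -/
def cellSign (γ : Γ) (τ : ι → PState p) : k := ∏ e, pairSign k γ τ e

theorem cellSign_eq_one (γ : Γ) (τ : ι → PState p) (h : ∀ w, (τ w).deg ≠ 1) :
    cellSign k γ τ = 1 := by
  refine Finset.prod_eq_one fun e _ => ?_
  induction e using Sym2.ind with
  | _ u v => rw [pairSign_mk, if_neg fun h' => h u h'.1]

theorem cellSign_one (τ : ι → PState p) : cellSign k (1 : Γ) τ = 1 := by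
  refine Finset.prod_eq_one fun e _ => ?_
  induction e using Sym2.ind with
  | _ u v => rw [pairSign_mk, if_neg fun h' => h'.2.2 (by simp)]

theorem cellSign_mul (a b : Γ) (τ : ι → PState p) :
    cellSign k (a * b) τ = cellSign k a (cellMap κ b τ) * cellSign k b τ := by
  have hb : Function.Bijective (Sym2.map (b • · : ι → ι)) := by
    refine Function.bijective_iff_has_inverse.2 ⟨Sym2.map (b⁻¹ • ·), fun e => ?_, fun e => ?_⟩ <;>
    · rw [Sym2.map_map]
      induction e using Sym2.ind with
      | _ u v => simp
  rw [cellSign, cellSign, cellSign, ← Fintype.prod_bijective _ hb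
    (fun e => pairSign k a (cellMap κ b τ) (Sym2.map (b • · : ι → ι) e)) _ (fun _ => rfl),
    ← Finset.prod_mul_distrib]
  refine Finset.prod_congr rfl fun e _ => ?_
  induction e using Sym2.ind with
  | _ u v =>
    rw [Sym2.map_mk, pairSign_mk, pairSign_mk, pairSign_mk, cellMap_smul, cellMap_smul,
      PState.deg_shift, PState.deg_shift, isInversion_mul]
    by_cases h1 : (τ u).deg = 1 <;> by_cases h2 : (τ v).deg = 1 <;>
      by_cases h3 : IsInversion a (b • u) (b • v) <;> by_cases h4 : IsInversion b u v <;>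
      simp [h1, h2, h3, h4]

theorem pairSign_mul_self (γ : Γ) (τ : ι → PState p) (e : Sym2 ι) :
    pairSign k γ τ e * pairSign k γ τ e = 1 := by
  induction e using Sym2.ind with
  | _ u v => rw [pairSign_mk]; split_ifs <;> simp

theorem cellSign_mul_self (γ : Γ) (τ : ι → PState p) :
    cellSign k γ τ * cellSign k γ τ = 1 := by
  rw [cellSign, ← Finset.prod_mul_distrib]
  exact Finset.prod_eq_one fun e _ => pairSign_mul_self γ τ e

open Classical in
theorem cellSign_mul_update (γ : Γ) (τ : ι → PState p) (w : ι) (s : PState p)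
    (hs : (τ w).deg = 1 ↔ ¬ s.deg = 1) :
    cellSign k γ τ * cellSign k γ (Function.update τ w s) =
      ∏ v, if (τ v).deg = 1 ∧ IsInversion γ v w then (-1 : k) else 1 := by
  rw [cellSign, cellSign, ← Finset.prod_mul_distrib,
    ← Finset.prod_subset (Finset.subset_univ (Finset.univ.image fun v => s(w, v)))]
  · rw [Finset.prod_image (fun u _ v _ h => by rw [Sym2.eq_iff] at h; aesop)]
    refine Finset.prod_congr rfl fun v _ => ?_
    rw [pairSign_mk, pairSign_mk, Function.update_self]
    by_cases h : v = w
    · subst h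
      simp [not_isInversion_self]
    · rw [Function.update_of_ne h, isInversion_comm γ w v]
      by_cases h1 : (τ v).deg = 1 <;> by_cases h2 : s.deg = 1 <;>
        by_cases h3 : IsInversion γ v w <;> simp [h1, h2, h3, hs]
  · intro e _ he
    have : pairSign k γ (Function.update τ w s) e = pairSign k γ τ e := by
      induction e using Sym2.ind with
      | _ u v =>
        have hu : u ≠ w := by
          rintro rfl; exact he (Finset.mem_image.2 ⟨v, Finset.mem_univ _, rfl⟩)
        have hv : v ≠ w := by
          rintro rfl; exact he (Finset.mem_image.2 ⟨u, Finset.mem_univ _, Sym2.eq_swap⟩)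
        rw [pairSign_mk, pairSign_mk, Function.update_of_ne hu, Function.update_of_ne hv]
    rw [this, pairSign_mul_self]

theorem prod_sgn_cellMap (γ : Γ) (τ : ι → PState p) (w : ι) :
    ∏ u with u < γ • w, (cellMap κ γ τ u).sgn k = ∏ u with γ • u < γ • w, (τ u).sgn k := by
  rw [Finset.prod_filter, Finset.prod_filter]
  refine (Fintype.prod_bijective _ (MulAction.bijective γ) _ _ fun u => ?_).symm
  rw [cellMap_smul, PState.sgn_shift]

theorem koszul_cellSign (γ : Γ) (τ : ι → PState p) (w : ι) (s : PState p)
    (hs : (τ w).deg = 1 ↔ ¬ s.deg = 1) :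
    (∏ u with u < γ • w, (cellMap κ γ τ u).sgn k) * cellSign k γ (Function.update τ w s) =
      cellSign k γ τ * ∏ u with u < w, (τ u).sgn k := by
  classical
  have h1 := cellSign_mul_update (k := k) γ τ w s hs
  have h2 : cellSign k γ (Function.update τ w s) =
      cellSign k γ τ * ∏ v, if (τ v).deg = 1 ∧ IsInversion γ v w then (-1 : k) else 1 := by
    rw [← h1, ← mul_assoc, cellSign_mul_self, one_mul]
  rw [h2, prod_sgn_cellMap, mul_left_comm]
  congr 1
  rw [Finset.prod_filter, Finset.prod_filter, ← Finset.prod_mul_distrib]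
  refine Finset.prod_congr rfl fun u _ => ?_
  rw [PState.sgn_eq, IsInversion]
  by_cases h1 : (τ u).deg = 1 <;> by_cases h3 : u < w <;> by_cases h4 : γ • u < γ • w <;>
    simp [h1, h3, h4]

/-- The representation on cochains of the join of `p`-gons. -/
def cellRep (ρ : Representation k Γ M) : Representation k Γ ((ι → PState p) → M) :=
  letI := cellAction hκ
  monRep ρ (cellSign k) cellSign_one (cellSign_mul (κ := κ))

theorem cellRep_apply (ρ : Representation k Γ M) (γ : Γ) (F : (ι → PState p) → M)
    (τ : ι → PState p) :
    cellRep hκ ρ γ F (cellMap κ γ τ) = cellSign k γ τ • ρ γ (F τ) :=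
  letI := cellAction hκ
  monRep_apply_smul (s := cellSign k) (hs1 := cellSign_one) (hs := cellSign_mul (κ := κ)) γ F τ

include hκ in
theorem cellMap_surjective (γ : Γ) : Function.Surjective (cellMap (p := p) κ γ) :=
  letI := cellAction hκ
  MulAction.surjective γ

theorem cellDiff_cellRep (ρ : Representation k Γ M) (γ : Γ) (F : (ι → PState p) → M) :
    cellDiff k p M (cellRep hκ ρ γ F) = cellRep hκ ρ γ (cellDiff k p M F) := by
  funext τ
  obtain ⟨τ, rfl⟩ := cellMap_surjective hκ γ τ
  rw [cellRep_apply]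
  simp only [cellDiff, totalOp, LinearMap.sum_apply, Finset.sum_apply, sgOp,
    Module.End.mul_apply, epsOp_apply, locOp_apply, map_sum, map_smul, Finset.smul_sum]
  refine (Fintype.sum_bijective _ (MulAction.bijective γ) _ _ fun w => ?_).symm
  refine Fintype.sum_bijective _ (PState.shift_bijective (κ γ w)) _ _ fun s => ?_
  rw [← cellMap_update, cellRep_apply, cellMap_smul, bdMat_shift]
  by_cases h : bdMat k p (τ w) s = 0
  · simp [h]
  have hs : (τ w).deg = 1 ↔ ¬ s.deg = 1 := by
    have := deg_of_bdMat_ne_zero h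
    have : (τ w).deg ≤ 2 := by rcases τ w with _ | ⟨_ | _, a⟩ <;> simp [PState.deg]
    omega
  have := koszul_cellSign (k := k) (κ := κ) γ τ w s hs
  rw [smul_smul, smul_smul, smul_smul, smul_smul, ← this]
  congr 1
  ring

theorem cellAug_cellRep (ρ : Representation k Γ M) (γ : Γ) (F : (ι → PState p) → M) :
    cellAug k ι p M (cellRep hκ ρ γ F) = ρ γ (cellAug k ι p M F) := by
  rw [cellAug_apply, cellAug_apply, map_sum]
  let e : (ι → ZMod p) → ι → ZMod p := fun x w => x (γ⁻¹ • w) + κ γ (γ⁻¹ • w)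
  have he : Function.Bijective e := by
    refine (Finite.injective_iff_bijective).1 fun x y h => funext fun w => ?_
    simpa [e] using congrFun h (γ • w)
  refine (Fintype.sum_bijective e he _ _ fun x => ?_).symm
  have := cellRep_apply hκ ρ γ F fun w => some (true, x w)
  rw [cellSign_eq_one _ _ (by simp [PState.deg]), one_smul] at this
  rw [← this]
  rfl

/-- The dimension shifting inequality for the join of `p`-gons. -/
theorem betti_le_of_cellAction [Finite Γ] [FiniteDimensional k M] [Nonempty ι]
    (ρ : Representation k Γ M)
    (hstab : letI := cellAction hκ
      ∀ τ : ι → PState p, ∀ γ : Γ, γ • τ = τ → cellSign k γ τ = 1)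
    (B : ℕ → ℕ)
    (hB : letI := cellAction hκ
      ∀ (n : ℕ) (τ : ι → PState p), cellDeg τ ≠ 0 →
      betti (ρ.comp (MulAction.stabilizer Γ τ).subtype) n ≤ B n) (m : ℕ) :
    betti ρ (m + 2 * Fintype.card ι) ≤
      Nat.card (ι → PState p) * ∑ t ∈ Finset.range (2 * Fintype.card ι), B (m + t + 1) +
        betti ρ m := by
  let := cellAction hκ
  obtain ⟨N, hN⟩ : ∃ N, 2 * Fintype.card ι = N + 1 :=
    Nat.exists_eq_succ_of_ne_zero (by simp [Fintype.card_ne_zero])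
  have hT : ∀ i (γ : Γ), ∀ τ ∈ {τ : ι → PState p | cellDeg τ = i},
      γ • τ ∈ {τ : ι → PState p | cellDeg τ = i} := fun i γ τ hτ =>
    (cellDeg_cellMap γ τ).trans hτ
  have hU : ∀ i γ, ∀ F ∈ cellChains k ι p M i, cellRep hκ ρ γ F ∈ cellChains k ι p M i :=
    fun i γ F hF => monRep_mem_supportedOn (hT i) γ F hF
  have main := betti_le_sum_of_exact (cellRep hκ ρ) ρ (cellChains k ι p M) hU (cellDiff k p M)
    (cellDiff_cellRep hκ ρ) (fun i v hv => cellDiff_mem hv) cellDiff_cellDiff N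
    (cellAug k ι p M) (cellAug_cellRep hκ ρ) (fun v hv => cellDiff_injective hv)
    (fun i hi v hv => cellDiff_exact (by omega) hv) (fun v _ => cellAug_cellDiff v)
    (fun v hv => cellDiff_exact_top hN hv) (by rw [← hN]; exact cellAug_surjective) m
  rw [hN]
  refine main.trans (add_le_add ?_ ?_)
  · rw [Finset.mul_sum]
    refine Finset.sum_le_sum fun t _ => ?_
    refine (betti_supportedOn_le {τ : ι → PState p | cellDeg τ = t + 1} (hT (t + 1))
      (fun τ _ => hstab τ) (m + t + 1) (B (m + t + 1)) fun τ hτ => hB _ τ ?_).trans ?_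
    · rw [hτ]; omega
    · exact Nat.mul_le_mul_right _ (Set.ncard_le_card _)
  · refine (betti_supportedOn_le {τ : ι → PState p | cellDeg τ = 0} (hT 0)
      (fun τ _ => hstab τ) m (betti ρ m) fun τ hτ => ?_).trans ?_
    · have hnone : ∀ w, τ w = none := fun w => by
        have := (Finset.sum_eq_zero_iff.1 (show ∑ w, (τ w).deg = 0 from hτ)) w (Finset.mem_univ w)
        rcases h : τ w with _ | ⟨_ | _, a⟩ <;> simp_all [PState.deg]
      have htop : MulAction.stabilizer Γ τ = ⊤ := by
        rw [eq_top_iff]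
        intro γ _
        refine MulAction.mem_stabilizer_iff.2 (funext fun w => ?_)
        change (τ (γ⁻¹ • w)).shift _ = τ w
        rw [hnone, hnone]; rfl
      rw [htop]
      exact (betti_congr (ρ := ρ.comp (⊤ : Subgroup Γ).subtype) (σ := ρ) Subgroup.topEquiv
        (LinearEquiv.refl k M) (fun _ _ => rfl) m).le
    · have : {τ : ι → PState p | cellDeg τ = 0}.ncard ≤ 1 := by
        rw [Set.ncard_le_one_iff]
        have hnone : ∀ τ : ι → PState p, cellDeg τ = 0 → ∀ w, τ w = none := fun τ hτ w => by
          have := (Finset.sum_eq_zero_iff.1 hτ) w (Finset.mem_univ w)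
          rcases h : τ w with _ | ⟨_ | _, a⟩ <;> simp_all [PState.deg]
        intro a b ha hb
        funext w
        rw [hnone a ha, hnone b hb]
      calc _ ≤ 1 * betti ρ m := Nat.mul_le_mul_right _ this
        _ = _ := one_mul _

end CellAction

section CentralExtension

variable {k : Type} [Field k] {p : ℕ} [Fact p.Prime] [CharP k p] {G : Type} [Group G] [Finite G]
  {M : Type} [AddCommGroup M] [Module k M] [FiniteDimensional k M]

theorem exists_cocycle (z : Multiplicative (ZMod p) →* G) (hz : ∀ c, z c ∈ Subgroup.center G)
    (g : G) (c : Multiplicative (ZMod p)) (w : G ⧸ z.range) :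
    ∃ a : ZMod p, (g • w).out * z (Multiplicative.ofAdd a) = g * z c * w.out := by
  have hc := Subgroup.mem_center_iff.1 (hz c)
  have h : ((g • w).out : G ⧸ z.range) = ((g * z c * w.out : G) : G ⧸ z.range) := by
    rw [QuotientGroup.out_eq', mul_assoc, ← hc, ← mul_assoc]
    rw [QuotientGroup.mk_mul_of_mem _ (show z c ∈ z.range from ⟨c, rfl⟩)]
    conv_lhs => rw [← QuotientGroup.out_eq' w]
    rfl
  obtain ⟨a, ha⟩ := QuotientGroup.eq.1 h
  exact ⟨a.toAdd, by rw [ofAdd_toAdd, ha, mul_inv_cancel_left]⟩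

theorem eq_one_of_isPGroup {H : Type} [Group H] (hH : IsPGroup p H) (χ : H →* k) (h : H) :
    χ h = 1 := by
  obtain ⟨n, hn⟩ := hH h
  have h1 : (χ h) ^ p ^ n = 1 := by rw [← map_pow, hn, map_one]
  have h2 : (χ h - 1) ^ p ^ n = 0 := by rw [sub_pow_char_pow, h1, one_pow, sub_self]
  exact sub_eq_zero.1 (pow_eq_zero_iff (pow_ne_zero n (Fact.out : p.Prime).ne_zero) |>.1 h2)

/-- The dimension shifting inequality attached to a central subgroup of order `p`. -/
theorem exists_betti_le_of_central (hG : IsPGroup p G) (z : Multiplicative (ZMod p) →* G)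
    (hinj : Function.Injective z) (hz : ∀ c, z c ∈ Subgroup.center G) :
    ∃ q C : ℕ, 0 < q ∧ ∀ (ρ : Representation k G M) (B : ℕ → ℕ),
      (∀ (n : ℕ) (S : Subgroup (G × Multiplicative (ZMod p))),
        (∀ b c, (z b, c) ∈ S → b * c = 1) →
        betti ((ρ.comp (MonoidHom.fst G (Multiplicative (ZMod p)))).comp S.subtype) n ≤ B n) →
      ∀ m, betti ρ (m + 2 * q) ≤ C * ∑ t ∈ Finset.range (2 * q), B (m + t + 1) := by
  classical
  let ι := G ⧸ z.range
  let _ : Fintype ι := Fintype.ofFinite ι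
  let _ : LinearOrder ι := LinearOrder.lift' (Fintype.equivFin ι) (Equiv.injective _)
  let _ : MulAction (G × Multiplicative (ZMod p)) ι :=
    MulAction.compHom ι (MonoidHom.fst G (Multiplicative (ZMod p)))
  choose κ' hκ' using exists_cocycle z hz
  let κ : G × Multiplicative (ZMod p) → ι → ZMod p := fun γ w => κ' γ.1 γ.2 w
  have hz' : ∀ c g, g * z c = z c * g := fun c => Subgroup.mem_center_iff.1 (hz c)
  have huniq : ∀ {a b : ZMod p} (g : G), g * z (Multiplicative.ofAdd a) =
      g * z (Multiplicative.ofAdd b) → a = b := fun g h =>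
    Multiplicative.ofAdd.injective (hinj (mul_left_cancel h))
  have hκ : ∀ a b w, κ (a * b) w = κ a (b • w) + κ b w := by
    rintro ⟨g, c⟩ ⟨h, d⟩ w
    refine huniq ((g * h) • w : ι).out ?_
    rw [ofAdd_add, map_mul]
    change _ * z (Multiplicative.ofAdd (κ' (g * h) (c * d) w)) =
      _ * (z (Multiplicative.ofAdd (κ' g c (h • w))) * z (Multiplicative.ofAdd (κ' h d w)))
    rw [hκ', ← mul_assoc, mul_smul, hκ', mul_assoc (g * z c), hκ', map_mul]
    simp only [mul_assoc]
    rw [← mul_assoc (z c) h, ← hz' c h]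
    simp only [mul_assoc]
  have hzfix : ∀ b (w : ι), z b • w = w := by
    intro b w
    rw [← QuotientGroup.out_eq' w]
    change ((z b * w.out : G) : ι) = _
    rw [← hz', QuotientGroup.mk_mul_of_mem _ (show z b ∈ z.range from ⟨b, rfl⟩)]
  have hκz : ∀ b c w, κ (z b, c) w = (b * c).toAdd := by
    intro b c w
    refine huniq w.out ?_
    have := hκ' (z b) c w
    rw [hzfix] at this
    change w.out * z (Multiplicative.ofAdd (κ' (z b) c w)) = _
    rw [this, ofAdd_toAdd, ← map_mul, ← hz']
  have hΓ : IsPGroup p (G × Multiplicative (ZMod p)) := by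
    rw [IsPGroup.iff_card] at hG ⊢
    obtain ⟨n, hn⟩ := hG
    exact ⟨n + 1, by simp [Nat.card_prod, hn, pow_succ]⟩
  refine ⟨Fintype.card ι, Nat.card (ι → PState p), Fintype.card_pos, fun ρ B hB m => ?_⟩
  let _ := cellAction hκ
  have h1 := betti_le_of_cellAction hκ (ρ.comp (MonoidHom.fst G (Multiplicative (ZMod p))))
    (by
      intro τ γ hγ
      let χ : MulAction.stabilizer (G × Multiplicative (ZMod p)) τ →* k :=
        { toFun := fun γ => cellSign k γ.1 τ
          map_one' := cellSign_one τ
          map_mul' := fun a b => by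
            have := cellSign_mul (k := k) (κ := κ) a.1 b.1 τ
            have hb : cellMap κ b.1 τ = τ := b.2
            rwa [hb] at this }
      exact eq_one_of_isPGroup (hΓ.to_subgroup _) χ ⟨γ, hγ⟩) B
    (by
      intro n τ hτ
      refine hB n _ fun b c hbc => ?_
      obtain ⟨w, hw⟩ : ∃ w, τ w ≠ none := by
        by_contra! h
        exact hτ (Finset.sum_eq_zero fun w _ => by rw [h w]; rfl)
      have hbc' : cellMap κ (z b, c) τ = τ := hbc
      have h2 := cellMap_smul κ (z b, c) τ w
      have h3 : ((z b, c) : G × Multiplicative (ZMod p)) • w = w := hzfix b w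
      rw [hbc', h3, hκz] at h2
      exact PState.shift_eq_self h2.symm hw) m
  obtain ⟨q, hq⟩ : ∃ q, Fintype.card ι = q + 1 := Nat.exists_eq_succ_of_ne_zero Fintype.card_ne_zero
  have h2 := betti_add_two_mul_ge (p := p) ρ m q
  rw [← hq] at h2
  omega

end CentralExtension

section PGroup

variable {p : ℕ} [Fact p.Prime] {G : Type} [Group G] [Finite G]

theorem IsPGroup.exists_ne_one_mem_center (hG : IsPGroup p G) (N : Subgroup G) [N.Normal]
    (hN : N ≠ ⊥) : ∃ n ∈ N, n ∈ Subgroup.center G ∧ n ≠ 1 := by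
  have hC : IsPGroup p (ConjAct G) := hG.of_equiv ConjAct.toConjAct
  have hdvd : p ∣ Nat.card N := by
    rcases (hG.to_subgroup N).card_eq_or_dvd with h | h
    · exact (hN (Subgroup.card_eq_one.1 h)).elim
    · exact h
  obtain ⟨b, hb, hne⟩ := hC.exists_fixed_point_of_prime_dvd_card_of_fixed_point N hdvd
    (a := (1 : N)) (fun g => smul_one g)
  refine ⟨b, b.2, Subgroup.mem_center_iff.2 fun g => ?_, fun h => hne (Subtype.ext h.symm)⟩
  have := congrArg Subtype.val (hb (ConjAct.toConjAct g))
  rw [ConjAct.Subgroup.val_conj_smul, ConjAct.toConjAct_smul] at this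
  exact mul_inv_eq_iff_eq_mul.1 this

theorem exists_addEquiv_of_module (p : ℕ) [Fact p.Prime] (A : Type) [AddCommGroup A] [Finite A]
    [Module (ZMod p) A] : ∃ r, Nonempty (A ≃+ (Fin r → ZMod p)) :=
  ⟨_, ⟨(Module.finBasis (ZMod p) A).equivFun.toAddEquiv⟩⟩

theorem exists_addEquiv_of_nsmul_eq_zero {A : Type} [AddCommGroup A] [Finite A]
    (h : ∀ x : A, p • x = 0) : ∃ r, Nonempty (A ≃+ (Fin r → ZMod p)) := by
  let _ : Module (ZMod p) A := AddCommGroup.zmodModule h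
  exact exists_addEquiv_of_module p A

theorem IsPGroup.isPElementaryAbelian_or_exists_central (hG : IsPGroup p G) :
    IsPElementaryAbelian p G ∨ ∃ z : Multiplicative (ZMod p) →* G, Function.Injective z ∧
      (∀ c, z c ∈ Subgroup.center G) ∧ ∀ ψ : G →* Multiplicative (ZMod p), ∀ c, ψ (z c) = 1 := by
  let Ψ : G →* ((G →* Multiplicative (ZMod p)) → Multiplicative (ZMod p)) :=
    MonoidHom.pi fun ψ => ψ
  by_cases hN : Ψ.ker = ⊥
  · left
    have hinj := (MonoidHom.ker_eq_bot_iff Ψ).1 hN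
    let _ : CommGroup G := { mul_comm := fun a b => hinj (by rw [map_mul, map_mul, mul_comm]) }
    have hexp : ∀ x : Additive G, p • x = 0 := by
      intro x
      change (Additive.toMul x) ^ p = 1
      refine hinj (funext fun ψ => ?_)
      rw [map_pow, map_one]
      change (ψ x.toMul) ^ p = 1
      have : p • (ψ x.toMul).toAdd = 0 := by simp
      exact this
    obtain ⟨r, ⟨e⟩⟩ := exists_addEquiv_of_nsmul_eq_zero hexp
    exact ⟨r, ⟨(MulEquiv.refl (Multiplicative (Additive G))).trans (AddEquiv.toMultiplicative e)⟩⟩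
  · right
    obtain ⟨n, hn, hnc, hn1⟩ := hG.exists_ne_one_mem_center Ψ.ker hN
    have hdvd := hG.dvd_orderOf hn1
    let x := n ^ (orderOf n / p)
    have hx : orderOf x = p := orderOf_pow_orderOf_div (orderOf_pos n).ne' hdvd
    have e := zmodCyclicMulEquiv (inferInstance : IsCyclic (Subgroup.zpowers x))
    rw [Nat.card_zpowers, hx] at e
    have hle : Subgroup.zpowers x ≤ Ψ.ker ⊓ Subgroup.center G := by
      rw [Subgroup.zpowers_le]
      exact pow_mem (Subgroup.mem_inf.2 ⟨hn, hnc⟩) _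
    refine ⟨(Subgroup.zpowers x).subtype.comp e.toMonoidHom,
      (Subgroup.subtype_injective _).comp e.injective, fun c => (hle (e c).2).2, fun ψ c => ?_⟩
    have := (hle (e c).2).1
    exact congrFun (MonoidHom.mem_ker.1 this) ψ

end PGroup

section ComplexityFunction

variable {f : ℕ → NNReal}

theorem IsProperComplexityFunction.pos (hf : IsProperComplexityFunction f) (n : ℕ) : 0 < f n := by
  obtain ⟨c, hc⟩ := hf 0
  have := hc n (by simp)
  rcases eq_or_ne (f n) 0 with h | h
  · simp [h] at this
  · exact pos_iff_ne_zero.2 h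

theorem IsProperComplexityFunction.exists_le (hf : IsProperComplexityFunction f) (a b : ℕ) :
    ∃ c : NNReal, ∀ m, f (m + a) ≤ c * f (m + b) := by
  obtain ⟨c, hc⟩ := hf ((a : ℤ) - b)
  refine ⟨c, fun m => ?_⟩
  have := hc (m + b) (by push_cast; omega)
  have h : (((m + b : ℕ) : ℤ) + (a - b)).toNat = m + a := by push_cast; omega
  rw [h] at this
  exact this.le

end ComplexityFunction

section Elementary

variable {k : Type} [Field k] {p : ℕ} [Fact p.Prime] [CharP k p]
  {M : Type} [AddCommGroup M] [Module k M] [FiniteDimensional k M]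

/-- Growth of homology of a `p`-group is detected on elementary abelian groups. -/
theorem exists_betti_le_of_elementary {f : ℕ → NNReal} (hf : IsProperComplexityFunction f)
    {G : Type} [Group G] [Finite G] (hG : IsPGroup p G) (ρ : Representation k G M)
    (hE : ∀ (E : Type) [Group E] [Finite E] (φ : E →* G), Function.Injective φ →
      IsPElementaryAbelian p E → ∃ d : NNReal, ∀ n, (betti (ρ.comp φ) n : NNReal) ≤ d * f n) :
    ∃ d : NNReal, ∀ n, (betti ρ n : NNReal) ≤ d * f n := by
  induction hc : Nat.card G using Nat.strong_induction_on generalizing G with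
  | _ N ih =>
  subst hc
  classical
  rcases hG.isPElementaryAbelian_or_exists_central with hel | ⟨z, hinj, hz, hψ⟩
  · exact hE G (MonoidHom.id G) Function.injective_id hel
  obtain ⟨q, C, hq, hqC⟩ := exists_betti_le_of_central (k := k) (M := M) hG z hinj hz
  let Γ := G × Multiplicative (ZMod p)
  let σ : ∀ S : Subgroup Γ, Representation k S M := fun S =>
    (ρ.comp (MonoidHom.fst G (Multiplicative (ZMod p)))).comp S.subtype
  have hS : ∀ S : Subgroup Γ, ∃ d : NNReal, (∀ b c, (z b, c) ∈ S → b * c = 1) →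
      ∀ n, (betti (σ S) n : NNReal) ≤ d * f n := by
    intro S
    by_cases hS : ∀ b c, (z b, c) ∈ S → b * c = 1
    swap
    · exact ⟨0, fun h => (hS h).elim⟩
    let π : S →* G := (MonoidHom.fst G (Multiplicative (ZMod p))).comp S.subtype
    have hπ : Function.Injective π := by
      rw [injective_iff_map_eq_one]
      rintro ⟨⟨g, c⟩, hgc⟩ (rfl : g = 1)
      have := hS 1 c (by rwa [map_one])
      rw [one_mul] at this
      subst this
      rfl
    have hlt : Nat.card S < Nat.card G := by
      refine lt_of_le_of_ne (Nat.card_le_card_of_injective π hπ) fun heq => ?_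
      have hbij : Function.Bijective π := (Nat.bijective_iff_injective_and_card π).2 ⟨hπ, heq⟩
      let e := MulEquiv.ofBijective π hbij
      let ψ : G →* Multiplicative (ZMod p) :=
        ((MonoidHom.snd G (Multiplicative (ZMod p))).comp S.subtype).comp e.symm.toMonoidHom
      let x := z (Multiplicative.ofAdd 1)
      have h1 : (e.symm x).1.2 = 1 := hψ ψ (Multiplicative.ofAdd 1)
      have h2 : (e.symm x).1.1 = x := e.apply_symm_apply x
      have h3 : (e.symm x).1 = (x, 1) := Prod.ext h2 h1
      have h4 := hS (Multiplicative.ofAdd 1) 1 (by rw [← h3]; exact (e.symm x).2)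
      rw [mul_one] at h4
      exact one_ne_zero (α := ZMod p) h4
    obtain ⟨d, hd⟩ := ih _ hlt (hG.of_injective π hπ) (σ S)
      (fun E _ _ φ hφ hEl => hE E (π.comp φ) (hπ.comp hφ) hEl) rfl
    exact ⟨d, fun _ => hd⟩
  choose D hD using hS
  let _ : Fintype (Subgroup Γ) := Fintype.ofFinite _
  let B : ℕ → ℕ := fun n => ∑ S : Subgroup Γ,
    if ∀ b c, (z b, c) ∈ S → b * c = 1 then betti (σ S) n else 0
  have hB : ∀ n, (B n : NNReal) ≤ (∑ S, D S) * f n := by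
    intro n
    simp only [B]
    rw [Nat.cast_sum, Finset.sum_mul]
    refine Finset.sum_le_sum fun S _ => ?_
    split_ifs with h
    · exact hD S h n
    · simp
  have key := hqC ρ B (fun n S hS => by
    refine le_trans ?_ (Finset.single_le_sum (fun _ _ => Nat.zero_le _) (Finset.mem_univ S))
    rw [if_pos hS])
  choose c hc using fun t => hf.exists_le (t + 1) (2 * q)
  have h1 : ∀ m, (betti ρ (m + 2 * q) : NNReal) ≤
      (C * ∑ t ∈ Finset.range (2 * q), (∑ S, D S) * c t) * f (m + 2 * q) := by
    intro m
    have := key m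
    refine (Nat.cast_le.2 this).trans ?_
    push_cast
    rw [mul_assoc, Finset.sum_mul]
    refine mul_le_mul_right (Finset.sum_le_sum fun t _ => ?_) _
    rw [mul_assoc]
    exact (hB _).trans (mul_le_mul_right (hc t m) _)
  refine ⟨(C * ∑ t ∈ Finset.range (2 * q), (∑ S, D S) * c t) +
    ∑ n ∈ Finset.range (2 * q), betti ρ n / f n, fun n => ?_⟩
  rcases lt_or_ge n (2 * q) with h | h
  · have h2 : (betti ρ n : NNReal) / f n ≤ ∑ n ∈ Finset.range (2 * q), (betti ρ n : NNReal) / f n :=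
      Finset.single_le_sum (f := fun n => (betti ρ n : NNReal) / f n) (fun _ _ => zero_le)
        (Finset.mem_range.2 h)
    calc (betti ρ n : NNReal) = betti ρ n / f n * f n := by
          rw [div_mul_cancel₀ _ (hf.pos n).ne']
      _ ≤ _ := mul_le_mul_left (h2.trans le_add_self) _
  · obtain ⟨m, rfl⟩ := Nat.exists_eq_add_of_le' h
    exact (h1 m).trans (mul_le_mul_left le_self_add _)

end Elementary

section Resolution

variable {k : Type} [Field k] {G : Type} [Group G]

/-- A linear map between representations commuting with the action. -/
def Equivariant (X Y : Rep.{0} k G) (l : X →ₗ[k] Y) : Prop :=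
  ∀ g v, l (X.ρ g v) = Y.ρ g (l v)

/-- The morphism of representations given by an equivariant linear map. -/
def Equivariant.toHom {X Y : Rep.{0} k G} {l : X →ₗ[k] Y} (h : Equivariant X Y l) : X ⟶ Y :=
  Rep.ofHom ⟨l, fun g => LinearMap.ext (h g)⟩

theorem equivariant_hom {X Y : Rep.{0} k G} (f : X ⟶ Y) :
    Equivariant X Y f.hom.toLinearMap :=
  fun g v => Rep.hom_comm_apply f g v

theorem Equivariant.comp {X Y Z : Rep.{0} k G} {l : X →ₗ[k] Y} {m : Y →ₗ[k] Z}
    (hm : Equivariant Y Z m) (hl : Equivariant X Y l) : Equivariant X Z (m ∘ₗ l) :=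
  fun g v => by simp only [LinearMap.comp_apply, hl g v, hm g]

theorem Equivariant.pow {X : Rep.{0} k G} {e : X →ₗ[k] X} (he : Equivariant X X e) (n : ℕ) :
    Equivariant X X (e ^ n) := by
  induction n with
  | zero => exact fun g v => rfl
  | succ n ih => exact fun g v => by rw [pow_succ, Module.End.mul_apply, he, ih]; rfl

theorem Equivariant.of_comp_injective {X Y Z : Rep.{0} k G} {l : X →ₗ[k] Y} {m : Y →ₗ[k] Z}
    (hm : Equivariant Y Z m) (hinj : Function.Injective m)
    (h : Equivariant X Z (m ∘ₗ l)) : Equivariant X Y l :=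
  fun g v => hinj (by rw [hm]; exact h g v)

theorem exists_lift_of_projective {P Q N : Rep.{0} k G} (hP : Projective P) {π : Q →ₗ[k] N}
    (hπ : Equivariant Q N π) (hsurj : Function.Surjective π) {f : P →ₗ[k] N}
    (hf : Equivariant P N f) : ∃ g : P →ₗ[k] Q, Equivariant P Q g ∧ ∀ x, π (g x) = f x := by
  have : Epi hπ.toHom := (Rep.epi_iff_surjective _).2 hsurj
  refine ⟨(Projective.factorThru hf.toHom hπ.toHom).hom.toLinearMap, equivariant_hom _,
    fun x => ?_⟩
  have := congrArg (fun t => t.hom x) (Projective.factorThru_comp hf.toHom hπ.toHom)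
  exact this

theorem projective_of_retract {P Q : Rep.{0} k G} (hP : Projective P) {s : Q →ₗ[k] P}
    {r : P →ₗ[k] Q} (hs : Equivariant Q P s) (hr : Equivariant P Q r) (h : ∀ x, r (s x) = x) :
    Projective Q :=
  Retract.projective (Y := P) ⟨hs.toHom, hr.toHom, by ext x; exact h x⟩

/-- A short exact sequence `0 → K → P → N → 0` with `P` projective of dimension at most `b`. -/
structure IsCover (K P N : Rep.{0} k G) (i : K →ₗ[k] P) (π : P →ₗ[k] N) (b : NNReal) :
    Prop where
  equivariant_i : Equivariant K P i
  equivariant_π : Equivariant P N π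
  injective : Function.Injective i
  surjective : Function.Surjective π
  exact : Function.Exact i π
  projective : Projective P
  finite : FiniteDimensional k P
  finrank_le : (Module.finrank k P : NNReal) ≤ b

/-- `X` has a resolution by projectives whose `n`-th term has dimension at most `r n`;
`Good n` contains the `n`-th syzygy. -/
def DimRes (X : Rep.{0} k G) (r : ℕ → NNReal) : Prop :=
  ∃ Good : ℕ → Rep.{0} k G → Prop, Good 0 X ∧ ∀ n N, Good n N →
    ∃ (K P : Rep.{0} k G) (i : K →ₗ[k] P) (π : P →ₗ[k] N),
      IsCover K P N i π (r n) ∧ Good (n + 1) K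

theorem exists_stable_pow {V : Type} [AddCommGroup V] [Module k V] [FiniteDimensional k V]
    (e : V →ₗ[k] V) : ∃ m₀, ∀ m ≥ m₀, LinearMap.range (e ^ m) = LinearMap.range (e ^ m₀) ∧
      LinearMap.ker (e ^ m) = LinearMap.ker (e ^ m₀) := by
  obtain ⟨a, ha⟩ := Filter.eventually_atTop.1
    ((LinearMap.eventually_iInf_range_pow_eq e).and (LinearMap.eventually_iSup_ker_pow_eq e))
  exact ⟨a, fun m hm => ⟨(ha m hm).1.symm.trans (ha a le_rfl).1,
    (ha m hm).2.symm.trans (ha a le_rfl).2⟩⟩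

theorem map_pow_apply_of_comm {V W : Type} [AddCommGroup V] [Module k V] [AddCommGroup W]
    [Module k W] {a : V →ₗ[k] V} {b : W →ₗ[k] W} {l : V →ₗ[k] W} (h : ∀ x, l (a x) = b (l x))
    (m : ℕ) (x : V) : l ((a ^ m) x) = (b ^ m) (l x) := by
  induction m generalizing x with
  | zero => rfl
  | succ m ih => rw [pow_succ, pow_succ, Module.End.mul_apply, Module.End.mul_apply, ih, h]

theorem Equivariant.range_invariant {X Y : Rep.{0} k G} {l : X →ₗ[k] Y} (h : Equivariant X Y l)
    (g : G) : ∀ v ∈ LinearMap.range l, Y.ρ g v ∈ LinearMap.range l := by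
  rintro _ ⟨x, rfl⟩
  exact ⟨X.ρ g x, h g x⟩

/-- The image of an equivariant map, as a representation. -/
def Equivariant.image {X Y : Rep.{0} k G} {l : X →ₗ[k] Y} (h : Equivariant X Y l) :
    Rep.{0} k G :=
  Rep.of (subRep Y.ρ (LinearMap.range l) h.range_invariant)

theorem DimRes.of_stable_image {Y : Rep.{0} k G} {r : ℕ → NNReal} (hY : DimRes Y r)
    {X : Rep.{0} k G} {e : Y →ₗ[k] Y} (he : Equivariant Y Y e) {j : X →ₗ[k] Y}
    (hj : Equivariant X Y j) (hji : Function.Injective j) {m₀ : ℕ}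
    (hm₀ : ∀ m ≥ m₀, LinearMap.range j = LinearMap.range (e ^ m)) : DimRes X r := by
  obtain ⟨Good, h0, hG⟩ := hY
  refine ⟨fun n N => ∃ (Z : Rep.{0} k G) (e : Z →ₗ[k] Z) (j : N →ₗ[k] Z) (m₀ : ℕ), Good n Z ∧
    Equivariant Z Z e ∧ Equivariant N Z j ∧ Function.Injective j ∧
    ∀ m ≥ m₀, LinearMap.range j = LinearMap.range (e ^ m),
    ⟨Y, e, j, m₀, h0, he, hj, hji, hm₀⟩, ?_⟩
  rintro n N ⟨Z, e, j, m₀, hZ, he, hj, hji, hm₀⟩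
  obtain ⟨K, P, i, π, hc, hK⟩ := hG n Z hZ
  have := hc.finite
  have : FiniteDimensional k Z := FiniteDimensional.of_surjective π hc.surjective
  have : FiniteDimensional k K := FiniteDimensional.of_injective i hc.injective
  obtain ⟨a, ha, hae⟩ := exists_lift_of_projective hc.projective hc.equivariant_π hc.surjective
    (he.comp hc.equivariant_π)
  have hb : ∀ x : K, ∃ y : K, i y = a (i x) := fun x => (hc.exact _).1 (by
    rw [hae]
    simp [hc.exact.apply_apply_eq_zero])
  choose bf hbf using hb
  let b : K →ₗ[k] K :=
    { toFun := bf
      map_add' := fun x y => hc.injective (by simp [hbf])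
      map_smul' := fun c x => hc.injective (by simp [hbf]) }
  have hbi : ∀ x, i (b x) = a (i x) := hbf
  have hbe : Equivariant K K b := hc.equivariant_i.of_comp_injective hc.injective
    (fun g v => by
      simp only [LinearMap.comp_apply, hbi, hc.equivariant_i g, ha g])
  have hπp : ∀ m x, π ((a ^ m) x) = (e ^ m) (π x) := map_pow_apply_of_comm hae
  have hip : ∀ m x, i ((b ^ m) x) = (a ^ m) (i x) := map_pow_apply_of_comm hbi
  obtain ⟨ma, hma⟩ := exists_stable_pow a
  obtain ⟨mb, hmb⟩ := exists_stable_pow b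
  obtain ⟨me, hme⟩ := exists_stable_pow e
  obtain ⟨m, h1, h2, h3, h4⟩ : ∃ m, m₀ ≤ m ∧ ma ≤ m ∧ mb ≤ m ∧ me ≤ m :=
    ⟨m₀ + ma + mb + me, by omega, by omega, by omega, by omega⟩
  have hra : ∀ m' ≥ m, LinearMap.range (a ^ m') = LinearMap.range (a ^ m) := fun m' h =>
    ((hma m' (h2.trans h)).1).trans (hma m h2).1.symm
  have hrb : ∀ m' ≥ m, LinearMap.range (b ^ m') = LinearMap.range (b ^ m) := fun m' h =>
    ((hmb m' (h3.trans h)).1).trans (hmb m h3).1.symm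
  have hka : ∀ m' ≥ m, LinearMap.ker (a ^ m') = LinearMap.ker (a ^ m) := fun m' h =>
    ((hma m' (h2.trans h)).2).trans (hma m h2).2.symm
  have hke : ∀ m' ≥ m, LinearMap.ker (e ^ m') = LinearMap.ker (e ^ m) := fun m' h =>
    ((hme m' (h4.trans h)).2).trans (hme m h4).2.symm
  have hrj := hm₀ m h1
  let P' := (ha.pow m).image
  let K' := (hbe.pow m).image
  let i' : K' →ₗ[k] P' := i.restrict (p := LinearMap.range (b ^ m))
    (q := LinearMap.range (a ^ m)) (by rintro _ ⟨x, rfl⟩; exact ⟨i x, (hip m x).symm⟩)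
  let jinv := (LinearEquiv.ofInjective j hji).symm
  have hjinv : ∀ y, j (jinv y) = y := fun y =>
    congrArg Subtype.val ((LinearEquiv.ofInjective j hji).apply_symm_apply y)
  have hland : ∀ x ∈ LinearMap.range (a ^ m), π x ∈ LinearMap.range j := by
    rintro _ ⟨x, rfl⟩
    rw [hrj, hπp]
    exact ⟨_, rfl⟩
  let π' : P' →ₗ[k] N := jinv.toLinearMap ∘ₗ π.restrict (p := LinearMap.range (a ^ m))
    (q := LinearMap.range j) hland
  have hπ' : ∀ x : P', j (π' x) = π x.1 := fun x => hjinv _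
  refine ⟨K', P', i', π', ⟨?_, ?_, ?_, ?_, ?_, ?_, ?_, ?_⟩,
    K, b, (LinearMap.range (b ^ m)).subtype, m, hK, hbe, fun g v => rfl,
    Subtype.val_injective, fun m' hm' => ?_⟩
  · exact fun g v => Subtype.ext (hc.equivariant_i g v.1)
  · refine hj.of_comp_injective hji fun g v => ?_
    simp only [LinearMap.comp_apply, hπ']
    exact hc.equivariant_π g v.1
  · exact fun x y h => Subtype.ext (hc.injective (congrArg Subtype.val h))
  · intro y
    obtain ⟨z, hz⟩ : j y ∈ LinearMap.range (e ^ m) := hrj ▸ ⟨y, rfl⟩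
    obtain ⟨x, rfl⟩ := hc.surjective z
    exact ⟨⟨(a ^ m) x, x, rfl⟩, hji ((hπ' _).trans ((hπp m x).trans hz))⟩
  · rintro ⟨x, hx⟩
    constructor
    · intro h
      have hx0 : π x = 0 := by rw [← hπ' ⟨x, hx⟩, h, map_zero]
      rw [← hra (m + m) (by omega)] at hx
      obtain ⟨y, rfl⟩ := hx
      have : π y ∈ LinearMap.ker (e ^ (m + m)) := by rw [LinearMap.mem_ker, ← hπp, hx0]
      rw [hke (m + m) (by omega), LinearMap.mem_ker, ← hπp] at this
      obtain ⟨z, hz⟩ := (hc.exact _).1 this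
      refine ⟨⟨(b ^ m) z, z, rfl⟩, Subtype.ext ?_⟩
      change i ((b ^ m) z) = (a ^ (m + m)) y
      rw [hip, hz, pow_add, Module.End.mul_apply]
    · rintro ⟨y, hy⟩
      have hx0 : π x = 0 := by
        rw [← show i y.1 = x from congrArg Subtype.val hy]
        exact hc.exact.apply_apply_eq_zero y.1
      exact hji ((hπ' _).trans (hx0.trans (map_zero j).symm))
  · let f : P' →ₗ[k] P' := (a ^ m).restrict (p := LinearMap.range (a ^ m))
      (q := LinearMap.range (a ^ m)) fun x _ => ⟨x, rfl⟩
    have hfi : Function.Injective f := by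
      refine (injective_iff_map_eq_zero f).2 ?_
      rintro ⟨_, x, rfl⟩ h
      have h' : (a ^ m) ((a ^ m) x) = 0 := congrArg Subtype.val h
      have : x ∈ LinearMap.ker (a ^ (m + m)) := by
        rw [LinearMap.mem_ker, pow_add, Module.End.mul_apply, h']
      rw [hka (m + m) (by omega)] at this
      exact Subtype.ext this
    have : FiniteDimensional k P' :=
      inferInstanceAs (FiniteDimensional k (LinearMap.range (a ^ m)))
    let F := LinearEquiv.ofInjectiveEndo f hfi
    have hFe : Equivariant P' P' f := fun g v => Subtype.ext (ha.pow m g v.1)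
    have hFs : Equivariant P' P' F.symm.toLinearMap := hFe.of_comp_injective hfi fun g v => by
      have h1 : ∀ w, f (F.symm w) = w := F.apply_symm_apply
      simp only [LinearMap.comp_apply, LinearEquiv.coe_coe, h1]
    have hs : Equivariant P' P (LinearMap.range (a ^ m)).subtype := fun g v => rfl
    have hr : Equivariant P P' (LinearMap.rangeRestrict (a ^ m)) :=
      fun g v => Subtype.ext (ha.pow m g v)
    refine projective_of_retract hc.projective hs (hFs.comp hr) fun x => ?_
    exact F.symm_apply_apply x
  · exact inferInstanceAs (FiniteDimensional k (LinearMap.range (a ^ m)))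
  · refine le_trans ?_ hc.finrank_le
    exact_mod_cast LinearMap.finrank_range_le (a ^ m)
  · exact (Submodule.range_subtype _).trans (hrb m' hm').symm

theorem DimRes.of_retract {X Y : Rep.{0} k G} {r : ℕ → NNReal} (hY : DimRes Y r)
    {s : X →ₗ[k] Y} {t : Y →ₗ[k] X} (hs : Equivariant X Y s) (ht : Equivariant Y X t)
    (h : ∀ x, t (s x) = x) : DimRes X r := by
  have hinj : Function.Injective s := Function.LeftInverse.injective h
  have hid : IsIdempotentElem (s ∘ₗ t : Module.End k Y) := by
    ext x
    simp [Module.End.mul_apply, h]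
  refine hY.of_stable_image (hs.comp ht) hs hinj (m₀ := 1) fun m hm => ?_
  rw [hid.pow_eq (by omega)]
  refine le_antisymm ?_ (LinearMap.range_comp_le_range _ _)
  rintro _ ⟨x, rfl⟩
  exact ⟨s x, by simp [h]⟩

theorem DimRes.mono {X : Rep.{0} k G} {r r' : ℕ → NNReal} (hX : DimRes X r) (h : ∀ n, r n ≤ r' n) :
    DimRes X r' := by
  obtain ⟨Good, h0, hG⟩ := hX
  refine ⟨Good, h0, fun n N hN => ?_⟩
  obtain ⟨K, P, i, π, hc, hK⟩ := hG n N hN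
  exact ⟨K, P, i, π, { hc with finrank_le := hc.finrank_le.trans (h n) }, hK⟩

theorem DimRes.res {X : Rep.{0} k G} {r : ℕ → NNReal} (hX : DimRes X r) (S : Subgroup G) :
    DimRes (Rep.res S.subtype X) r := by
  obtain ⟨Good, h0, hG⟩ := hX
  refine ⟨fun n N => ∃ Z, Good n Z ∧ N = Rep.res S.subtype Z, ⟨X, h0, rfl⟩, ?_⟩
  rintro n _ ⟨Z, hZ, rfl⟩
  obtain ⟨K, P, i, π, hc, hK⟩ := hG n Z hZ
  refine ⟨Rep.res S.subtype K, Rep.res S.subtype P, i, π, ⟨fun g => hc.equivariant_i g,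
    fun g => hc.equivariant_π g, hc.injective, hc.surjective, hc.exact, ?_, hc.finite,
    hc.finrank_le⟩, K, hK, rfl⟩
  have := hc.projective
  exact (Rep.resFunctor S.subtype).projective_obj P

end Resolution

section Coinduction

variable {k : Type} [Field k] {G : Type} [Group G] [Finite G]

theorem finrank_coind_le (S : Subgroup G) (V : Rep.{0} k S) [FiniteDimensional k V] :
    FiniteDimensional k (Rep.coind S.subtype V) ∧
      Module.finrank k (Rep.coind S.subtype V) ≤ Nat.card G * Module.finrank k V := by
  have := Fintype.ofFinite G
  refine ⟨inferInstanceAs (FiniteDimensional k (Representation.coindV S.subtype V.ρ)), ?_⟩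
  refine (Submodule.finrank_le (Representation.coindV S.subtype V.ρ)).trans ?_
  rw [Module.finrank_pi_fintype]
  simp [Nat.card_eq_fintype_card]

theorem projective_coind (S : Subgroup G) {P : Rep.{0} k S} (hP : Projective P) :
    Projective (Rep.coind S.subtype P) := by
  classical
  have := (Rep.coindFunctor k S.subtype).preservesProjectiveObjects_of_adjunction_of_preservesEpimorphisms
    (Rep.coindResAdjunction.{0} k S)
  exact (Rep.coindFunctor k S.subtype).projective_obj P

theorem DimRes.coind {S : Subgroup G} {X : Rep.{0} k S} {r : ℕ → NNReal} (hX : DimRes X r) :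
    DimRes (Rep.coind S.subtype X) (fun n => Nat.card G * r n) := by
  obtain ⟨Good, h0, hG⟩ := hX
  refine ⟨fun n N => ∃ Z, Good n Z ∧ N = Rep.coind S.subtype Z, ⟨X, h0, rfl⟩, ?_⟩
  rintro n _ ⟨Z, hZ, rfl⟩
  obtain ⟨K, P, i, π, hc, hK⟩ := hG n Z hZ
  have hfin := hc.finite
  let i' := Rep.coindMap S.subtype hc.equivariant_i.toHom
  let π' := Rep.coindMap S.subtype hc.equivariant_π.toHom
  have hi' : ∀ (F : Rep.coind S.subtype K) g, (i'.hom F).1 g = i (F.1 g) := fun F g => rfl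
  have hπ' : ∀ (F : Rep.coind S.subtype P) g, (π'.hom F).1 g = π (F.1 g) := fun F g => rfl
  refine ⟨Rep.coind S.subtype K, Rep.coind S.subtype P, i'.hom.toLinearMap, π'.hom.toLinearMap,
    ⟨equivariant_hom _, equivariant_hom _, ?_, ?_, ?_, projective_coind S hc.projective,
    (finrank_coind_le S P).1, ?_⟩, K, hK, rfl⟩
  · intro F F' h
    refine Subtype.ext (funext fun g => hc.injective ?_)
    exact congrFun (congrArg Subtype.val h) g
  · have : Epi hc.equivariant_π.toHom := (Rep.epi_iff_surjective _).2 hc.surjective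
    exact (Rep.epi_iff_surjective _).1
      (inferInstanceAs (Epi ((Rep.coindFunctor k S.subtype).map hc.equivariant_π.toHom)))
  · intro F
    constructor
    · intro h
      have h' : ∀ g, ∃ y, i y = F.1 g := fun g =>
        (hc.exact _).1 (congrFun (congrArg Subtype.val h) g)
      choose y hy using h'
      refine ⟨⟨y, fun s g => hc.injective ?_⟩, Subtype.ext (funext hy)⟩
      rw [hy, hc.equivariant_i, hy]
      exact F.2 s g
    · rintro ⟨F', rfl⟩
      exact Subtype.ext (funext fun g => hc.exact.apply_apply_eq_zero (F'.1 g))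
  · refine le_trans ?_ (mul_le_mul_right hc.finrank_le _)
    exact_mod_cast (finrank_coind_le S P).2

/-- The contribution of a coset to the transfer map `coind (res X) → X`. -/
def transferTerm (S : Subgroup G) (X : Rep.{0} k G)
    (F : Rep.coind S.subtype (Rep.res S.subtype X)) (q : G ⧸ S) : X :=
  Quotient.liftOn' q (fun g => X.ρ g (F.1 g⁻¹)) fun a b hab => by
    obtain ⟨s, rfl⟩ : ∃ s : S, b = a * s :=
      ⟨⟨a⁻¹ * b, QuotientGroup.leftRel_apply.1 hab⟩, by simp⟩
    have h := F.2 s⁻¹ a⁻¹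
    have h' : F.1 (a * (s : G))⁻¹ = X.ρ (s : G)⁻¹ (F.1 a⁻¹) := by
      rw [mul_inv_rev]
      exact h
    change _ = X.ρ (a * s) (F.1 (a * (s : G))⁻¹)
    rw [h', ← Module.End.mul_apply, ← map_mul]
    simp

theorem DimRes.of_res {S : Subgroup G} {X : Rep.{0} k G} {r : ℕ → NNReal}
    (hX : DimRes (Rep.res S.subtype X) r) (hS : (S.index : k) ≠ 0) :
    DimRes X (fun n => Nat.card G * r n) := by
  have := Fintype.ofFinite (G ⧸ S)
  let s : X →ₗ[k] Rep.coind S.subtype (Rep.res S.subtype X) :=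
    { toFun := fun v => ⟨fun g => X.ρ g v, fun s g => by
        change X.ρ (s * g) v = X.ρ s (X.ρ g v)
        rw [map_mul]; rfl⟩
      map_add' := fun v w => Subtype.ext (funext fun g => map_add (X.ρ g) v w)
      map_smul' := fun c v => Subtype.ext (funext fun g => map_smul (X.ρ g) c v) }
  let t : Rep.coind S.subtype (Rep.res S.subtype X) →ₗ[k] X :=
    { toFun := fun F => (S.index : k)⁻¹ • ∑ q, transferTerm S X F q
      map_add' := fun F F' => by
        rw [← smul_add, ← Finset.sum_add_distrib]
        congr 1
        refine Finset.sum_congr rfl fun q _ => ?_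
        induction q using Quotient.inductionOn'
        exact map_add (X.ρ _) _ _
      map_smul' := fun c F => by
        rw [RingHom.id_apply, smul_comm c, Finset.smul_sum (r := c)]
        congr 1
        refine Finset.sum_congr rfl fun q _ => ?_
        induction q using Quotient.inductionOn'
        exact map_smul (X.ρ _) _ _ }
  refine hX.coind.of_retract (s := s) (t := t) ?_ ?_ ?_
  · intro g v
    refine Subtype.ext (funext fun h => ?_)
    change X.ρ h (X.ρ g v) = X.ρ (h * g) v
    rw [map_mul]; rfl
  · intro g F
    change (S.index : k)⁻¹ • ∑ q, transferTerm S X _ q =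
      X.ρ g ((S.index : k)⁻¹ • ∑ q, transferTerm S X F q)
    rw [map_smul, map_sum, ← Equiv.sum_comp (MulAction.toPerm g)]
    congr 1
    refine Finset.sum_congr rfl fun q _ => ?_
    induction q using Quotient.inductionOn' with
    | _ a =>
      change X.ρ (g * a) (F.1 ((g * a)⁻¹ * g)) = X.ρ g (X.ρ a (F.1 a⁻¹))
      rw [map_mul, mul_inv_rev, inv_mul_cancel_right]; rfl
  · intro v
    change (S.index : k)⁻¹ • ∑ q, transferTerm S X (s v) q = v
    have : ∀ q, transferTerm S X (s v) q = v := fun q => by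
      induction q using Quotient.inductionOn' with
      | _ a =>
        change X.ρ a (X.ρ a⁻¹ v) = v
        simp
    simp only [this, Finset.sum_const, Finset.card_univ, ← Nat.card_eq_fintype_card]
    change (S.index : k)⁻¹ • S.index • v = v
    rw [← Nat.cast_smul_eq_nsmul k, inv_smul_smul₀ hS]

end Coinduction

section Nakayama

variable {k : Type} [Field k] {G : Type} [Group G] [Finite G] {p : ℕ} [Fact p.Prime] [CharP k p]

theorem IsPGroup.eq_top_of_sup_coinvariantsKer (hG : IsPGroup p G) {V : Type} [AddCommGroup V]
    [Module k V] (ρ : Representation k G V) (U : Submodule k V)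
    (hU : ∀ g, ∀ v ∈ U, ρ g v ∈ U) (h : U ⊔ Representation.Coinvariants.ker ρ = ⊤) : U = ⊤ := by
  by_contra hne
  obtain ⟨l, hl0, hlU⟩ := Submodule.exists_le_ker_of_lt_top U (lt_top_iff_ne_top.2 hne)
  let s : Set (Module.Dual k V) := Set.range fun g => ρ.dual g l
  let A := AddSubgroup.closure s
  have htor : ∀ x : Module.Dual k V, p • x = 0 := fun x => by
    rw [← Nat.cast_smul_eq_nsmul k, CharP.cast_eq_zero, zero_smul]
  have hinv : ∀ g, ∀ x ∈ A, ρ.dual g x ∈ A := fun g x hx => by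
    induction hx using AddSubgroup.closure_induction with
    | mem x hx =>
      obtain ⟨g', rfl⟩ := hx
      refine AddSubgroup.subset_closure ⟨g * g', ?_⟩
      simp only [map_mul, Module.End.mul_apply]
    | zero => rw [map_zero]; exact A.zero_mem
    | add x y _ _ hx hy => rw [map_add]; exact A.add_mem hx hy
    | neg x _ hx => rw [map_neg]; exact A.neg_mem hx
  have hkill : ∀ x ∈ A, U ≤ LinearMap.ker x := fun x hx => by
    induction hx using AddSubgroup.closure_induction with
    | mem x hx =>
      obtain ⟨g', rfl⟩ := hx
      exact fun u hu => hlU (hU g'⁻¹ u hu)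
    | zero => exact fun u hu => rfl
    | add x y _ _ hx hy =>
      exact fun u hu => by
        have h1 : x u = 0 := hx hu
        have h2 : y u = 0 := hy hu
        simp [h1, h2]
    | neg x _ hx =>
      exact fun u hu => by
        have h1 : x u = 0 := hx hu
        simp [h1]
  have hfg : AddGroup.FG A := (AddGroup.fg_iff_addSubgroup_fg A).2
    ⟨(Set.finite_range fun g => ρ.dual g l).toFinset, by rw [Set.Finite.coe_toFinset]⟩
  have hfin : Finite A := AddCommGroup.finite_of_fg_isAddTorsion A fun x =>
    isOfFinAddOrder_iff_nsmul_eq_zero.2 ⟨p, (Fact.out : p.Prime).pos, Subtype.ext (htor x)⟩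
  have hlA : l ∈ A := AddSubgroup.subset_closure ⟨1, by simp only [map_one, Module.End.one_apply]⟩
  have hdvd : p ∣ Nat.card A := by
    have : addOrderOf (⟨l, hlA⟩ : A) = p :=
      addOrderOf_eq_prime (Subtype.ext (htor l)) fun h0 => hl0 (congrArg Subtype.val h0)
    rw [← this]
    exact addOrderOf_dvd_natCard _
  let _ : MulAction G A :=
    { smul := fun g x => ⟨ρ.dual g x, hinv g x x.2⟩
      one_smul := fun x => Subtype.ext (by
        change ρ.dual 1 x = x
        simp only [map_one, Module.End.one_apply])
      mul_smul := fun a b x => Subtype.ext (by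
        change ρ.dual (a * b) x = ρ.dual a (ρ.dual b x)
        simp only [map_mul, Module.End.mul_apply]) }
  obtain ⟨b, hb, hb0⟩ := hG.exists_fixed_point_of_prime_dvd_card_of_fixed_point A hdvd
    (a := 0) (fun g => Subtype.ext (map_zero (ρ.dual g)))
  have hfix : ∀ g v, b.1 (ρ g v) = b.1 v := fun g v => by
    have h1 : ρ.dual g⁻¹ b = b := congrArg Subtype.val (hb g⁻¹)
    have h2 := LinearMap.congr_fun h1 v
    rw [Representation.dual_apply, inv_inv] at h2
    exact h2
  refine hb0 (Subtype.ext (LinearMap.ker_eq_top.1 (top_le_iff.1 ?_)).symm)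
  rw [← h, sup_le_iff]
  refine ⟨hkill b b.2, Submodule.span_le.2 ?_⟩
  rintro _ ⟨⟨g, v⟩, rfl⟩
  change b.1 (ρ g v - v) = 0
  rw [map_sub, hfix, sub_self]

end Nakayama

section Free

variable {k : Type} [Field k] {G : Type} [Group G] [Finite G]

theorem projective_of_subsingleton {H : Type} [Group H] [Subsingleton H] (X : Rep.{0} k H) :
    Projective X := by
  refine ⟨fun {E Y} f e he => ?_⟩
  obtain ⟨s, hs⟩ := LinearMap.exists_rightInverse_of_surjective e.hom.toLinearMap
    (LinearMap.range_eq_top.2 ((Rep.epi_iff_surjective e).1 he))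
  have hg : Equivariant X E (s ∘ₗ f.hom.toLinearMap) := fun g v => by
    rw [Subsingleton.elim g 1, map_one, map_one]; rfl
  refine ⟨hg.toHom, ?_⟩
  ext x
  exact LinearMap.congr_fun hs (f.hom x)

/-- The free representation on a vector space. -/
abbrev freeRep (G : Type) [Group G] (k : Type) [Field k] (W : Type) [AddCommGroup W]
    [Module k W] : Rep.{0} k G :=
  Rep.coind (⊥ : Subgroup G).subtype (Rep.of (Representation.trivial k (⊥ : Subgroup G) W))

variable {W : Type} [AddCommGroup W] [Module k W]

theorem freeRep_projective : Projective (freeRep G k W) :=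
  projective_coind _ (projective_of_subsingleton _)

/-- The equivariant map out of the free representation extending a linear map. -/
def freeLift {X : Rep.{0} k G} (l : W →ₗ[k] X) : freeRep G k W →ₗ[k] X :=
  let _ := Fintype.ofFinite G
  { toFun := fun F => ∑ g, X.ρ g (l (F.1 g⁻¹))
    map_add' := fun F F' => by
      rw [← Finset.sum_add_distrib]
      refine Finset.sum_congr rfl fun g _ => ?_
      rw [← map_add, ← map_add]
      rfl
    map_smul' := fun c F => by
      rw [RingHom.id_apply, Finset.smul_sum]
      refine Finset.sum_congr rfl fun g _ => ?_
      rw [← map_smul, ← map_smul]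
      rfl }

theorem freeLift_equivariant {X : Rep.{0} k G} (l : W →ₗ[k] X) :
    Equivariant (freeRep G k W) X (freeLift l) := by
  intro g F
  let _ := Fintype.ofFinite G
  change ∑ h, X.ρ h (l (F.1 (h⁻¹ * g))) = X.ρ g (∑ h, X.ρ h (l (F.1 h⁻¹)))
  rw [map_sum, ← Equiv.sum_comp (Equiv.mulLeft g)]
  refine Finset.sum_congr rfl fun h _ => ?_
  simp only [Equiv.coe_mulLeft, map_mul, mul_inv_rev, inv_mul_cancel_right]
  rfl

theorem range_le_range_freeLift {X : Rep.{0} k G} (l : W →ₗ[k] X) :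
    LinearMap.range l ≤ LinearMap.range (freeLift l) := by
  classical
  rintro _ ⟨w, rfl⟩
  let _ := Fintype.ofFinite G
  refine ⟨⟨Pi.single 1 w, fun s g => ?_⟩, ?_⟩
  · obtain rfl := Subsingleton.elim s 1
    exact congrArg (Pi.single (M := fun _ : G => W) 1 w) (one_mul g)
  · change ∑ g, X.ρ g (l (Pi.single (M := fun _ => W) 1 w g⁻¹)) = l w
    rw [Finset.sum_eq_single 1]
    · simp
    · intro g _ hg
      rw [Pi.single_eq_of_ne (inv_ne_one.2 hg), map_zero, map_zero]
    · simp

theorem betti_freeRep_succ (n : ℕ) : betti (freeRep G k W).ρ (n + 1) = 0 := by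
  rw [betti_coind, betti_succ_of_subsingleton]

omit [Finite G] in
theorem betti_zero_le_finrank [FiniteDimensional k W] (ρ : Representation k G W) :
    betti ρ 0 ≤ Module.finrank k W := by
  rw [betti_zero]
  exact Submodule.finrank_quotient_le _

theorem betti_freeRep_zero_le [FiniteDimensional k W] :
    betti (freeRep G k W).ρ 0 ≤ Module.finrank k W := by
  rw [betti_coind]
  exact betti_zero_le_finrank _

theorem betti_succ_of_projective {P : Rep.{0} k G} [FiniteDimensional k P]
    (hP : Projective P) (n : ℕ) : betti P.ρ (n + 1) = 0 := by
  have hsurj : Function.Surjective (freeLift (X := P) LinearMap.id) := fun x =>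
    range_le_range_freeLift LinearMap.id ⟨x, rfl⟩
  obtain ⟨s, hs, hse⟩ := exists_lift_of_projective hP (freeLift_equivariant _) hsurj
    (f := LinearMap.id) (fun _ _ => rfl)
  have := Module.Finite.of_injective s (Function.LeftInverse.injective hse)
  have hfin := (finrank_coind_le (⊥ : Subgroup G)
    (Rep.of (Representation.trivial k (⊥ : Subgroup G) P))).1
  refine Nat.le_zero.1 ((betti_le_of_retract (MonoidHom.id G) s hs (MonoidHom.id G) _
    (freeLift_equivariant (X := P) LinearMap.id) rfl (LinearMap.ext hse) (n + 1)).trans ?_)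
  exact (betti_freeRep_succ n).le

theorem DimRes.betti_le {X : Rep.{0} k G} {r : ℕ → NNReal} (hX : DimRes X r) (n : ℕ) :
    (betti X.ρ n : NNReal) ≤ r n := by
  obtain ⟨Good, h0, hG⟩ := hX
  suffices h : ∀ n m N, Good m N → (betti N.ρ n : NNReal) ≤ r (m + n) by
    simpa using h n 0 X h0
  intro n
  induction n with
  | zero =>
    intro m N hN
    obtain ⟨K, P, i, π, hc, hK⟩ := hG m N hN
    have := hc.finite
    have : FiniteDimensional k N := FiniteDimensional.of_surjective π hc.surjective
    refine le_trans ?_ hc.finrank_le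
    exact_mod_cast (betti_zero_le_of_surjective π hc.equivariant_π hc.surjective).trans
      (betti_zero_le_finrank P.ρ)
  | succ n ih =>
    intro m N hN
    obtain ⟨K, P, i, π, hc, hK⟩ := hG m N hN
    have := hc.finite
    have : FiniteDimensional k N := FiniteDimensional.of_surjective π hc.surjective
    have : FiniteDimensional k K := FiniteDimensional.of_injective i hc.injective
    have h1 := betti_succ_right_le i π hc.equivariant_i hc.equivariant_π hc.injective
      hc.surjective hc.exact n
    rw [betti_succ_of_projective hc.projective, zero_add] at h1
    have h2 := ih (m + 1) K hK
    rw [show m + 1 + n = m + (n + 1) by omega] at h2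
    exact le_trans (by exact_mod_cast h1) h2

variable {p : ℕ} [Fact p.Prime] [CharP k p]

omit [Finite G] in
theorem Equivariant.ker_invariant {X Y : Rep.{0} k G} {l : X →ₗ[k] Y} (h : Equivariant X Y l)
    (g : G) : ∀ v ∈ LinearMap.ker l, X.ρ g v ∈ LinearMap.ker l := fun v hv => by
  rw [LinearMap.mem_ker] at hv ⊢
  rw [h, hv, map_zero]

/-- The kernel of an equivariant map, as a representation. -/
def Equivariant.kernel {X Y : Rep.{0} k G} {l : X →ₗ[k] Y} (h : Equivariant X Y l) :
    Rep.{0} k G :=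
  Rep.of (subRep X.ρ (LinearMap.ker l) h.ker_invariant)

theorem IsPGroup.dimRes (hG : IsPGroup p G) {X : Rep.{0} k G} [FiniteDimensional k X]
    {c : ℕ → NNReal} (hc : ∀ n, (betti X.ρ n : NNReal) ≤ c n) :
    DimRes X (fun n => Nat.card G * c n) := by
  refine ⟨fun n N => FiniteDimensional k N ∧ ∀ m, (betti N.ρ m : NNReal) ≤ c (n + m),
    ⟨inferInstance, fun m => by simpa using hc m⟩, ?_⟩
  rintro n N ⟨hN, hb⟩
  let I := Representation.Coinvariants.ker N.ρ
  obtain ⟨s, hs⟩ := LinearMap.exists_rightInverse_of_surjective I.mkQ I.range_mkQ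
  let π := freeLift (X := N) s
  have hπ : Equivariant (freeRep G k (N ⧸ I)) N π := freeLift_equivariant s
  have hfin := finrank_coind_le (⊥ : Subgroup G)
    (Rep.of (Representation.trivial k (⊥ : Subgroup G) (N ⧸ I)))
  have hfin1 : FiniteDimensional k (freeRep G k (N ⧸ I)) := hfin.1
  have hsurj : Function.Surjective π := by
    refine LinearMap.range_eq_top.1 (hG.eq_top_of_sup_coinvariantsKer N.ρ _
      hπ.range_invariant (top_le_iff.1 fun v _ => ?_))
    rw [← add_sub_cancel (s (I.mkQ v)) v]
    refine Submodule.add_mem_sup (range_le_range_freeLift s ⟨_, rfl⟩) ?_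
    rw [← Submodule.Quotient.mk_eq_zero, Submodule.Quotient.mk_sub, sub_eq_zero]
    exact (LinearMap.congr_fun hs (I.mkQ v)).symm
  have hfr : Module.finrank k (N ⧸ I) = betti N.ρ 0 := (betti_zero N.ρ).symm
  have hH0 : Function.Injective (hlgyMap (MonoidHom.id G) π hπ 0) := by
    have hs0 := hlgyMap_zero_surjective π hπ hsurj
    refine (LinearMap.injective_iff_surjective_of_finrank_eq_finrank ?_).2 hs0
    refine le_antisymm ?_ (betti_zero_le_of_surjective π hπ hsurj)
    exact betti_freeRep_zero_le.trans hfr.le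
  let K : Rep.{0} k G := hπ.kernel
  have hKfin : FiniteDimensional k K := inferInstanceAs (FiniteDimensional k (LinearMap.ker π))
  let i : K →ₗ[k] freeRep G k (N ⧸ I) := (LinearMap.ker π).subtype
  have hi : Equivariant K (freeRep G k (N ⧸ I)) i := fun g v => rfl
  have hinj : Function.Injective i := Subtype.val_injective
  have hex : Function.Exact i π := fun v => ⟨fun hv => ⟨⟨v, hv⟩, rfl⟩, by
    rintro ⟨w, rfl⟩
    exact w.2⟩
  refine ⟨K, freeRep G k (N ⧸ I), i, π, ⟨hi, hπ, hinj, hsurj, hex, freeRep_projective, hfin1,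
    ?_⟩, hKfin, fun m => ?_⟩
  · have h1 := hb 0
    refine le_trans ?_ (mul_le_mul_right h1 _)
    have h2 := hfin.2
    rw [show Module.finrank k (Rep.of (Representation.trivial k (⊥ : Subgroup G) (N ⧸ I))) =
      betti N.ρ 0 from hfr] at h2
    exact_mod_cast h2
  · have h1 : betti K.ρ m ≤ betti N.ρ (m + 1) := by
      cases m with
      | zero =>
        exact betti_left_le_of_eq_zero i π hi hπ hinj hsurj hex 0
          (hlgyMap_zero_eq_zero i π hi hπ hinj hsurj hex hH0)
      | succ m =>
        have h2 := betti_left_le i π hi hπ hinj hsurj hex (m + 1)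
        rwa [betti_freeRep_succ, add_zero] at h2
    have h2 := hb (m + 1)
    rw [show n + (m + 1) = n + 1 + m by omega] at h2
    exact le_trans (by exact_mod_cast h1) h2

end Free

section ProjectiveResolution

universe u v

variable {A : Type u} [Category.{v} A] [Abelian A]

/-- A projective resolution built from its terms and differentials. -/
theorem exists_projectiveResolution {Z : A} (P : ℕ → A) (hP : ∀ n, Projective (P n))
    (d : ∀ n, P (n + 1) ⟶ P n) (ε : P 0 ⟶ Z) (hε : Epi ε) (w : ∀ n, d (n + 1) ≫ d n = 0)
    (w₀ : d 0 ≫ ε = 0) (hd : ∀ n, (ShortComplex.mk (d (n + 1)) (d n) (w n)).Exact)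
    (hd₀ : (ShortComplex.mk (d 0) ε w₀).Exact) :
    ∃ Q : ProjectiveResolution Z, ∀ n, Q.complex.X n = P n := by
  let C : ChainComplex A ℕ := ChainComplex.of P d w
  have hC : ∀ n, C.d (n + 1) n = d n := fun n => ChainComplex.of_d _ _ _
  have hε' := ChainComplex.toSingle₀Equiv_symm_apply_f_zero (C := C) (X := Z) ε
    (by rw [hC]; exact w₀)
  refine ⟨{ complex := C
            projective := hP
            π := (ChainComplex.toSingle₀Equiv C Z).symm ⟨ε, by rw [hC]; exact w₀⟩
            quasiIso := ⟨fun n => ?_⟩ }, fun n => rfl⟩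
  cases n with
  | zero =>
    rw [ChainComplex.quasiIsoAt₀_iff, ShortComplex.quasiIso_iff_of_zeros']
    · refine (ShortComplex.exact_and_epi_g_iff_of_iso ?_).2 ⟨hd₀, hε⟩
      exact ShortComplex.isoMk (Iso.refl _) (Iso.refl _) (Iso.refl _)
        ((Category.id_comp _).trans ((hC 0).symm.trans (Category.comp_id _).symm))
        ((Category.id_comp _).trans (hε'.symm.trans (Category.comp_id _).symm))
    all_goals rfl
  | succ n =>
    rw [quasiIsoAt_iff_exactAt' _ _ (ChainComplex.exactAt_succ_single_obj _ _),
      HomologicalComplex.exactAt_iff' _ (n + 1 + 1) (n + 1) n (by simp) (by simp)]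
    refine (ShortComplex.exact_iff_of_iso ?_).2 (hd n)
    exact ShortComplex.isoMk (Iso.refl _) (Iso.refl _) (Iso.refl _)
        ((Category.id_comp _).trans ((hC (n + 1)).symm.trans (Category.comp_id _).symm))
        ((Category.id_comp _).trans ((hC n).symm.trans (Category.comp_id _).symm))

end ProjectiveResolution

section ModuleConversion

variable {k : Type} [Field k] {G : Type} [Group G] [Finite G]

theorem RankLE.finrank_le {V : Type} [AddCommGroup V] [Module k V] [Module (MonoidAlgebra k G) V]
    [IsScalarTower k (MonoidAlgebra k G) V] {b : NNReal} (h : RankLE (MonoidAlgebra k G) V b) :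
    FiniteDimensional k V ∧ (Module.finrank k V : NNReal) ≤ Nat.card G * b := by
  classical
  obtain ⟨s, hs, hsb⟩ := h
  let _ := Fintype.ofFinite G
  let t : Finset (MonoidAlgebra k G) := Finset.univ.image (MonoidAlgebra.of k G)
  have ht : Submodule.span k (t : Set (MonoidAlgebra k G)) = ⊤ := by
    rw [Finset.coe_image, Finset.coe_univ, Set.image_univ]
    refine top_le_iff.1 fun x _ => ?_
    induction x using MonoidAlgebra.induction_on with
    | of g => exact Submodule.subset_span ⟨g, rfl⟩
    | add x y hx hy => exact Submodule.add_mem _ (hx trivial) (hy trivial)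
    | smul r x hx => exact Submodule.smul_mem _ r (hx trivial)
  have hspan : Submodule.span k ((Finset.image₂ (· • ·) t s : Finset V) : Set V) = ⊤ := by
    rw [Finset.coe_image₂, Set.image2_smul, Submodule.span_smul_of_span_eq_top ht, hs,
      Submodule.restrictScalars_top]
  refine ⟨⟨⟨_, hspan⟩⟩, ?_⟩
  have h1 : Module.finrank k V ≤ Nat.card G * s.card := by
    rw [← finrank_top, ← hspan]
    refine (finrank_span_finset_le_card _).trans ((Finset.card_image₂_le _ _ _).trans ?_)
    refine Nat.mul_le_mul_right _ (Finset.card_image_le.trans ?_)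
    rw [Finset.card_univ, Nat.card_eq_fintype_card]
  calc (Module.finrank k V : NNReal) ≤ (Nat.card G * s.card : ℕ) := by exact_mod_cast h1
    _ ≤ Nat.card G * b := by
      push_cast
      exact mul_le_mul_right hsb _

omit [Finite G] in
theorem rankLE_of_finrank_le {V : Type} [AddCommGroup V] [Module k V]
    [Module (MonoidAlgebra k G) V] [IsScalarTower k (MonoidAlgebra k G) V] [FiniteDimensional k V]
    {b : NNReal} (h : (Module.finrank k V : NNReal) ≤ b) : RankLE (MonoidAlgebra k G) V b := by
  classical
  refine ⟨Finset.univ.image (Module.finBasis k V), ?_, ?_⟩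
  · rw [Finset.coe_image, Finset.coe_univ, Set.image_univ]
    exact Submodule.span_eq_top_of_span_eq_top k _ _ (Module.finBasis k V).span_eq
  · refine le_trans ?_ h
    exact_mod_cast Finset.card_image_le.trans (by simp)

/-- The representation underlying a `k[G]`-module. -/
abbrev toRep (V : ModuleCat.{0} (MonoidAlgebra k G)) : Rep.{0} k G :=
  Rep.ofModuleMonoidAlgebra.obj V

theorem finrank_toRep_le {V : ModuleCat.{0} (MonoidAlgebra k G)} {b : NNReal}
    (h : RankLE (MonoidAlgebra k G) V b) :
    FiniteDimensional k (toRep V) ∧ (Module.finrank k (toRep V) : NNReal) ≤ Nat.card G * b :=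
  let _ : Module (MonoidAlgebra k G) (toRep V) := V.isModule
  have : IsScalarTower k (MonoidAlgebra k G) (toRep V) :=
    IsScalarTower.of_algebraMap_smul fun _ _ => rfl
  RankLE.finrank_le h

theorem finite_toRep (V : ModuleCat.{0} (MonoidAlgebra k G))
    [h : Module.Finite (MonoidAlgebra k G) V] : FiniteDimensional k (toRep V) := by
  obtain ⟨s, hs⟩ := h
  exact (finrank_toRep_le (b := s.card) ⟨s, hs, le_rfl⟩).1

omit [Finite G] in
theorem rankLE_toModule {X : Rep.{0} k G} [FiniteDimensional k X] {b : NNReal}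
    (h : (Module.finrank k X : NNReal) ≤ b) :
    RankLE (MonoidAlgebra k G) (Rep.toModuleMonoidAlgebra.obj X) b :=
  let _ : Module (MonoidAlgebra k G) X := (Rep.toModuleMonoidAlgebra.obj X).isModule
  have : IsScalarTower k (MonoidAlgebra k G) X :=
    IsScalarTower.of_algebraMap_smul fun c x =>
      congrArg (fun t : Module.End k X => t x) (X.ρ.asAlgebraHom.commutes c)
  rankLE_of_finrank_le (V := X) h

/-- The linear map underlying a morphism of `k[G]`-modules. -/
abbrev toRepMap {V W : ModuleCat.{0} (MonoidAlgebra k G)} (f : V ⟶ W) : toRep V →ₗ[k] toRep W :=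
  (Rep.ofModuleMonoidAlgebra.map f).hom.toLinearMap

theorem ComplexityLE.dimRes {M : ModuleCat.{0} (MonoidAlgebra k G)} {f : ℕ → NNReal}
    (h : ComplexityLE (MonoidAlgebra k G) M f) :
    ∃ d : NNReal, DimRes (toRep M) (fun n => d * f n) := by
  obtain ⟨P, d, hd⟩ := h
  let δ : ∀ n, toRep (P.complex.X (n + 1)) →ₗ[k] toRep (P.complex.X n) := fun n =>
    toRepMap (P.complex.d (n + 1) n)
  have hδ : ∀ n, Equivariant _ _ (δ n) := fun n => equivariant_hom _
  have hex : ∀ n, Function.Exact (δ (n + 1)) (δ n) := fun n =>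
    (ShortComplex.ShortExact.moduleCat_exact_iff_function_exact _).1 (P.exact_succ n)
  refine ⟨Nat.card G * d, fun n N => ∃ a : toRep (P.complex.X n) →ₗ[k] N,
    Equivariant _ _ a ∧ Function.Surjective a ∧ Function.Exact (δ n) a, ?_, ?_⟩
  · refine ⟨toRepMap (P.π.f 0), equivariant_hom _, ?_, ?_⟩
    · exact (ModuleCat.epi_iff_surjective (P.π.f 0)).1 inferInstance
    · exact (ShortComplex.ShortExact.moduleCat_exact_iff_function_exact _).1 P.exact₀
  · rintro n N ⟨a, ha, has, hae⟩
    have hfin := finrank_toRep_le (hd n)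
    refine ⟨ha.kernel, toRep (P.complex.X n), (LinearMap.ker a).subtype, a,
      ⟨fun g v => rfl, ha, Subtype.val_injective, has, ?_, ?_, hfin.1, ?_⟩,
      (δ n).codRestrict (LinearMap.ker a) fun x => hae.apply_apply_eq_zero x, ?_, ?_, ?_⟩
    · exact LinearMap.exact_subtype_ker_map a
    · have := P.projective n
      exact Rep.ofModuleMonoidAlgebra.projective_obj _
    · exact hfin.2.trans (mul_assoc _ _ _).ge
    · exact fun g v => Subtype.ext (hδ n g v)
    · rintro ⟨x, hx⟩
      obtain ⟨y, rfl⟩ := (hae x).1 hx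
      exact ⟨y, rfl⟩
    · intro x
      refine Iff.trans ?_ (hex n x)
      exact Subtype.ext_iff

end ModuleConversion

section ModuleConversion

variable {k : Type} [Field k] {G : Type} [Group G]

theorem DimRes.complexityLE {M : ModuleCat.{0} (MonoidAlgebra k G)} {f : ℕ → NNReal} {d : NNReal}
    (h : DimRes (toRep M) (fun n => d * f n)) : ComplexityLE (MonoidAlgebra k G) M f := by
  obtain ⟨Good, h0, hG⟩ := h
  choose K P i π hc hK using hG
  let S : ∀ n, { N : Rep.{0} k G // Good n N } := fun n =>
    Nat.rec ⟨toRep M, h0⟩ (fun n N => ⟨K n N.1 N.2, hK n N.1 N.2⟩) n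
  let F := Rep.toModuleMonoidAlgebra (k := k) (G := G)
  let Q : ∀ n, Rep.{0} k G := fun n => P n (S n).1 (S n).2
  have hcS : ∀ n, IsCover (S (n + 1)).1 (Q n) (S n).1 _ _ (d * f n) := fun n =>
    hc n (S n).1 (S n).2
  let δ : ∀ n, F.obj (Q (n + 1)) ⟶ F.obj (Q n) := fun n =>
    F.map ((hcS (n + 1)).equivariant_π.toHom ≫ (hcS n).equivariant_i.toHom)
  let ε : F.obj (Q 0) ⟶ M := F.map (hcS 0).equivariant_π.toHom ≫ (Rep.counitIso M).hom
  have hex₀ := (Function.Surjective.comp_exact_iff_exact (hcS 1).surjective).2 (hcS 0).exact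
  have hδ₀ : Function.Exact (δ 0).hom ε.hom := hex₀
  have hδ : ∀ n, Function.Exact (δ (n + 1)).hom (δ n).hom := fun n => by
    have hex := (Function.Injective.comp_exact_iff_exact (hcS n).injective).2
      ((Function.Surjective.comp_exact_iff_exact (hcS (n + 2)).surjective).2 (hcS (n + 1)).exact)
    exact hex
  have hε : Epi ε := (ModuleCat.epi_iff_surjective ε).2 (hcS 0).surjective
  have w₀ : δ 0 ≫ ε = 0 := by
    ext x
    exact hδ₀.apply_apply_eq_zero x
  have w : ∀ n, δ (n + 1) ≫ δ n = 0 := fun n => by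
    ext x
    exact (hδ n).apply_apply_eq_zero x
  have hQ : ∀ n, Projective (F.obj (Q n)) := fun n =>
    have := (hcS n).projective
    Rep.toModuleMonoidAlgebra.projective_obj _
  obtain ⟨R, hR⟩ := exists_projectiveResolution (fun n => F.obj (Q n)) hQ δ ε hε w w₀
    (fun n => (ShortComplex.ShortExact.moduleCat_exact_iff_function_exact _).2 (hδ n))
    ((ShortComplex.ShortExact.moduleCat_exact_iff_function_exact _).2 hδ₀)
  refine ⟨R, d, fun n => ?_⟩
  rw [hR n]
  have := (hcS n).finite
  exact rankLE_toModule (hcS n).finrank_le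

end ModuleConversion

section Restriction

variable {k : Type} [Field k] {G : Type} [Group G]

/-- Restriction of modules and restriction of representations agree. -/
def resModEquiv (S : Subgroup G) (M : ModuleCat.{0} (MonoidAlgebra k G)) :
    toRep (resMod k S M) ≃ₗ[k] Rep.res S.subtype (toRep M) where
  toFun x := x
  invFun x := x
  map_add' _ _ := rfl
  map_smul' c x := by
    change subgroupRingHom k S (algebraMap k _ c) • (show M from x) =
      (algebraMap k (MonoidAlgebra k G) c) • (show M from x)
    congr 1
    simp [subgroupRingHom]
  left_inv _ := rfl
  right_inv _ := rfl

theorem resModEquiv_equivariant (S : Subgroup G) (M : ModuleCat.{0} (MonoidAlgebra k G)) :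
    Equivariant _ _ (resModEquiv S M).toLinearMap := fun g x => by
  change subgroupRingHom k S (MonoidAlgebra.of k S g) • (show M from x) =
    MonoidAlgebra.of k G g • (show M from x)
  congr 1
  simp [subgroupRingHom]

theorem resModEquiv_symm_equivariant (S : Subgroup G) (M : ModuleCat.{0} (MonoidAlgebra k G)) :
    Equivariant _ _ (resModEquiv S M).symm.toLinearMap :=
  (resModEquiv_equivariant S M).of_comp_injective (resModEquiv S M).injective fun _ _ => rfl

theorem complexityLE_resMod_iff [Finite G] (S : Subgroup G)
    (M : ModuleCat.{0} (MonoidAlgebra k G)) (f : ℕ → NNReal) :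
    ComplexityLE (MonoidAlgebra k S) (resMod k S M) f ↔
      ∃ d : NNReal, DimRes (Rep.res S.subtype (toRep M)) (fun n => d * f n) := by
  constructor
  · intro h
    obtain ⟨d, hd⟩ := h.dimRes
    exact ⟨d, hd.of_retract (resModEquiv_symm_equivariant S M) (resModEquiv_equivariant S M)
      fun _ => rfl⟩
  · rintro ⟨d, hd⟩
    exact DimRes.complexityLE (hd.of_retract (resModEquiv_equivariant S M)
      (resModEquiv_symm_equivariant S M) fun _ => rfl)

end Restriction

/-- **Alperin–Evens theorem** (growth-rate formulation): over a field `k` of characteristic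
`p > 0` and a finite group `G`, a finitely generated `kG`-module `M` has complexity `≤ f`
if and only if it has complexity `≤ f` over every elementary abelian `p`-subgroup of `G`. -/
theorem alperin_evens_complexity
    (p : ℕ) (hp : p.Prime) (k : Type) [Field k] [CharP k p]
    (G : Type) [Group G] [Finite G]
    (M : ModuleCat.{0} (MonoidAlgebra k G)) (hM : Module.Finite (MonoidAlgebra k G) M)
    (f : ℕ → NNReal) (hf : IsProperComplexityFunction f) :
    ComplexityLE (MonoidAlgebra k G) M f ↔
      ∀ E : Subgroup G, IsPElementaryAbelian p E →
        ComplexityLE (MonoidAlgebra k E) (resMod k E M) f := by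
  refine ⟨fun h E _ => ?_, fun h => ?_⟩
  · obtain ⟨d, hd⟩ := h.dimRes
    exact (complexityLE_resMod_iff E M f).2 ⟨d, hd.res E⟩
  have := Fact.mk hp
  have := finite_toRep M
  let S : Sylow p G := default
  let X : Rep.{0} k S.1 := Rep.res S.1.subtype (toRep M)
  have hX : FiniteDimensional k X := this
  obtain ⟨d, hd⟩ := exists_betti_le_of_elementary hf S.isPGroup' X.ρ
    (fun E _ _ φ hφ hE => by
      let ψ : E →* G := S.1.subtype.comp φ
      have hψ : Function.Injective ψ := Subtype.val_injective.comp hφ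
      let e : E ≃* ψ.range := MonoidHom.ofInjective hψ
      obtain ⟨r, ⟨a⟩⟩ := hE
      obtain ⟨d, hd⟩ := (complexityLE_resMod_iff ψ.range M f).1
        (h ψ.range ⟨r, ⟨e.symm.trans a⟩⟩)
      refine ⟨d, fun n => le_trans (le_of_eq ?_) (hd.betti_le n)⟩
      have hY : FiniteDimensional k (Rep.res ψ.range.subtype (toRep M)) := this
      exact congrArg Nat.cast (betti_congr e (LinearEquiv.refl k (toRep M)) (fun _ _ => rfl) n))
  have hindex : (S.1.index : k) ≠ 0 := fun h0 =>
    S.not_dvd_index ((CharP.cast_eq_zero_iff k p _).1 h0)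
  have hres := (S.isPGroup'.dimRes hd).of_res hindex
  refine DimRes.complexityLE (d := Nat.card G * (Nat.card S.1 * d)) (hres.mono fun n => ?_)
  rw [mul_assoc, mul_assoc]
end
end

section
/- Let k be a ring, G a group, H a subgroup of G, M a kH-module, and f a proper complexity function. If c_{kH}(M) ≤ f, then c_{kG}(Ind_H^G(M)) ≤ f, where Ind_H^G(M) = kG ⊗_{kH} M. The same holds with c replaced by cds throughout. -/
open CategoryTheory

noncomputable section

namespace InducedComplexity

open ModuleCat

variable {R S : Type} [Ring R] [Ring S] {φ : R →+* S}
  {Ind : ModuleCat.{0} R ⥤ ModuleCat.{0} S}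

section Unit

variable (adj : Ind ⊣ restrictScalars φ)

/-- The unit of an induction–restriction adjunction, as an additive map. -/
def unitHom (A : ModuleCat.{0} R) : A →+ Ind.obj A where
  toFun a := (adj.unit.app A).hom a
  map_zero' := (adj.unit.app A).hom.map_zero
  map_add' := (adj.unit.app A).hom.map_add

lemma unitHom_smul (A : ModuleCat.{0} R) (r : R) (a : A) :
    unitHom adj A (r • a) = φ r • unitHom adj A a :=
  (adj.unit.app A).hom.map_smul r a

lemma map_unitHom {A B : ModuleCat.{0} R} (g : A ⟶ B) (a : A) :
    (Ind.map g).hom (unitHom adj A a) = unitHom adj B (g.hom a) :=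
  (congrArg (fun h => h.hom a) (adj.unit.naturality g)).symm

/-- Morphisms out of an induced module are determined by their values on the image of the unit. -/
lemma hom_ext_of_unitHom {A : ModuleCat.{0} R} {B : ModuleCat.{0} S} {g h : Ind.obj A ⟶ B}
    (H : ∀ a, g.hom (unitHom adj A a) = h.hom (unitHom adj A a)) : g = h := by
  apply (adj.homEquiv A B).injective
  rw [adj.homEquiv_unit, adj.homEquiv_unit]
  ext a
  exact H a

lemma homEquiv_symm_unitHom {A : ModuleCat.{0} R} {B : ModuleCat.{0} S}
    (g : A ⟶ (restrictScalars φ).obj B) (a : A) :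
    (((adj.homEquiv A B).symm g).hom (unitHom adj A a) : B) = g.hom a := by
  have h := (adj.homEquiv A B).apply_symm_apply g
  rw [adj.homEquiv_unit] at h
  exact congrArg (fun h => h.hom a) h

/-- The image of a generating set under the unit generates the induced module. -/
lemma span_unitHom_image {A : ModuleCat.{0} R} {s : Set A} (hs : Submodule.span R s = ⊤) :
    Submodule.span S (unitHom adj A '' s) = ⊤ := by
  set N := Submodule.span S (unitHom adj A '' s) with hN
  have key : ∀ a : A, unitHom adj A a ∈ N := by
    intro a
    have ha : a ∈ Submodule.span R s := hs ▸ Submodule.mem_top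
    induction ha using Submodule.span_induction with
    | mem x hx => exact Submodule.subset_span ⟨x, hx, rfl⟩
    | zero => rw [map_zero]; exact N.zero_mem
    | add x y _ _ hx hy => rw [map_add]; exact N.add_mem hx hy
    | smul r x _ hx => rw [unitHom_smul]; exact N.smul_mem _ hx
  have hq : ModuleCat.ofHom N.mkQ = 0 := hom_ext_of_unitHom adj fun a => by
    simpa using key a
  rw [← N.ker_mkQ, LinearMap.ker_eq_top]
  exact congrArg ModuleCat.Hom.hom hq

/-- A bimodule map `π : S → R` yields an `R`-linear map from `A` to its coinduced module,
sending `a` to `s ↦ π s • a`. -/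
def toCoextend (φ : R →+* S) (π : S →+ R) (hl : ∀ r s, π (φ r * s) = r * π s)
    (hr : ∀ s r, π (s * φ r) = π s * r) (A : ModuleCat.{0} R) :
    A ⟶ (restrictScalars φ).obj ((coextendScalars φ).obj A) :=
  ModuleCat.ofHom (Y := (restrictScalars φ).obj ((coextendScalars φ).obj A))
    { toFun := fun a => (CoextendScalars.equiv φ A).symm
        { toFun := fun s : S => π s • a
          map_add' := fun s t : S => by
            change π (s + t) • a = _
            rw [map_add, add_smul]
          map_smul' := fun r (s : S) => by
            change π (φ r * s) • a = r • (π s • a)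
            rw [hl, mul_smul] }
      map_add' := fun a b => (CoextendScalars.equiv φ A).injective <|
        LinearMap.ext fun s : S => smul_add (π s) a b
      map_smul' := fun r a => (CoextendScalars.equiv φ A).injective <|
        LinearMap.ext fun s : S => by
          change π s • (r • a) = π (s * φ r) • a
          rw [hr, mul_smul] }

/-- The map `(aᵢ) ↦ ∑ bᵢ • η aᵢ` into the induced module. -/
def sumHom {ι : Type} (b : ι → S) (A : ModuleCat.{0} R) : (ι →₀ A) →+ Ind.obj A :=
  Finsupp.liftAddHom fun i =>
    (DistribSMul.toAddMonoidHom (Ind.obj A) (b i)).comp (unitHom adj A)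

@[simp]
lemma sumHom_single {ι : Type} (b : ι → S) (A : ModuleCat.{0} R) (i : ι) (a : A) :
    sumHom adj b A (Finsupp.single i a) = b i • unitHom adj A a := by
  simp [sumHom]

/-- If `S` is additively generated by the `bᵢ φ(r)`, then every element of the induced module is a
sum of elements `bᵢ • η a`. -/
lemma sumHom_surjective {ι : Type} {b : ι → S}
    (hb : AddSubgroup.closure {s | ∃ i r, s = b i * φ r} = ⊤) (A : ModuleCat.{0} R) :
    Function.Surjective (sumHom adj b A) := by
  have key : ∀ (s : S) (a : A), s • unitHom adj A a ∈ (sumHom adj b A).range := by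
    intro s a
    have hs : s ∈ AddSubgroup.closure {s | ∃ i r, s = b i * φ r} := hb ▸ AddSubgroup.mem_top s
    induction hs using AddSubgroup.closure_induction with
    | mem x hx =>
      obtain ⟨i, r, rfl⟩ := hx
      exact ⟨Finsupp.single i (r • a), by rw [sumHom_single, unitHom_smul, mul_smul]⟩
    | zero => rw [zero_smul]; exact zero_mem _
    | add x y _ _ hx hy => rw [add_smul]; exact add_mem hx hy
    | neg x _ hx => rw [neg_smul]; exact neg_mem hx
  intro x
  have hx : x ∈ Submodule.span S (unitHom adj A '' Set.univ) := by
    rw [span_unitHom_image adj Submodule.span_univ]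
    exact Submodule.mem_top
  change x ∈ (sumHom adj b A).range
  induction hx using Submodule.closure_induction with
  | zero => exact zero_mem _
  | add x y _ _ hx hy => exact add_mem hx hy
  | smul_mem s x hx =>
    obtain ⟨a, -, rfl⟩ := hx
    exact key s a

lemma map_sumHom {ι : Type} (b : ι → S) {A B : ModuleCat.{0} R} (g : A ⟶ B) (c : ι →₀ A) :
    (Ind.map g).hom (sumHom adj b A c) =
      sumHom adj b B (Finsupp.mapRange.addMonoidHom g.hom.toAddMonoidHom c) := by
  induction c using Finsupp.induction_linear with
  | zero => simp
  | add c d hc hd => rw [map_add, map_add, hc, hd, map_add, map_add]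
  | single i a => simp [map_unitHom]

/-- Dual families with respect to a bimodule map make `sumHom` injective. -/
lemma sumHom_injective {ι : Type} {b b' : ι → S} (π : S →+ R)
    (hl : ∀ r s, π (φ r * s) = r * π s) (hr : ∀ s r, π (s * φ r) = π s * r)
    (hone : ∀ i, π (b' i * b i) = 1) (hzero : ∀ i j, i ≠ j → π (b' i * b j) = 0)
    (A : ModuleCat.{0} R) :
    Function.Injective (sumHom adj b A) := by
  let ψ : Ind.obj A ⟶ (coextendScalars φ).obj A :=
    (adj.homEquiv A _).symm (toCoextend φ π hl hr A)
  have hψ : ∀ (c : ι →₀ A) (i : ι),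
      (CoextendScalars.equiv φ A (ψ.hom (sumHom adj b A c))) (b' i) = c i := by
    intro c i
    induction c using Finsupp.induction_linear with
    | zero => rw [map_zero, map_zero, map_zero]; rfl
    | add c d hc hd =>
      rw [map_add, map_add, map_add]
      exact congrArg₂ (· + ·) hc hd
    | single j a =>
      rw [sumHom_single, map_smul, homEquiv_symm_unitHom]
      change π (b' i * b j) • a = _
      by_cases h : i = j
      · subst h; rw [hone, one_smul, Finsupp.single_eq_same]
      · rw [hzero i j h, zero_smul, Finsupp.single_eq_of_ne h]
  intro c d h
  ext i
  rw [← hψ c i, ← hψ d i, h]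

end Unit

/-- The image of a generating set under the unit bounds the rank of the induced module. -/
lemma rankLE_obj (adj : Ind ⊣ restrictScalars φ) {A : ModuleCat.{0} R} {c : NNReal}
    (h : RankLE R A c) : RankLE S (Ind.obj A) c := by
  obtain ⟨s, hs, hcard⟩ := h
  classical
  refine ⟨s.image (unitHom adj A), ?_, ?_⟩
  · rw [Finset.coe_image]
    exact span_unitHom_image adj hs
  · exact le_trans (by exact_mod_cast Finset.card_image_le) hcard

lemma preservesMonomorphisms (adj : Ind ⊣ restrictScalars φ) {ι : Type} {b b' : ι → S}
    (hb : AddSubgroup.closure {s | ∃ i r, s = b i * φ r} = ⊤) (π : S →+ R)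
    (hl : ∀ r s, π (φ r * s) = r * π s) (hr : ∀ s r, π (s * φ r) = π s * r)
    (hone : ∀ i, π (b' i * b i) = 1) (hzero : ∀ i j, i ≠ j → π (b' i * b j) = 0) :
    Ind.PreservesMonomorphisms where
  preserves {A B} g hg := by
    rw [ModuleCat.mono_iff_injective] at hg ⊢
    intro x y hxy
    obtain ⟨c, rfl⟩ := sumHom_surjective adj hb A x
    obtain ⟨d, rfl⟩ := sumHom_surjective adj hb A y
    have h := sumHom_injective adj π hl hr hone hzero B
      ((map_sumHom adj b g c).symm.trans (hxy.trans (map_sumHom adj b g d)))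
    congr 1
    exact Finsupp.mapRange_injective g.hom (map_zero _) hg h

section GroupRing

variable (k : Type) [Ring k] {G : Type} [Group G] (H : Subgroup G)

/-- Restriction of coefficients from `k[G]` to `k[H]`. -/
def groupRingRetraction : MonoidAlgebra k G →+ MonoidAlgebra k H :=
  MonoidAlgebra.comapDomainAddMonoidHom H.subtype H.subtype_injective

lemma groupRingRetraction_single_mem {g : G} (hg : g ∈ H) (r : k) :
    groupRingRetraction k H (MonoidAlgebra.single g r) = MonoidAlgebra.single ⟨g, hg⟩ r :=
  MonoidAlgebra.comapDomain_single_map H.subtype H.subtype_injective ⟨g, hg⟩ r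

lemma groupRingRetraction_single_notMem {g : G} (hg : g ∉ H) (r : k) :
    groupRingRetraction k H (MonoidAlgebra.single g r) = 0 :=
  MonoidAlgebra.comapDomain_single_of_not_mem_range (by simpa using hg) H.subtype_injective

lemma subgroupRingHom_single (h : H) (r : k) :
    subgroupRingHom k H (MonoidAlgebra.single h r) = MonoidAlgebra.single (h : G) r :=
  MonoidAlgebra.mapDomain_single

lemma groupRingRetraction_left (x : MonoidAlgebra k H) (y : MonoidAlgebra k G) :
    groupRingRetraction k H (subgroupRingHom k H x * y) = x * groupRingRetraction k H y := by
  induction x using MonoidAlgebra.induction_linear with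
  | zero => simp
  | add x x' hx hx' => simp only [map_add, add_mul, hx, hx']
  | single h r =>
    induction y using MonoidAlgebra.induction_linear with
    | zero => simp
    | add y y' hy hy' => simp only [map_add, mul_add, hy, hy']
    | single g r' =>
      rw [subgroupRingHom_single, MonoidAlgebra.single_mul_single]
      by_cases hg : g ∈ H
      · rw [groupRingRetraction_single_mem k H hg,
          groupRingRetraction_single_mem k H (H.mul_mem h.2 hg), MonoidAlgebra.single_mul_single]
        rfl
      · rw [groupRingRetraction_single_notMem k H hg, mul_zero,
          groupRingRetraction_single_notMem k H (by rwa [H.mul_mem_cancel_left h.2])]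

lemma groupRingRetraction_right (y : MonoidAlgebra k G) (x : MonoidAlgebra k H) :
    groupRingRetraction k H (y * subgroupRingHom k H x) = groupRingRetraction k H y * x := by
  induction x using MonoidAlgebra.induction_linear with
  | zero => simp
  | add x x' hx hx' => simp only [map_add, mul_add, hx, hx']
  | single h r =>
    induction y using MonoidAlgebra.induction_linear with
    | zero => simp
    | add y y' hy hy' => simp only [map_add, add_mul, hy, hy']
    | single g r' =>
      rw [subgroupRingHom_single, MonoidAlgebra.single_mul_single]
      by_cases hg : g ∈ H
      · rw [groupRingRetraction_single_mem k H hg,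
          groupRingRetraction_single_mem k H (H.mul_mem hg h.2), MonoidAlgebra.single_mul_single]
        rfl
      · rw [groupRingRetraction_single_notMem k H hg, zero_mul,
          groupRingRetraction_single_notMem k H (by rwa [H.mul_mem_cancel_right h.2])]

lemma closure_coset_representatives :
    AddSubgroup.closure {s : MonoidAlgebra k G | ∃ (q : G ⧸ H) (x : MonoidAlgebra k H),
      s = MonoidAlgebra.single q.out 1 * subgroupRingHom k H x} = ⊤ := by
  rw [eq_top_iff]
  rintro s -
  induction s using MonoidAlgebra.induction_linear with
  | zero => exact zero_mem _
  | add x y hx hy => exact add_mem hx hy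
  | single g r =>
    have hg : (g : G ⧸ H).out⁻¹ * g ∈ H :=
      QuotientGroup.eq.1 (QuotientGroup.out_eq' (g : G ⧸ H))
    refine AddSubgroup.subset_closure ⟨(g : G ⧸ H), MonoidAlgebra.single ⟨_, hg⟩ r, ?_⟩
    rw [subgroupRingHom_single, MonoidAlgebra.single_mul_single]
    simp

/-- Induction of modules from a subgroup preserves monomorphisms. -/
lemma preservesMonomorphisms_of_subgroup
    {Ind : ModuleCat.{0} (MonoidAlgebra k H) ⥤ ModuleCat.{0} (MonoidAlgebra k G)}
    (adj : Ind ⊣ restrictScalars (subgroupRingHom k H)) : Ind.PreservesMonomorphisms := by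
  refine preservesMonomorphisms adj
    (b := fun q : G ⧸ H => MonoidAlgebra.single q.out 1)
    (b' := fun q : G ⧸ H => MonoidAlgebra.single q.out⁻¹ 1)
    (closure_coset_representatives k H) (groupRingRetraction k H)
    (groupRingRetraction_left k H) (groupRingRetraction_right k H) ?_ ?_
  · intro q
    rw [MonoidAlgebra.single_mul_single, inv_mul_cancel, mul_one,
      groupRingRetraction_single_mem k H H.one_mem]
    rfl
  · intro p q hpq
    rw [MonoidAlgebra.single_mul_single]
    refine groupRingRetraction_single_notMem k H (fun h => hpq ?_) _
    rw [← QuotientGroup.out_eq' p, ← QuotientGroup.out_eq' q]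
    exact QuotientGroup.eq.2 h

end GroupRing

lemma complexityLE_of_iso {M N : ModuleCat.{0} R} (e : M ≅ N) {f : ℕ → NNReal}
    (h : ComplexityLE R M f) : ComplexityLE R N f := by
  obtain ⟨P, d, hP⟩ := h
  exact ⟨{ complex := P.complex
           π := P.π ≫ (ChainComplex.single₀ _).map e.hom }, d, hP⟩

lemma complexityLE_obj (adj : Ind ⊣ restrictScalars φ) [Ind.PreservesMonomorphisms]
    {M : ModuleCat.{0} R} {f : ℕ → NNReal}
    (h : ComplexityLE R M f) : ComplexityLE S (Ind.obj M) f := by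
  obtain ⟨P, d, hP⟩ := h
  have : Ind.Additive := adj.left_adjoint_additive
  have := adj.leftAdjoint_preservesColimits
  have : Ind.PreservesHomology := Ind.preservesHomology_of_preservesMonos_and_cokernels
  have : Ind.PreservesProjectiveObjects :=
    Functor.preservesProjectiveObjects_of_adjunction_of_preservesEpimorphisms adj
  exact ⟨Ind.mapProjectiveResolution P, d, fun n => rankLE_obj adj (hP n)⟩

lemma cdsLE_obj (adj : Ind ⊣ restrictScalars φ) [Ind.PreservesMonomorphisms]
    {M : ModuleCat.{0} R} {f : ℕ → NNReal}
    (h : CdsLE R M f) : CdsLE S (Ind.obj M) f := by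
  obtain ⟨N, hN⟩ := h
  have : Ind.Additive := adj.left_adjoint_additive
  have := adj.leftAdjoint_preservesColimits
  have := Limits.preservesBinaryBiproducts_of_preservesBinaryCoproducts Ind
  exact ⟨Ind.obj N, complexityLE_of_iso
    (Ind.mapIso (biprodIsoProd M N).symm ≪≫ Ind.mapBiprod M N ≪≫
      biprodIsoProd (Ind.obj M) (Ind.obj N)) (complexityLE_obj adj hN)⟩

end InducedComplexity

/-- If `c_{kH}(M) ≤ f` then `c_{kG}(Ind_H^G M) ≤ f`, and likewise for `cds`.  Here the
induction functor `Ind_H^G = kG ⊗_{kH} (-)` is characterized by its universal property: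
it is a left adjoint of the restriction functor from `kG`-modules to `kH`-modules. -/
theorem complexity_of_induced
    (k : Type) [Ring k] (G : Type) [Group G] (H : Subgroup G)
    (Ind : ModuleCat.{0} (MonoidAlgebra k H) ⥤ ModuleCat.{0} (MonoidAlgebra k G))
    (adj : Ind ⊣ ModuleCat.restrictScalars (subgroupRingHom k H))
    (M : ModuleCat.{0} (MonoidAlgebra k H))
    (f : ℕ → NNReal) (hf : IsProperComplexityFunction f) :
    (ComplexityLE (MonoidAlgebra k H) M f →
        ComplexityLE (MonoidAlgebra k G) (Ind.obj M) f) ∧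
    (CdsLE (MonoidAlgebra k H) M f →
        CdsLE (MonoidAlgebra k G) (Ind.obj M) f) := by
  have := InducedComplexity.preservesMonomorphisms_of_subgroup k H adj
  exact ⟨InducedComplexity.complexityLE_obj adj, InducedComplexity.cdsLE_obj adj⟩
end
end

section
/- Let k be a ring, G a group, H a normal subgroup of G of finite index, M a kG-module, and f a proper complexity function. Assume that cds_{kS}(M) ≤ f for every subgroup S with H ≤ S ≤ G such that S/H is a p-Sylow subgroup of G/H for some prime p. Then cds_{kG}(M) ≤ f. -/
open CategoryTheory

noncomputable section

open Limits

theorem RankLE.of_generating_maps {R : Type} [Ring R] {X Y Z : Type} [AddCommGroup X] [Module R X]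
    [AddCommGroup Y] [Module R Y] [AddCommGroup Z] [Module R Z] {b c : NNReal}
    (hX : RankLE R X b) (hY : RankLE R Y c) (u : X →ₗ[R] Z) (v : Y →ₗ[R] Z)
    (huv : LinearMap.range u ⊔ LinearMap.range v = ⊤) : RankLE R Z (b + c) := by
  classical
  obtain ⟨s, hs, hsb⟩ := hX
  obtain ⟨t, ht, htc⟩ := hY
  refine ⟨s.image u ∪ t.image v, ?_, ?_⟩
  · rw [Finset.coe_union, Finset.coe_image, Finset.coe_image, Submodule.span_union,
      Submodule.span_image, Submodule.span_image, hs, ht, Submodule.map_top, Submodule.map_top, huv]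
  · refine le_trans ?_ (add_le_add hsb htc)
    exact_mod_cast (Finset.card_union_le _ _).trans
      (add_le_add Finset.card_image_le Finset.card_image_le)

theorem quasiIso_biprod_map {C : Type*} [Category C] [Abelian C] {ι : Type*} {c : ComplexShape ι}
    {K K' L L' : HomologicalComplex C c} (a : K ⟶ L) (b : K' ⟶ L') [QuasiIso a] [QuasiIso b] :
    QuasiIso (biprod.map a b) := by
  rw [quasiIso_iff]
  intro n
  rw [quasiIsoAt_iff_isIso_homologyMap]
  let F := HomologicalComplex.homologyFunctor C c n
  have ha : IsIso (F.map a) := inferInstanceAs (IsIso (HomologicalComplex.homologyMap a n))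
  have hb : IsIso (F.map b) := inferInstanceAs (IsIso (HomologicalComplex.homologyMap b n))
  change IsIso (F.map (biprod.map a b))
  refine ⟨F.map biprod.fst ≫ inv (F.map a) ≫ F.map biprod.inl +
    F.map biprod.snd ≫ inv (F.map b) ≫ F.map biprod.inr, ?_, ?_⟩
  · rw [Preadditive.comp_add, ← F.map_comp_assoc, ← F.map_comp_assoc, biprod.map_fst,
      biprod.map_snd, F.map_comp_assoc, F.map_comp_assoc, IsIso.hom_inv_id_assoc,
      IsIso.hom_inv_id_assoc, ← F.map_comp, ← F.map_comp, ← F.map_add, biprod.total, F.map_id]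
  · rw [Preadditive.add_comp, Category.assoc, Category.assoc, Category.assoc, Category.assoc,
      ← F.map_comp, ← F.map_comp, biprod.inl_map, biprod.inr_map, F.map_comp, F.map_comp,
      IsIso.inv_hom_id_assoc, IsIso.inv_hom_id_assoc, ← F.map_comp, ← F.map_comp, ← F.map_add,
      biprod.total, F.map_id]

theorem ComplexityLE.of_iso {R : Type} [Ring R] {M N : ModuleCat.{0} R} {f : ℕ → NNReal}
    (h : ComplexityLE R M f) (e : M ≅ N) : ComplexityLE R N f := by
  obtain ⟨P, d, hd⟩ := h
  exact ⟨{ complex := P.complex, π := P.π ≫ (ChainComplex.single₀ _).map e.hom }, d, hd⟩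

theorem ComplexityLE.biprod {R : Type} [Ring R] {M N : ModuleCat.{0} R} {f : ℕ → NNReal}
    (hM : ComplexityLE R M f) (hN : ComplexityLE R N f) : ComplexityLE R (M ⊞ N) f := by
  obtain ⟨P, d, hd⟩ := hM
  obtain ⟨Q, d', hd'⟩ := hN
  have := quasiIso_biprod_map P.π Q.π
  have : (ChainComplex.single₀ (ModuleCat.{0} R)).Additive :=
    inferInstanceAs (HomologicalComplex.single _ _ _).Additive
  have := preservesBinaryBiproduct_of_preservesBiproduct (ChainComplex.single₀ (ModuleCat.{0} R)) M N
  refine ⟨{ complex := P.complex ⊞ Q.complex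
            projective n := Projective.of_iso (HomologicalComplex.biprodXIso _ _ n).symm
              inferInstance
            π := biprod.map P.π Q.π ≫ ((ChainComplex.single₀ _).mapBiprod M N).inv }, d + d', ?_⟩
  intro n
  rw [add_mul]
  refine (hd n).of_generating_maps (hd' n) ((biprod.inl : P.complex ⟶ _ ⊞ Q.complex).f n).hom
    ((biprod.inr : Q.complex ⟶ P.complex ⊞ _).f n).hom ?_
  rw [eq_top_iff]
  intro z _
  have hz := congr(($(biprod.total (X := P.complex) (Y := Q.complex)).f n).hom z)
  rw [← show _ = z from hz]
  exact Submodule.add_mem_sup ⟨(biprod.fst : P.complex ⊞ Q.complex ⟶ _).f n z, rfl⟩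
    ⟨(biprod.snd : P.complex ⊞ Q.complex ⟶ _).f n z, rfl⟩

theorem CdsLE.of_retract {R : Type} [Ring R] {M X : ModuleCat.{0} R} {f : ℕ → NNReal}
    (hX : ComplexityLE R X f) (i : M ⟶ X) (r : X ⟶ M) (hir : i ≫ r = 𝟙 M) : CdsLE R M f := by
  have hri (m : M) : r.hom (i.hom m) = m := congr($(hir).hom m)
  refine ⟨ModuleCat.of R (LinearMap.ker r.hom), hX.of_iso (LinearEquiv.toModuleIso
    (LinearEquiv.ofLinearMap
      (r.hom.prod ((LinearMap.id - i.hom ∘ₗ r.hom).codRestrict _ fun x ↦ by simp [hri]))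
      (i.hom.coprod (LinearMap.ker r.hom).subtype) ?_ ?_))⟩
  · ext x
    · simp [hri]
    · simp [hri]
    · simp
    · simp
  · ext x
    simp

theorem ModuleCat.exists_retraction_prod {R : Type} [Ring R] (L N : ModuleCat.{0} R) :
    ∃ (i : L ⟶ ModuleCat.of R (L × N)) (r : ModuleCat.of R (L × N) ⟶ L), i ≫ r = 𝟙 L :=
  ⟨ModuleCat.ofHom (LinearMap.inl R L N), ModuleCat.ofHom (LinearMap.fst R L N), rfl⟩

/-- A Frobenius system for a ring homomorphism `φ : R →+* A`: an `R`-bimodule map `E : A → R`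
together with finite dual bases `x` and `y` which are orthonormal with respect to `E`. -/
structure FrobeniusSystem {R A : Type} [Ring R] [Ring A] (φ : R →+* A) (ι : Type) [Fintype ι]
    [DecidableEq ι] where
  /-- the bimodule map -/
  E : A →+ R
  /-- the right basis -/
  x : ι → A
  /-- the left basis -/
  y : ι → A
  E_map_mul (r : R) (a : A) : E (φ r * a) = r * E a
  E_mul_map (a : A) (r : R) : E (a * φ r) = E a * r
  E_mul (i j : ι) : E (y i * x j) = if i = j then 1 else 0
  sum_x (a : A) : ∑ i, x i * φ (E (y i * a)) = a
  sum_y (a : A) : ∑ i, φ (E (a * x i)) * y i = a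

namespace FrobeniusSystem

variable {R A : Type} [Ring R] [Ring A] {φ : R →+* A} {ι : Type} [Fintype ι] [DecidableEq ι]
  (Φ : FrobeniusSystem φ ι)

theorem sum_E_mul_E (a b : A) : ∑ j, Φ.E (a * Φ.x j) * Φ.E (Φ.y j * b) = Φ.E (a * b) := by
  simp_rw [← Φ.E_mul_map, ← map_sum, mul_assoc, ← Finset.mul_sum, Φ.sum_x]

/-- The representation of `A` by matrices over `R` given by a Frobenius system. -/
def toMatrix : A →+* Matrix ι ι R where
  toFun a := Matrix.of fun i j ↦ Φ.E (Φ.y i * a * Φ.x j)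
  map_one' := by
    ext i j
    simp [Φ.E_mul, Matrix.one_apply]
  map_mul' a b := by
    ext i j
    simp only [Matrix.of_apply, Matrix.mul_apply]
    rw [show Φ.y i * (a * b) * Φ.x j = (Φ.y i * a) * (b * Φ.x j) by simp only [mul_assoc],
      ← Φ.sum_E_mul_E]
    simp only [mul_assoc]
  map_zero' := by ext; simp
  map_add' a b := by ext; simp [mul_add, add_mul]

/-- Induction of `R`-modules to `A`-modules along a Frobenius system. -/
def ind : ModuleCat.{0} R ⥤ ModuleCat.{0} A :=
  ModuleCat.toMatrixModCat R ι ⋙ ModuleCat.restrictScalars Φ.toMatrix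

/-- Elements of the induced module as tuples. -/
def indEquiv (P : ModuleCat.{0} R) : Φ.ind.obj P ≃+ (ι → P) := AddEquiv.refl _

theorem indEquiv_smul (P : ModuleCat.{0} R) (a : A) (v : Φ.ind.obj P) (i : ι) :
    Φ.indEquiv P (a • v) i = ∑ j, Φ.E (Φ.y i * a * Φ.x j) • Φ.indEquiv P v j := rfl

theorem ind_ext {P : ModuleCat.{0} R} {v w : Φ.ind.obj P}
    (h : ∀ i, Φ.indEquiv P v i = Φ.indEquiv P w i) : v = w :=
  (Φ.indEquiv P).injective (funext h)

instance : Φ.ind.Additive where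
  map_add {P Q f g} := by
    ext v
    exact Φ.ind_ext fun i ↦ rfl

instance : Φ.ind.PreservesHomology := by
  refine Functor.preservesHomology_of_map_exact _ fun S hS ↦ ?_
  rw [ShortComplex.moduleCat_exact_iff] at hS ⊢
  intro v hv
  choose w hw using fun i ↦ hS (Φ.indEquiv S.X₂ v i)
    (congrFun (congrArg (Φ.indEquiv S.X₃) hv) i)
  exact ⟨(Φ.indEquiv S.X₁).symm w, Φ.ind_ext hw⟩

/-- The unit of induction. -/
def indUnit (P : ModuleCat.{0} R) : P ⟶ (ModuleCat.restrictScalars φ).obj (Φ.ind.obj P) :=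
  ModuleCat.ofHom (Y := (ModuleCat.restrictScalars φ).obj (Φ.ind.obj P))
    { toFun := fun p ↦ (Φ.indEquiv P).symm fun i ↦ Φ.E (Φ.y i) • p
      map_add' := fun p q ↦ Φ.ind_ext fun i ↦ smul_add _ p q
      map_smul' := fun r p ↦ Φ.ind_ext fun i ↦ by
        change Φ.E (Φ.y i) • r • p = ∑ j, Φ.E (Φ.y i * φ r * Φ.x j) • Φ.E (Φ.y j) • p
        simp only [← mul_smul, ← Finset.sum_smul]
        rw [← Φ.E_mul_map]
        simpa using congr($((Φ.sum_E_mul_E (Φ.y i * φ r) 1).symm) • p) }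

theorem sum_x_smul_indUnit (P : ModuleCat.{0} R) (v : Φ.ind.obj P) :
    ∑ i, Φ.x i • (show Φ.ind.obj P from Φ.indUnit P (Φ.indEquiv P v i)) = v := by
  refine Φ.ind_ext fun l ↦ ?_
  have key (i : ι) :
      Φ.indEquiv P (Φ.x i • (show Φ.ind.obj P from Φ.indUnit P (Φ.indEquiv P v i))) l =
        (if l = i then (1 : R) else 0) • Φ.indEquiv P v i := by
    rw [Φ.indEquiv_smul, ← Φ.E_mul]
    change ∑ j, Φ.E (Φ.y l * Φ.x i * Φ.x j) • Φ.E (Φ.y j) • Φ.indEquiv P v i = _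
    simp only [← mul_smul, ← Finset.sum_smul]
    simpa using congr($(Φ.sum_E_mul_E (Φ.y l * Φ.x i) 1) • Φ.indEquiv P v i)
  rw [map_sum, Finset.sum_apply, Finset.sum_congr rfl fun i _ ↦ key i]
  simp

/-- The `A`-linear extension of an `R`-linear map to an `A`-module. -/
def indDesc {P : ModuleCat.{0} R} {X : ModuleCat.{0} A}
    (l : P ⟶ (ModuleCat.restrictScalars φ).obj X) : Φ.ind.obj P ⟶ X :=
  ModuleCat.ofHom (X := Φ.ind.obj P)
    { toFun := fun v ↦ ∑ i, Φ.x i • (show X from l (Φ.indEquiv P v i))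
      map_add' := fun v w ↦ by
        rw [← Finset.sum_add_distrib]
        refine Finset.sum_congr rfl fun i _ ↦ ?_
        rw [← smul_add]
        exact congrArg (Φ.x i • ·) (map_add l.hom _ _)
      map_smul' := fun a v ↦ by
        let l' : P → X := fun p ↦ l p
        have key (c : ι → R) (p : ι → P) : l' (∑ j, c j • p j) = ∑ j, φ (c j) • l' (p j) :=
          (map_sum l.hom _ _).trans (Finset.sum_congr rfl fun j _ ↦ map_smul l.hom _ _)
        change ∑ i, Φ.x i • l' (∑ j, Φ.E (Φ.y i * a * Φ.x j) • Φ.indEquiv P v j) =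
          a • ∑ i, Φ.x i • l' (Φ.indEquiv P v i)
        simp only [key, Finset.smul_sum, ← mul_smul]
        rw [Finset.sum_comm]
        refine Finset.sum_congr rfl fun j _ ↦ ?_
        rw [← Finset.sum_smul]
        simp only [mul_assoc, Φ.sum_x] }

theorem indDesc_indUnit {P : ModuleCat.{0} R} {X : ModuleCat.{0} A} (h : Φ.ind.obj P ⟶ X) :
    Φ.indDesc (Φ.indUnit P ≫ (ModuleCat.restrictScalars φ).map h) = h := by
  ext v
  refine Eq.trans ?_ (congrArg h (Φ.sum_x_smul_indUnit P v))
  refine Eq.trans (Finset.sum_congr rfl fun i _ ↦ ?_) (map_sum h.hom _ _).symm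
  exact (map_smul h.hom _ _).symm

theorem indDesc_comp {P : ModuleCat.{0} R} {X Y : ModuleCat.{0} A}
    (l : P ⟶ (ModuleCat.restrictScalars φ).obj X) (g : X ⟶ Y) :
    Φ.indDesc l ≫ g = Φ.indDesc (l ≫ (ModuleCat.restrictScalars φ).map g) := by
  ext v
  refine (map_sum g.hom _ _).trans (Finset.sum_congr rfl fun i _ ↦ ?_)
  exact map_smul g.hom _ _

instance : Φ.ind.PreservesProjectiveObjects where
  projective_obj {P} hP :=
    { factors := fun {X Y} h e he ↦ by
        have : Epi ((ModuleCat.restrictScalars φ).map e) := by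
          rw [ModuleCat.epi_iff_surjective] at he ⊢
          exact he
        let h' := Φ.indUnit P ≫ (ModuleCat.restrictScalars φ).map h
        refine ⟨Φ.indDesc (Projective.factorThru h' ((ModuleCat.restrictScalars φ).map e)), ?_⟩
        rw [indDesc_comp, Projective.factorThru_comp, indDesc_indUnit] }

theorem rankLE_ind {P : ModuleCat.{0} R} {b : NNReal} (h : RankLE R P b) :
    RankLE A (Φ.ind.obj P) b := by
  classical
  obtain ⟨s, hs, hb⟩ := h
  let u : P → Φ.ind.obj P := fun p ↦ Φ.indUnit P p
  refine ⟨s.image u, ?_, le_trans (mod_cast Finset.card_image_le) hb⟩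
  have hu (p : P) : u p ∈ Submodule.span A (s.image u : Set (Φ.ind.obj P)) := by
    have hp : p ∈ Submodule.span R (s : Set P) := hs ▸ Submodule.mem_top
    induction hp using Submodule.span_induction with
    | mem p hp => exact Submodule.subset_span (Finset.mem_coe.2 (Finset.mem_image_of_mem u hp))
    | zero =>
      rw [show u 0 = 0 from map_zero (Φ.indUnit P).hom]
      exact zero_mem _
    | add p q _ _ hp hq =>
      rw [show u (p + q) = u p + u q from map_add (Φ.indUnit P).hom p q]
      exact add_mem hp hq
    | smul r p _ hp =>
      rw [show u (r • p) = φ r • u p from map_smul (Φ.indUnit P).hom r p]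
      exact Submodule.smul_mem _ _ hp
  rw [eq_top_iff]
  intro v _
  rw [← Φ.sum_x_smul_indUnit P v]
  exact Submodule.sum_mem _ fun i _ ↦ Submodule.smul_mem _ _ (hu _)

theorem complexityLE_ind {P : ModuleCat.{0} R} {f : ℕ → NNReal} (h : ComplexityLE R P f) :
    ComplexityLE A (Φ.ind.obj P) f := by
  obtain ⟨Q, d, hd⟩ := h
  exact ⟨Φ.ind.mapProjectiveResolution Q, d, fun n ↦ Φ.rankLE_ind (hd n)⟩

/-- The embedding of an `A`-module into the module induced from its restriction. -/
def toIndRes (M : ModuleCat.{0} A) : M ⟶ Φ.ind.obj ((ModuleCat.restrictScalars φ).obj M) :=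
  ModuleCat.ofHom (Y := Φ.ind.obj ((ModuleCat.restrictScalars φ).obj M))
    { toFun := fun m ↦ (Φ.indEquiv _).symm fun i ↦ Φ.y i • m
      map_add' := fun m n ↦ Φ.ind_ext fun i ↦ smul_add (Φ.y i) m n
      map_smul' := fun a m ↦ Φ.ind_ext fun i ↦ by
        change Φ.y i • a • m = ∑ j, φ (Φ.E (Φ.y i * a * Φ.x j)) • Φ.y j • m
        simp only [← mul_smul, ← Finset.sum_smul, Φ.sum_y] }

theorem toIndRes_indDesc_apply (M : ModuleCat.{0} A) (m : M) :
    (Φ.toIndRes M ≫ Φ.indDesc (𝟙 _)) m = (∑ i, Φ.x i * Φ.y i) • m := by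
  rw [Finset.sum_smul]
  simp only [mul_smul]
  rfl

theorem exists_complexityLE_of_cdsLE {M : ModuleCat.{0} A} {f : ℕ → NNReal}
    (h : CdsLE R ((ModuleCat.restrictScalars φ).obj M) f) :
    ∃ X, ComplexityLE A X f ∧
      ∃ (i : M ⟶ X) (r : X ⟶ M), i ≫ r = Φ.toIndRes M ≫ Φ.indDesc (𝟙 _) := by
  obtain ⟨N, hN⟩ := h
  obtain ⟨i, r, hir⟩ := ModuleCat.exists_retraction_prod ((ModuleCat.restrictScalars φ).obj M) N
  refine ⟨_, Φ.complexityLE_ind hN, Φ.toIndRes M ≫ Φ.ind.map i,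
    Φ.ind.map r ≫ Φ.indDesc (𝟙 _), ?_⟩
  rw [Category.assoc, ← Φ.ind.map_comp_assoc, hir, Φ.ind.map_id, Category.id_comp]

end FrobeniusSystem

section GroupRing

variable (k : Type) [Ring k] {G : Type} [Group G] (S : Subgroup G)

open MonoidAlgebra

/-- The projection of a group ring onto the group ring of a subgroup. -/
def subgroupRingProj : MonoidAlgebra k G →+ MonoidAlgebra k S :=
  comapDomainAddMonoidHom S.subtype S.subtype_injective

variable {k S}

theorem subgroupRingProj_single_of_mem {g : G} (hg : g ∈ S) (c : k) :
    subgroupRingProj k S (single g c) = single ⟨g, hg⟩ c :=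
  comapDomain_single_map S.subtype S.subtype_injective ⟨g, hg⟩ c

theorem subgroupRingProj_single_of_notMem {g : G} (hg : g ∉ S) (c : k) :
    subgroupRingProj k S (single g c) = 0 :=
  comapDomain_single_of_not_mem_range (by simpa using hg) S.subtype_injective

theorem subgroupRingHom_single (s : S) (c : k) :
    subgroupRingHom k S (single s c) = single (s : G) c := by
  simp [subgroupRingHom]

theorem subgroupRingProj_map_mul (r : MonoidAlgebra k S) (a : MonoidAlgebra k G) :
    subgroupRingProj k S (subgroupRingHom k S r * a) = r * subgroupRingProj k S a := by
  induction r using MonoidAlgebra.induction_linear with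
  | zero => simp
  | add r r' hr hr' => simp [add_mul, hr, hr']
  | single s c =>
    induction a using MonoidAlgebra.induction_linear with
    | zero => simp
    | add a a' ha ha' => simp [mul_add, ha, ha']
    | single g d =>
      rw [subgroupRingHom_single, single_mul_single]
      by_cases hg : g ∈ S
      · rw [subgroupRingProj_single_of_mem hg, subgroupRingProj_single_of_mem (mul_mem s.2 hg),
          single_mul_single]
        rfl
      · rw [subgroupRingProj_single_of_notMem hg, subgroupRingProj_single_of_notMem
          (by rwa [S.mul_mem_cancel_left s.2]), mul_zero]

theorem subgroupRingProj_mul_map (a : MonoidAlgebra k G) (r : MonoidAlgebra k S) :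
    subgroupRingProj k S (a * subgroupRingHom k S r) = subgroupRingProj k S a * r := by
  induction r using MonoidAlgebra.induction_linear with
  | zero => simp
  | add r r' hr hr' => simp [mul_add, hr, hr']
  | single s c =>
    induction a using MonoidAlgebra.induction_linear with
    | zero => simp
    | add a a' ha ha' => simp [add_mul, ha, ha']
    | single g d =>
      rw [subgroupRingHom_single, single_mul_single]
      by_cases hg : g ∈ S
      · rw [subgroupRingProj_single_of_mem hg, subgroupRingProj_single_of_mem (mul_mem hg s.2),
          single_mul_single]
        rfl
      · rw [subgroupRingProj_single_of_notMem hg, subgroupRingProj_single_of_notMem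
          (by rwa [S.mul_mem_cancel_right s.2]), zero_mul]

variable (k S)

/-- The Frobenius system of a subgroup of finite index given by coset representatives. -/
def subgroupFrobeniusSystem [Fintype (G ⧸ S)] [DecidableEq (G ⧸ S)] :
    FrobeniusSystem (subgroupRingHom k S) (G ⧸ S) where
  E := subgroupRingProj k S
  x q := single q.out 1
  y q := single q.out⁻¹ 1
  E_map_mul := subgroupRingProj_map_mul
  E_mul_map := subgroupRingProj_mul_map
  E_mul p q := by
    rw [single_mul_single, mul_one]
    split_ifs with h
    · subst h
      rw [inv_mul_cancel]
      exact subgroupRingProj_single_of_mem (one_mem S) 1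
    · refine subgroupRingProj_single_of_notMem (fun hS ↦ h ?_) 1
      rwa [← QuotientGroup.eq, QuotientGroup.out_eq', QuotientGroup.out_eq'] at hS
  sum_x a := by
    induction a using MonoidAlgebra.induction_linear with
    | zero => simp
    | add a b ha hb => simp only [mul_add, map_add, Finset.sum_add_distrib, ha, hb]
    | single g c =>
      rw [Finset.sum_eq_single (g : G ⧸ S)]
      · have hg : (g : G ⧸ S).out⁻¹ * g ∈ S := by
          rw [← QuotientGroup.eq, QuotientGroup.out_eq']
        rw [single_mul_single, subgroupRingProj_single_of_mem hg, subgroupRingHom_single,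
          single_mul_single]
        simp
      · intro q _ hq
        rw [single_mul_single, subgroupRingProj_single_of_notMem, map_zero, mul_zero]
        rw [← QuotientGroup.eq, QuotientGroup.out_eq']
        exact hq
      · simp
  sum_y a := by
    induction a using MonoidAlgebra.induction_linear with
    | zero => simp
    | add a b ha hb => simp only [add_mul, map_add, Finset.sum_add_distrib, ha, hb]
    | single g c =>
      rw [Finset.sum_eq_single ((g⁻¹ : G) : G ⧸ S)]
      · have hg : g * ((g⁻¹ : G) : G ⧸ S).out ∈ S := by
          rw [← inv_inv g, ← QuotientGroup.eq, QuotientGroup.out_eq', inv_inv]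
        rw [single_mul_single, subgroupRingProj_single_of_mem hg, subgroupRingHom_single,
          single_mul_single]
        simp
      · intro q _ hq
        rw [single_mul_single, subgroupRingProj_single_of_notMem, map_zero, zero_mul]
        rw [← inv_inv g, ← QuotientGroup.eq, QuotientGroup.out_eq']
        exact hq.symm
      · simp

theorem exists_complexityLE_of_cdsLE_resMod [S.FiniteIndex] {M : ModuleCat.{0} (MonoidAlgebra k G)}
    {f : ℕ → NNReal} (h : CdsLE (MonoidAlgebra k S) (resMod k S M) f) :
    ∃ X, ComplexityLE (MonoidAlgebra k G) X f ∧
      ∃ (i : M ⟶ X) (r : X ⟶ M), i ≫ r = (S.index : ℤ) • 𝟙 M := by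
  classical
  have : Fintype (G ⧸ S) := Fintype.ofFinite _
  let Φ := subgroupFrobeniusSystem k S
  obtain ⟨X, hX, i, r, hir⟩ := Φ.exists_complexityLE_of_cdsLE (M := M) h
  refine ⟨X, hX, i, r, ?_⟩
  rw [hir]
  ext m
  refine (Φ.toIndRes_indDesc_apply M m).trans ?_
  have hsum : ∑ q : G ⧸ S, Φ.x q * Φ.y q = (S.index : MonoidAlgebra k G) := by
    rw [Finset.sum_congr rfl fun q _ ↦ show Φ.x q * Φ.y q = 1 from
      (single_mul_single ..).trans (by rw [mul_inv_cancel, mul_one]; rfl)]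
    simp [Subgroup.index, Nat.card_eq_fintype_card]
  rw [hsum, Nat.cast_smul_eq_nsmul]
  simp

end GroupRing

theorem cdsLE_of_forall_prime {R : Type} [Ring R] (M : ModuleCat.{0} R) (f : ℕ → NNReal)
    (n : ℕ → ℕ) (hn : ∀ p, p.Prime → ¬ p ∣ n p)
    (h : ∀ p, p.Prime → ∃ X, ComplexityLE R X f ∧
      ∃ (i : M ⟶ X) (r : X ⟶ M), i ≫ r = (n p : ℤ) • 𝟙 M) :
    CdsLE R M f := by
  let J : Ideal ℤ :=
    { carrier := {z | ∃ X, ComplexityLE R X f ∧ ∃ (i : M ⟶ X) (r : X ⟶ M), i ≫ r = z • 𝟙 M}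
      add_mem' := by
        rintro z w ⟨X, hX, i, r, hir⟩ ⟨Y, hY, j, s, hjs⟩
        exact ⟨X ⊞ Y, hX.biprod hY, biprod.lift i j, biprod.desc r s, by
          rw [biprod.lift_desc, hir, hjs, add_smul]⟩
      zero_mem' := by
        obtain ⟨X, hX, i, r, hir⟩ := h 2 Nat.prime_two
        exact ⟨X, hX, 0, r, by simp⟩
      smul_mem' := by
        rintro c z ⟨X, hX, i, r, hir⟩
        exact ⟨X, hX, c • i, r, by rw [Preadditive.zsmul_comp, hir, smul_smul, smul_eq_mul]⟩ }
  have hJ (p : ℕ) (hp : p.Prime) : (n p : ℤ) ∈ J := h p hp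
  have h1 : (1 : ℤ) ∈ J := by
    rw [← Ideal.eq_top_iff_one]
    obtain ⟨d, hd⟩ := (IsPrincipalIdealRing.principal J).principal
    rw [hd, Ideal.submodule_span_eq, Ideal.span_singleton_eq_top]
    by_contra hu
    obtain ⟨p, hp, hpd⟩ := Nat.exists_prime_and_dvd (mt Int.isUnit_iff_natAbs_eq.2 hu)
    have := hJ p hp
    rw [hd, Ideal.submodule_span_eq, Ideal.mem_span_singleton] at this
    exact hn p hp (Int.natCast_dvd_natCast.1 ((Int.natCast_dvd.2 hpd).trans this))
  obtain ⟨X, hX, i, r, hir⟩ := h1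
  exact CdsLE.of_retract hX i r (by rw [hir, one_smul])

/-- If `H` is a finite-index normal subgroup of `G` and `cds_{kS}(M) ≤ f` for every
subgroup `H ≤ S ≤ G` such that `S/H` is a `p`-Sylow subgroup of `G/H` for some prime `p`,
then `cds_{kG}(M) ≤ f`. -/
theorem cds_of_sylow_quotients
    (k : Type) [Ring k] (G : Type) [Group G]
    (H : Subgroup G) [H.Normal] [H.FiniteIndex]
    (M : ModuleCat.{0} (MonoidAlgebra k G))
    (f : ℕ → NNReal) (hf : IsProperComplexityFunction f)
    (hyp : ∀ (p : ℕ), p.Prime → ∀ S : Subgroup G, H ≤ S →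
      (∃ P : Sylow p (G ⧸ H), S.map (QuotientGroup.mk' H) = (P : Subgroup (G ⧸ H))) →
      CdsLE (MonoidAlgebra k S) (resMod k S M) f) :
    CdsLE (MonoidAlgebra k G) M f := by
  choose! P hP using fun (p : ℕ) (hp : p.Prime) ↦
    show ∃ P : Subgroup (G ⧸ H), ¬ p ∣ P.index ∧ ∃ Q : Sylow p (G ⧸ H), P = Q by
      have : Fact p.Prime := ⟨hp⟩
      let Q : Sylow p (G ⧸ H) := default
      exact ⟨Q, Q.not_dvd_index, Q, rfl⟩
  have hsurj := QuotientGroup.mk'_surjective H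
  have hindex (p : ℕ) : ((P p).comap (QuotientGroup.mk' H)).index = (P p).index :=
    (P p).index_comap_of_surjective hsurj
  have hle (p : ℕ) : H ≤ (P p).comap (QuotientGroup.mk' H) := by
    simpa using (QuotientGroup.mk' H).ker_le_comap (P p)
  refine cdsLE_of_forall_prime M f (fun p ↦ ((P p).comap (QuotientGroup.mk' H)).index)
    (fun p hp ↦ hindex p ▸ (hP p hp).1) fun p hp ↦ ?_
  obtain ⟨Q, hQ⟩ := (hP p hp).2
  have := Subgroup.finiteIndex_of_le (hle p)
  refine exists_complexityLE_of_cdsLE_resMod k _ (hyp p hp _ (hle p) ⟨Q, ?_⟩)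
  rw [Subgroup.map_comap_eq_self_of_surjective hsurj, hQ]
end
end
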